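/- There exists an absolute constant A ∈ ℕ (independent of p, q, d, n) with the following property. For every prime p, every q = p^k, every degree parameter d ∈ ℕ, every n ≥ s + t + 100, and every function f : F_q^n → F_q, the rejection probability of the sparse (s+t)-flat tester satisfies rej_{s+t}(f) ≥ q^{−A} · min(1, |supp(H)| · δ_d(f)). -/

import Mathlib

noncomputable section

open Finset

/-- Affine maps `F^ℓ → F^n`, given as a pair (linear part matrix, translation). -/
abbrev Aff (F : Type) (n ℓ : ℕ) := Matrix (Fin n) (Fin ℓ) F × (Fin n → F)

/-- Application of an affine map `T = (M, c)`: `x ↦ Mx + c`. -/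
def affApp {F : Type} [Field F] {n ℓ : ℕ} (T : Aff F n ℓ) (x : Fin ℓ → F) : Fin n → F :=
  T.1.mulVec x + T.2

/-- Inner product of two functions `F^m → F`. -/
def ip {F : Type} [Field F] [Fintype F] {m : ℕ} (u v : (Fin m → F) → F) : F :=
  ∑ z : Fin m → F, u z * v z

/-- `g` has degree at most `d` as a function. -/
def fDegLE {F : Type} [Field F] {m : ℕ} (g : (Fin m → F) → F) (d : ℕ) : Prop :=
  ∃ Q : MvPolynomial (Fin m) F, Q.totalDegree ≤ d ∧ ∀ x, MvPolynomial.eval x Q = g x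

/-- The defining equation of the polynomial `P`:
`x_1 ⋯ x_{p-1} · P = ∑_{I ⊆ [p-1]} (-1)^{|I|+1} (x_I + x_p)^{q-1}`. -/
def Pdef {F : Type} [Field F] (p q : ℕ) (hp : 0 < p) (P : MvPolynomial (Fin p) F) : Prop :=
  (∏ i : Fin (p - 1), MvPolynomial.X (Fin.castLE (Nat.sub_le p 1) i)) * P =
    ∑ I : Finset (Fin (p - 1)),
      MvPolynomial.C ((-1 : F) ^ (I.card + 1)) *
        ((∑ i ∈ I, MvPolynomial.X (Fin.castLE (Nat.sub_le p 1) i)) +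
          MvPolynomial.X (⟨p - 1, Nat.sub_lt hp one_pos⟩ : Fin p)) ^ (q - 1)

/-- The test polynomial `H_e` as a function on `F^{s+t}`. -/
def Hfun {F : Type} [Field F] {p : ℕ} (P : MvPolynomial (Fin p) F)
    (s t : ℕ) (e : Fin t → ℕ) (x : Fin (s + t) → F) : F :=
  (∏ i ∈ Finset.range (s / p),
    MvPolynomial.eval (fun l : Fin p =>
      if h : p * i + (l : ℕ) < s + t then x ⟨p * i + (l : ℕ), h⟩ else 0) P) *
  ∏ j : Fin t, x (Fin.natAdd s j) ^ e j

/-- A degree sequence `e ∈ {0, …, q-1}^t` is valid if `∑ e_j ≤ t(q-1) - r`. -/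
def validE (q r t : ℕ) (e : Fin t → ℕ) : Prop :=
  (∀ j, e j ≤ q - 1) ∧ ∑ j, e j ≤ t * (q - 1) - r

/-- `T` rejects `f` in the sparse `(s+t)`-flat test. -/
def rejects {F : Type} [Field F] [Fintype F] {p : ℕ} (P : MvPolynomial (Fin p) F)
    (q s r t n : ℕ) (f : (Fin n → F) → F) (T : Aff F n (s + t)) : Prop :=
  ∃ e : Fin t → ℕ, validE q r t e ∧ ip (fun x => f (affApp T x)) (Hfun P s t e) ≠ 0

/-- Density of `A` inside `C`. -/
def dens {α : Type} (A C : Set α) : ℝ :=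
  (Nat.card ↥(A ∩ C) : ℝ) / (Nat.card ↥C : ℝ)

/-- Fractional measure of a set in a (finite) type. -/
def mu {α : Type} (A : Set α) : ℝ :=
  (Nat.card ↥A : ℝ) / (Nat.card α : ℝ)

/-- The union of the supports of the test polynomials `H_e`. -/
def suppH {F : Type} [Field F] [Fintype F] {p : ℕ} (P : MvPolynomial (Fin p) F)
    (q s t : ℕ) : Set (Fin (s + t) → F) :=
  {x | ∃ e : Fin t → ℕ, (∀ j, e j ≤ q - 1) ∧ Hfun P s t e x ≠ 0}

/-- Edge expansion of a set `S` in the (regular) graph with adjacency `adj`: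
the probability that a uniformly random step started in `S` escapes `S`. -/
def expans {α : Type} (adj : α → α → Prop) (S : Set α) : ℝ :=
  (Nat.card {x : α × α // x.1 ∈ S ∧ adj x.1 x.2 ∧ x.2 ∉ S} : ℝ) /
  (Nat.card {x : α × α // x.1 ∈ S ∧ adj x.1 x.2} : ℝ)

/-- Adjacency in the affine bi-linear scheme graph: two distinct affine maps are adjacent
iff their agreement set is an affine subspace of dimension `ℓ - 1`. -/
def adjBilin {F : Type} [Field F] {n ℓ : ℕ} (T₁ T₂ : Aff F n ℓ) : Prop :=
  T₁ ≠ T₂ ∧ ∃ W : AffineSubspace F (Fin ℓ → F),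
    (W : Set (Fin ℓ → F)).Nonempty ∧
    (W : Set (Fin ℓ → F)) = {x | affApp T₁ x = affApp T₂ x} ∧
    Module.finrank F W.direction = ℓ - 1

/-- `W` is an `ℓ`-flat: a nonempty affine subspace of dimension `ℓ`. -/
def IsFlat {F : Type} [Field F] {N : ℕ} (ℓ : ℕ) (W : AffineSubspace F (Fin N → F)) : Prop :=
  (W : Set (Fin N → F)).Nonempty ∧ Module.finrank F W.direction = ℓ

/-- Adjacency in the affine Grassmann graph `AffGras(N, ℓ)`: two distinct `ℓ`-flats are
adjacent iff their intersection is an `(ℓ-1)`-flat. -/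
def adjGras {F : Type} [Field F] {N : ℕ} (ℓ : ℕ) (U V : AffineSubspace F (Fin N → F)) : Prop :=
  U ≠ V ∧ IsFlat ℓ U ∧ IsFlat ℓ V ∧ IsFlat (ℓ - 1) (U ⊓ V)

/-- The minimal fractional Hamming distance from `f` to a function of degree at most `d`. -/
def deltaDist {F : Type} [Field F] [Fintype F] {n : ℕ} (f : (Fin n → F) → F) (d : ℕ) : ℝ :=
  sInf {x : ℝ | ∃ g : (Fin n → F) → F, fDegLE g d ∧
    x = (Nat.card {y : Fin n → F // f y ≠ g y} : ℝ) / (Fintype.card (Fin n → F) : ℝ)}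

namespace SparseTester

set_option linter.unusedSectionVars false

/-! ### Real-valued indicators and counts -/

open Classical in
/-- Indicator of a proposition as a real number. -/
def ind (p : Prop) : ℝ := if p then 1 else 0

theorem ind_pos {p : Prop} (h : p) : ind p = 1 := by simp [ind, h]

theorem ind_neg {p : Prop} (h : ¬p) : ind p = 0 := by simp [ind, h]

theorem ind_nonneg (p : Prop) : 0 ≤ ind p := by unfold ind; split_ifs <;> norm_num

theorem ind_le_one (p : Prop) : ind p ≤ 1 := by unfold ind; split_ifs <;> norm_num

theorem ind_mono {p q : Prop} (h : p → q) : ind p ≤ ind q := by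
  by_cases hp : p
  · simp [ind_pos hp, ind_pos (h hp)]
  · simpa [ind_neg hp] using ind_nonneg q

theorem ind_and (p q : Prop) : ind (p ∧ q) = ind p * ind q := by
  by_cases hp : p <;> by_cases hq : q <;> simp [ind, hp, hq]

theorem ind_not (p : Prop) : ind (¬p) = 1 - ind p := by
  by_cases hp : p <;> simp [ind, hp]

theorem ind_or_le (p q : Prop) : ind (p ∨ q) ≤ ind p + ind q := by
  by_cases hp : p <;> by_cases hq : q <;> simp [ind, hp, hq]

theorem ind_exists_le {α : Type*} [Fintype α] (p : α → Prop) :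
    ind (∃ a, p a) ≤ ∑ a, ind (p a) := by
  by_cases h : ∃ a, p a
  · obtain ⟨a, ha⟩ := h
    rw [ind_pos ⟨a, ha⟩, ← ind_pos ha]
    exact single_le_sum (f := fun a => ind (p a)) (fun i _ => ind_nonneg _) (mem_univ a)
  · rw [ind_neg h]
    exact sum_nonneg fun i _ => ind_nonneg _

theorem sum_ind_eq {α : Type*} [Fintype α] (a : α) : ∑ x, ind (a = x) = 1 := by
  classical
  simp [ind]

theorem sum_ind_eq' {α : Type*} [Fintype α] (a : α) : ∑ x, ind (x = a) = 1 := by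
  classical
  simp [ind]

/-- The number of elements satisfying a predicate, as a real number. -/
def ct {α : Type*} [Fintype α] (p : α → Prop) : ℝ := ∑ x, ind (p x)

theorem ct_nonneg {α : Type*} [Fintype α] (p : α → Prop) : 0 ≤ ct p :=
  sum_nonneg fun _ _ => ind_nonneg _

theorem ct_mono {α : Type*} [Fintype α] {p q : α → Prop} (h : ∀ x, p x → q x) : ct p ≤ ct q :=
  sum_le_sum fun x _ => ind_mono (h x)

theorem ct_le_card {α : Type*} [Fintype α] (p : α → Prop) : ct p ≤ Fintype.card α := by
  calc ct p ≤ ∑ _x : α, (1 : ℝ) := sum_le_sum fun x _ => ind_le_one _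
    _ = _ := by simp

theorem ct_pos {α : Type*} [Fintype α] {p : α → Prop} (h : ∃ x, p x) : 1 ≤ ct p := by
  obtain ⟨a, ha⟩ := h
  rw [← ind_pos ha]
  exact single_le_sum (f := fun a => ind (p a)) (fun i _ => ind_nonneg _) (mem_univ a)

theorem exists_of_ct_pos {α : Type*} [Fintype α] {p : α → Prop} (h : 0 < ct p) : ∃ x, p x := by
  by_contra! hn
  have : ct p = 0 := sum_eq_zero fun x _ => ind_neg (hn x)
  linarith

theorem ct_eq_natCard {α : Type*} [Fintype α] (p : α → Prop) :
    ct p = (Nat.card {x // p x} : ℝ) := by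
  classical
  simp only [ct, ind]
  rw [sum_boole, Nat.card_eq_fintype_card, Fintype.card_subtype]

theorem ct_le_of_injective {α β : Type*} [Fintype α] [Fintype β] {p : α → Prop} {q : β → Prop}
    (g : α → β) (hg : ∀ x y, p x → p y → g x = g y → x = y) (hpq : ∀ x, p x → q (g x)) :
    ct p ≤ ct q := by
  rw [ct_eq_natCard, ct_eq_natCard]
  exact_mod_cast Nat.card_le_card_of_injective
    (fun x : {x // p x} => (⟨g x, hpq x x.2⟩ : {x // q x}))
    fun x y h => Subtype.ext (hg _ _ x.2 y.2 (congrArg Subtype.val h))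

theorem ct_equiv {α β : Type*} [Fintype α] [Fintype β] (e : α ≃ β) (p : β → Prop) :
    ct (fun x => p (e x)) = ct p :=
  e.sum_comp fun x => ind (p x)

theorem ct_not {α : Type*} [Fintype α] (p : α → Prop) :
    ct (fun x => ¬p x) = Fintype.card α - ct p := by
  simp [ct, ind_not, sum_sub_distrib]

theorem ct_or_le {α : Type*} [Fintype α] (p q : α → Prop) :
    ct (fun x => p x ∨ q x) ≤ ct p + ct q := by
  unfold ct
  rw [← sum_add_distrib]
  exact sum_le_sum fun x _ => ind_or_le _ _

theorem ct_exists_le {α γ : Type*} [Fintype α] [Fintype γ] (p : γ → α → Prop) :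
    ct (fun x => ∃ c, p c x) ≤ ∑ c, ct (p c) := by
  unfold ct
  rw [sum_comm]
  exact sum_le_sum fun x _ => ind_exists_le _

theorem ct_prod {α β : Type*} [Fintype α] [Fintype β] (p : α × β → Prop) :
    ct p = ∑ x, ct fun y => p (x, y) :=
  Fintype.sum_prod_type _

theorem ct_prod_right {α β : Type*} [Fintype α] [Fintype β] (p : α × β → Prop) :
    ct p = ∑ y, ct fun x => p (x, y) :=
  Fintype.sum_prod_type_right _

/-! ### Fourier analysis on `σ → F` -/

section Fourier
variable {F : Type} [Field F] [Fintype F] {σ : Type} [Fintype σ] [DecidableEq σ]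

/-- A fixed primitive additive character of the finite field `F`. -/
def chi (F : Type) [Field F] [Fintype F] : AddChar F ℂ :=
  AddChar.FiniteField.primitiveChar_to_Complex F

theorem chi_neg (x : F) : chi F (-x) = (starRingEnd ℂ) (chi F x) :=
  AddChar.map_neg_eq_conj _ _

theorem chi_add (x y : F) : chi F (x + y) = chi F x * chi F y :=
  AddChar.map_add_eq_mul _ _ _

theorem sum_chi_dot_of_ne (v : σ → F) (hv : v ≠ 0) : ∑ z : σ → F, chi F (v ⬝ᵥ z) = 0 := by
  obtain ⟨i, hi⟩ : ∃ i, v i ≠ 0 := by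
    by_contra! h
    exact hv (funext h)
  obtain ⟨y, hy⟩ : ∃ y, chi F (v i * y) ≠ 1 := by
    by_contra! h
    apply AddChar.FiniteField.primitiveChar_to_Complex_isPrimitive F hi
    ext y
    simpa [AddChar.mulShift_apply, chi] using h y
  have key : ∑ z : σ → F, chi F (v ⬝ᵥ z) = chi F (v i * y) * ∑ z : σ → F, chi F (v ⬝ᵥ z) := by
    rw [mul_sum, ← Equiv.sum_comp (Equiv.addLeft (Pi.single i y))]
    refine sum_congr rfl fun z _ => ?_
    simp [dotProduct_add, chi_add]
  have h0 : (chi F (v i * y) - 1) * ∑ z : σ → F, chi F (v ⬝ᵥ z) = 0 := by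
    rw [sub_mul, one_mul, ← key, sub_self]
  exact (mul_eq_zero.1 h0).resolve_left (sub_ne_zero.2 hy)

theorem sum_chi_dot_zero :
    ∑ z : σ → F, chi F ((0 : σ → F) ⬝ᵥ z) = (Fintype.card (σ → F) : ℂ) := by
  simp

/-- The Fourier sum with coefficients `α`. -/
def ft (α : (σ → F) → ℂ) (z : σ → F) : ℂ := ∑ v, α v * chi F (v ⬝ᵥ z)

theorem sum_ft_mul_conj (α β : (σ → F) → ℂ) :
    ∑ z, ft α z * (starRingEnd ℂ) (ft β z) =
      Fintype.card (σ → F) * ∑ v, α v * (starRingEnd ℂ) (β v) := by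
  classical
  have h1 : ∀ z, ft α z * (starRingEnd ℂ) (ft β z) =
      ∑ v, ∑ w, α v * (starRingEnd ℂ) (β w) * chi F ((v - w) ⬝ᵥ z) := by
    intro z
    unfold ft
    rw [map_sum, sum_mul_sum]
    refine sum_congr rfl fun v _ => sum_congr rfl fun w _ => ?_
    rw [sub_dotProduct, sub_eq_add_neg, chi_add, chi_neg, map_mul]
    ring
  simp only [h1]
  rw [sum_comm, mul_sum]
  refine sum_congr rfl fun v _ => ?_
  rw [sum_comm, sum_eq_single v]
  · rw [← mul_sum, sub_self, sum_chi_dot_zero]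
    ring
  · intro w _ hw
    rw [← mul_sum, sum_chi_dot_of_ne _ (sub_ne_zero.2 hw.symm), mul_zero]
  · simp

theorem sum_norm_ft_sq (α : (σ → F) → ℂ) :
    ∑ z, ‖ft α z‖ ^ 2 = Fintype.card (σ → F) * ∑ v, ‖α v‖ ^ 2 := by
  have := sum_ft_mul_conj α α
  simp only [Complex.mul_conj'] at this
  exact_mod_cast this

/-- Additive self-convolution. -/
def conv (α : (σ → F) → ℂ) (C : σ → F) : ℂ := ∑ B, α B * α (C - B)

theorem ft_sq (α : (σ → F) → ℂ) (z : σ → F) : ft α z ^ 2 = ft (conv α) z := by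
  unfold ft conv
  rw [sq, sum_mul_sum]
  simp only [sum_mul]
  conv_rhs => rw [sum_comm]
  refine sum_congr rfl fun B _ => ?_
  rw [← Equiv.sum_comp (Equiv.subRight B)]
  refine sum_congr rfl fun C _ => ?_
  simp only [Equiv.subRight_apply]
  have : chi F (C ⬝ᵥ z) = chi F (B ⬝ᵥ z) * chi F ((C - B) ⬝ᵥ z) := by
    rw [← chi_add, ← add_dotProduct]
    congr 2
    abel
  rw [this]
  ring

theorem sum_norm_ft_pow_four (α : (σ → F) → ℂ) :
    ∑ z, ‖ft α z‖ ^ 4 = Fintype.card (σ → F) * ∑ C, ‖conv α C‖ ^ 2 := by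
  rw [← sum_norm_ft_sq]
  refine sum_congr rfl fun z _ => ?_
  rw [← ft_sq, norm_pow]
  ring

theorem sum_norm_conv_sq_le (α : (σ → F) → ℂ) {ε : ℝ} (h : ∀ z, ‖ft α z‖ ≤ ε) :
    ∑ C, ‖conv α C‖ ^ 2 ≤ ε ^ 2 * ∑ v, ‖α v‖ ^ 2 := by
  have hc : (0 : ℝ) < Fintype.card (σ → F) := by exact_mod_cast Fintype.card_pos
  refine le_of_mul_le_mul_left ?_ hc
  rw [← sum_norm_ft_pow_four]
  calc ∑ z, ‖ft α z‖ ^ 4 ≤ ∑ z, ε ^ 2 * ‖ft α z‖ ^ 2 := by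
        refine sum_le_sum fun z _ => ?_
        have h2 : ‖ft α z‖ ^ 2 ≤ ε ^ 2 := pow_le_pow_left₀ (norm_nonneg _) (h z) 2
        nlinarith [sq_nonneg ‖ft α z‖]
    _ = _ := by rw [← mul_sum, sum_norm_ft_sq]; ring

/-- The Fourier transform of the indicator of `S`. -/
def hatS (S : (σ → F) → Prop) (B : σ → F) : ℂ := ft (fun T => (ind (S T) : ℂ)) B

theorem hatS_zero (S : (σ → F) → Prop) : hatS S 0 = (ct S : ℂ) := by
  simp [hatS, ft, ct]

theorem hatS_neg (S : (σ → F) → Prop) (B : σ → F) :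
    hatS S (-B) = (starRingEnd ℂ) (hatS S B) := by
  simp [hatS, ft, chi_neg]

theorem sum_norm_hatS_sq (S : (σ → F) → Prop) :
    ∑ B, ‖hatS S B‖ ^ 2 = Fintype.card (σ → F) * ct S := by
  unfold hatS
  rw [sum_norm_ft_sq]
  congr 1
  refine sum_congr rfl fun T _ => ?_
  by_cases h : S T <;> simp [ind, h]

theorem autocorrelation (S : (σ → F) → Prop) (D : σ → F) :
    (Fintype.card (σ → F) : ℂ) * ((∑ T, ind (S T) * ind (S (T + D)) : ℝ) : ℂ) =
      ∑ B, ((‖hatS S B‖ ^ 2 : ℝ) : ℂ) * chi F (D ⬝ᵥ B) := by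
  have h1 : ∀ B, ((‖hatS S B‖ ^ 2 : ℝ) : ℂ) * chi F (D ⬝ᵥ B) =
      ft (fun T => (ind (S (T - D)) : ℂ)) B * (starRingEnd ℂ) (hatS S B) := by
    intro B
    have : ft (fun T => (ind (S (T - D)) : ℂ)) B = hatS S B * chi F (D ⬝ᵥ B) := by
      unfold hatS ft
      rw [sum_mul, ← Equiv.sum_comp (Equiv.addRight D)]
      refine sum_congr rfl fun T _ => ?_
      simp [add_dotProduct, chi_add, mul_assoc]
    rw [this, mul_right_comm, Complex.mul_conj']
    push_cast
    ring
  simp only [h1]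
  unfold hatS
  rw [sum_ft_mul_conj]
  congr 1
  push_cast
  conv_rhs => rw [← Equiv.sum_comp (Equiv.addRight D)]
  refine sum_congr rfl fun T _ => ?_
  simp

end Fourier

/-! ### Matrices indexed by pairs -/

section Mat
variable {F : Type} [Field F] [Fintype F] {ι κ : Type} [Fintype ι] [DecidableEq ι]
  [Fintype κ] [DecidableEq κ]

/-- Matrix-vector product for a matrix indexed by pairs. -/
def mv (T : ι × κ → F) (w : κ → F) : ι → F := fun i => ∑ k, T (i, k) * w k

/-- Vector-matrix product for a matrix indexed by pairs. -/
def vm (v : ι → F) (T : ι × κ → F) : κ → F := fun k => ∑ i, v i * T (i, k)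

/-- The rank-one matrix `u ⊗ w`. -/
def tens (u : ι → F) (w : κ → F) : ι × κ → F := fun p => u p.1 * w p.2

theorem mv_add (T T' : ι × κ → F) (w : κ → F) : mv (T + T') w = mv T w + mv T' w := by
  ext i
  simp [mv, add_mul, sum_add_distrib]

theorem mv_add_right (T : ι × κ → F) (w w' : κ → F) : mv T (w + w') = mv T w + mv T w' := by
  ext i
  simp [mv, mul_add, sum_add_distrib]

theorem mv_smul (T : ι × κ → F) (c : F) (w : κ → F) : mv T (c • w) = c • mv T w := by
  ext i
  simp only [mv, Pi.smul_apply, smul_eq_mul, mul_sum]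
  exact sum_congr rfl fun k _ => by ring

theorem mv_tens (u : ι → F) (l w : κ → F) : mv (tens u l) w = (l ⬝ᵥ w) • u := by
  ext i
  simp only [mv, tens, Pi.smul_apply, smul_eq_mul, dotProduct, sum_mul]
  exact sum_congr rfl fun k _ => by ring

theorem vm_add (v : ι → F) (T T' : ι × κ → F) : vm v (T + T') = vm v T + vm v T' := by
  ext i
  simp [vm, mul_add, sum_add_distrib]

theorem vm_tens (v u : ι → F) (l : κ → F) : vm v (tens u l) = (v ⬝ᵥ u) • l := by
  ext i
  simp only [vm, tens, Pi.smul_apply, smul_eq_mul, dotProduct, sum_mul]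
  exact sum_congr rfl fun k _ => by ring

theorem tens_dot (u : ι → F) (w : κ → F) (T : ι × κ → F) :
    tens u w ⬝ᵥ T = u ⬝ᵥ mv T w := by
  simp only [dotProduct, tens, mv, Fintype.sum_prod_type, mul_sum]
  exact sum_congr rfl fun k _ => sum_congr rfl fun k _ => by ring

theorem tens_dot' (u : ι → F) (w : κ → F) (T : ι × κ → F) :
    tens u w ⬝ᵥ T = w ⬝ᵥ vm u T := by
  simp only [dotProduct, tens, vm, Fintype.sum_prod_type_right, mul_sum]
  exact sum_congr rfl fun k _ => sum_congr rfl fun k _ => by ring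

theorem add_tens (u u' : ι → F) (w : κ → F) : tens (u + u') w = tens u w + tens u' w := by
  ext p
  simp [tens, add_mul]

theorem tens_zero (u : ι → F) : tens u (0 : κ → F) = 0 := by
  ext p
  simp [tens]

theorem zero_tens (w : κ → F) : tens (0 : ι → F) w = 0 := by
  ext p
  simp [tens]

theorem tens_smul (u : ι → F) (c : F) (w : κ → F) : tens u (c • w) = tens (c • u) w := by
  ext p
  simp only [tens, Pi.smul_apply, smul_eq_mul]
  ring

/-- Rank-one matrices. -/
def RankOne (B : ι × κ → F) : Prop := B ≠ 0 ∧ ∃ v w, B = tens v w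

/-- The linear map attached to a matrix. -/
def mvLin (B : ι × κ → F) : (κ → F) →ₗ[F] (ι → F) where
  toFun := mv B
  map_add' := mv_add_right B
  map_smul' := mv_smul B

/-- Size of the kernel of a matrix. -/
def kerCt (B : ι × κ → F) : ℝ := ct fun l => mv B l = 0

theorem kerCt_eq (B : ι × κ → F) :
    kerCt B * (Fintype.card F : ℝ) ^ Module.finrank F (LinearMap.range (mvLin B)) =
      (Fintype.card F : ℝ) ^ Fintype.card κ := by
  have h1 : kerCt B = (Fintype.card F : ℝ) ^ Module.finrank F (LinearMap.ker (mvLin B)) := by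
    unfold kerCt
    rw [ct_eq_natCard]
    have : Nat.card {l // mv B l = 0} = Nat.card (LinearMap.ker (mvLin B)) := rfl
    rw [this, Module.natCard_eq_pow_finrank (K := F), Nat.card_eq_fintype_card]
    push_cast
    rfl
  rw [h1, ← pow_add, add_comm, LinearMap.finrank_range_add_finrank_ker, Module.finrank_pi]

theorem kerCt_zero : kerCt (0 : ι × κ → F) = (Fintype.card F : ℝ) ^ Fintype.card κ := by
  have h : ∀ l : κ → F, mv (0 : ι × κ → F) l = 0 := fun l => by ext i; simp [mv]
  simp [kerCt, ct, ind, h]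

theorem mv_single (B : ι × κ → F) (k : κ) : mv B (Pi.single k 1) = fun i => B (i, k) := by
  ext i
  simp [mv, Pi.single_apply]

theorem eq_tens_of_finrank_le_one (B : ι × κ → F)
    (h : Module.finrank F (LinearMap.range (mvLin B)) ≤ 1) : ∃ v w, B = tens v w := by
  rw [finrank_le_one_iff] at h
  obtain ⟨v, hv⟩ := h
  choose c hc using fun k => hv ⟨mv B (Pi.single k 1), ⟨_, rfl⟩⟩
  refine ⟨v, c, ?_⟩
  ext ⟨i, k⟩
  have h1 : c k • (v : ι → F) = mv B (Pi.single k 1) := congrArg Subtype.val (hc k)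
  have := congrFun h1 i
  rw [mv_single] at this
  simp only [Pi.smul_apply, smul_eq_mul] at this
  simp only [tens]
  rw [← this]
  ring

theorem eq_zero_of_finrank_eq_zero (B : ι × κ → F)
    (h : Module.finrank F (LinearMap.range (mvLin B)) = 0) : B = 0 := by
  have h1 : LinearMap.range (mvLin B) = ⊥ := Submodule.finrank_eq_zero.1 h
  have h2 := LinearMap.range_eq_bot.1 h1
  ext ⟨i, k⟩
  have := congrFun (LinearMap.congr_fun h2 (Pi.single k 1)) i
  change mv B (Pi.single k 1) i = 0 at this
  rw [mv_single] at this
  exact this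

theorem one_le_card_field (F : Type) [Field F] [Fintype F] : (1 : ℝ) ≤ Fintype.card F := by
  exact_mod_cast Fintype.card_pos (α := F)

theorem kerCt_le (B : ι × κ → F) (hB : B ≠ 0) :
    kerCt B * (Fintype.card F : ℝ) ≤ (Fintype.card F : ℝ) ^ Fintype.card κ := by
  rw [← kerCt_eq B]
  refine mul_le_mul_of_nonneg_left ?_ (ct_nonneg _)
  refine le_self_pow₀ (one_le_card_field F) fun h => hB ?_
  exact eq_zero_of_finrank_eq_zero B h

theorem kerCt_le_of_not_rankOne (B : ι × κ → F) (hB : B ≠ 0) (h1 : ¬RankOne B) :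
    kerCt B * (Fintype.card F : ℝ) ^ 2 ≤ (Fintype.card F : ℝ) ^ Fintype.card κ := by
  rw [← kerCt_eq B]
  refine mul_le_mul_of_nonneg_left ?_ (ct_nonneg _)
  refine pow_le_pow_right₀ (one_le_card_field F) ?_
  by_contra! h
  exact h1 ⟨hB, eq_tens_of_finrank_le_one B (by omega)⟩

/-- The average of shifted correlations along rank-one directions, on the Fourier side. -/
theorem sum_correlation (S : (ι × κ → F) → Prop) :
    (Fintype.card (ι × κ → F) : ℝ) *
      (∑ u : ι → F, ∑ l : κ → F, ∑ T, ind (S T) * ind (S (T + tens u l))) =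
      (Fintype.card F : ℝ) ^ Fintype.card ι * ∑ B, ‖hatS S B‖ ^ 2 * kerCt B := by
  have key : ((Fintype.card (ι × κ → F) : ℝ) *
      (∑ u : ι → F, ∑ l : κ → F, ∑ T, ind (S T) * ind (S (T + tens u l))) : ℝ) =
      (((Fintype.card F : ℝ) ^ Fintype.card ι * ∑ B, ‖hatS S B‖ ^ 2 * kerCt B : ℝ) : ℂ) := by
    have h1 : ∀ l : κ → F, ∀ B : ι × κ → F, ∑ u : ι → F, chi F (tens u l ⬝ᵥ B) =
        (Fintype.card F : ℂ) ^ Fintype.card ι * (ind (mv B l = 0) : ℝ) := by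
      intro l B
      simp only [tens_dot]
      by_cases h : mv B l = 0
      · simp [h, ind]
      · rw [ind_neg h]
        simp only [dotProduct_comm _ (mv B l)]
        rw [sum_chi_dot_of_ne _ h]
        simp
    have h2 : (((Fintype.card (ι × κ → F) : ℝ) *
      (∑ u : ι → F, ∑ l : κ → F, ∑ T, ind (S T) * ind (S (T + tens u l))) : ℝ) : ℂ) =
      ∑ u : ι → F, ∑ l : κ → F, ∑ B, ((‖hatS S B‖ ^ 2 : ℝ) : ℂ) * chi F (tens u l ⬝ᵥ B) := by
      simp only [← autocorrelation]
      simp only [← mul_sum, ← Complex.ofReal_sum]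
      push_cast
      rfl
    rw [h2, sum_comm]
    have h3 : ∀ l : κ → F, ∑ u : ι → F, ∑ B, ((‖hatS S B‖ ^ 2 : ℝ) : ℂ) * chi F (tens u l ⬝ᵥ B)
        = ∑ B, ((‖hatS S B‖ ^ 2 : ℝ) : ℂ) *
          ((Fintype.card F : ℂ) ^ Fintype.card ι * (ind (mv B l = 0) : ℝ)) := by
      intro l
      rw [sum_comm]
      refine sum_congr rfl fun B _ => ?_
      rw [← mul_sum, h1]
    simp only [h3]
    rw [sum_comm]
    simp only [kerCt, ct]
    push_cast
    simp only [mul_sum]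
    refine sum_congr rfl fun B _ => sum_congr rfl fun l _ => by ring
  exact_mod_cast key

end Mat

section Conv
variable {F : Type} [Field F] [Fintype F] {ι κ : Type} [Fintype ι] [DecidableEq ι]
  [Fintype κ] [DecidableEq κ]

theorem tens_ne_zero {v : ι → F} {w : κ → F} (hv : v ≠ 0) (hw : w ≠ 0) : tens v w ≠ 0 := by
  obtain ⟨i, hi⟩ := Function.ne_iff.1 hv
  obtain ⟨k, hk⟩ := Function.ne_iff.1 hw
  intro h
  exact mul_ne_zero hi hk (congrFun h (i, k))

theorem left_ne_zero_of_tens {v : ι → F} {w : κ → F} (h : tens v w ≠ 0) : v ≠ 0 := by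
  rintro rfl
  exact h (zero_tens w)

theorem right_ne_zero_of_tens {v : ι → F} {w : κ → F} (h : tens v w ≠ 0) : w ≠ 0 := by
  rintro rfl
  exact h (tens_zero v)

/-- Swapping the two sides of a matrix. -/
def transp (B : ι × κ → F) : κ × ι → F := fun p => B (p.2, p.1)

theorem transp_tens (v : ι → F) (w : κ → F) : transp (tens v w) = tens w v := by
  ext p
  simp [transp, tens, mul_comm]

theorem transp_add (B B' : ι × κ → F) : transp (B + B') = transp B + transp B' := rfl

theorem right_parallel {x v : ι → F} {w w' : κ → F} (h : tens x w = tens v w')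
    (hv : v ≠ 0) (hw : w' ≠ 0) : ∃ c : F, w = c • w' := by
  obtain ⟨i, hi⟩ := Function.ne_iff.1 hv
  obtain ⟨k, hk⟩ := Function.ne_iff.1 hw
  have h1 : ∀ k, x i * w k = v i * w' k := fun k => congrFun h (i, k)
  have hx : x i ≠ 0 := by
    intro h0
    have := h1 k
    rw [h0, zero_mul] at this
    exact mul_ne_zero hi hk this.symm
  refine ⟨v i / x i, ?_⟩
  ext k
  simp only [Pi.smul_apply, smul_eq_mul]
  field_simp
  linear_combination h1 k

theorem left_parallel {x v : ι → F} {w w' : κ → F} (h : tens x w = tens v w')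
    (hv : v ≠ 0) (hw : w' ≠ 0) : ∃ c : F, x = c • v := by
  have h' : tens w x = tens w' v := by
    rw [← transp_tens x w, ← transp_tens v w', h]
  exact right_parallel h' hw hv

theorem rank_one_sum {v v' v0 : ι → F} {w w' w0 : κ → F}
    (h : tens v w + tens v' w' = tens v0 w0) (hv0 : v0 ≠ 0) (hw0 : w0 ≠ 0) (hw : w ≠ 0)
    : (∃ x, tens v w = tens x w0) ∨ ∃ y, tens v w = tens v0 y := by
  obtain ⟨i0, hi0⟩ := Function.ne_iff.1 hv0
  obtain ⟨k0, hk0⟩ := Function.ne_iff.1 hw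
  by_cases hc : ∀ i, v0 i0 * v i = v i0 * v0 i
  · right
    refine ⟨(v i0 / v0 i0) • w, ?_⟩
    rw [tens_smul]
    congr 1
    ext i
    simp only [Pi.smul_apply, smul_eq_mul]
    have := hc i
    simp only [Pi.zero_apply] at hi0
    field_simp
    linear_combination this
  · left
    push Not at hc
    obtain ⟨i, hi⟩ := hc
    have hij : ∀ j k, v j * w k + v' j * w' k = v0 j * w0 k := fun j k => congrFun h (j, k)
    set A := v0 i0 * v i - v i0 * v0 i with hA
    set A' := v0 i0 * v' i - v' i0 * v0 i with hA'
    have hAne : A ≠ 0 := sub_ne_zero.2 hi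
    have h1 : ∀ k, A * w k + A' * w' k = 0 := by
      intro k
      simp only [hA, hA']
      linear_combination v0 i0 * hij i k - v0 i * hij i0 k
    have hA'ne : A' ≠ 0 := by
      intro h0
      have := h1 k0
      rw [h0, zero_mul, add_zero] at this
      exact mul_ne_zero hAne hk0 this
    have hw' : w' = (-A / A') • w := by
      ext k
      simp only [Pi.smul_apply, smul_eq_mul]
      field_simp
      linear_combination h1 k
    rw [hw', tens_smul, ← add_tens] at h
    obtain ⟨c, hc⟩ := right_parallel h hv0 hw0
    exact ⟨c • v, by rw [hc, tens_smul]⟩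

theorem mem_span_of_rank_two {v v' v1 v2 : ι → F} {w w' w1 w2 : κ → F}
    (h : tens v w + tens v' w' = tens v1 w1 + tens v2 w2)
    (hC : ¬∃ x y, tens v w + tens v' w' = tens x y) : ∃ α β : F, α • v1 + β • v2 = v := by
  set C := tens v w + tens v' w' with hCdef
  have hrange : ∀ {a a' : ι → F} {b b' : κ → F}, C = tens a b + tens a' b' →
      LinearMap.range (mvLin C) = Submodule.span F {a, a'} := by
    intro a a' b b' hab
    refine Submodule.eq_of_le_of_finrank_le ?_ ?_
    · rintro _ ⟨l, rfl⟩
      change mv C l ∈ _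
      rw [hab, mv_add, mv_tens, mv_tens]
      exact Submodule.mem_span_pair.2 ⟨_, _, rfl⟩
    · classical
      refine le_trans (b := 2) ?_ ?_
      · have h1 := finrank_span_finset_le_card (R := F) ({a, a'} : Finset (ι → F))
        rw [coe_pair] at h1
        exact h1.trans card_le_two
      · by_contra! hlt
        exact hC (eq_tens_of_finrank_le_one C (by omega))
  have hv : v ∈ Submodule.span F {v1, v2} := by
    rw [← hrange h, hrange hCdef]
    exact Submodule.subset_span (by simp)
  exact Submodule.mem_span_pair.1 hv

theorem conv_sq_le (a : (ι × κ → F) → ℂ) (C : ι × κ → F) {K : ℝ}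
    (hK : ct (fun B => a B ≠ 0 ∧ a (C - B) ≠ 0) ≤ K) :
    ‖conv a C‖ ^ 2 ≤ K * ∑ B, ‖a B‖ ^ 2 * ‖a (C - B)‖ ^ 2 := by
  have h1 : ‖conv a C‖ ≤ ∑ B, ind (a B ≠ 0 ∧ a (C - B) ≠ 0) * (‖a B‖ * ‖a (C - B)‖) := by
    refine (norm_sum_le _ _).trans (sum_le_sum fun B _ => ?_)
    rw [norm_mul]
    by_cases h : a B ≠ 0 ∧ a (C - B) ≠ 0
    · rw [ind_pos h, one_mul]
    · rw [ind_neg h, zero_mul]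
      rw [not_and_or, not_not, not_not] at h
      rcases h with h | h <;> simp [h]
  calc ‖conv a C‖ ^ 2 ≤ (∑ B, ind (a B ≠ 0 ∧ a (C - B) ≠ 0) * (‖a B‖ * ‖a (C - B)‖)) ^ 2 :=
        pow_le_pow_left₀ (norm_nonneg _) h1 2
    _ ≤ (∑ B, ind (a B ≠ 0 ∧ a (C - B) ≠ 0) ^ 2) * ∑ B, (‖a B‖ * ‖a (C - B)‖) ^ 2 :=
        sum_mul_sq_le_sq_mul_sq _ _ _
    _ ≤ _ := by
        have h2 : ∑ B, ind (a B ≠ 0 ∧ a (C - B) ≠ 0) ^ 2 = ct (fun B => a B ≠ 0 ∧ a (C - B) ≠ 0) := by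
          refine sum_congr rfl fun B _ => ?_
          rw [sq, ← ind_and, and_self]
        rw [h2]
        simp only [mul_pow]
        exact mul_le_mul_of_nonneg_right hK (sum_nonneg fun B _ => by positivity)

theorem rank_two_count (a : (ι × κ → F) → ℂ) (ha : ∀ B, a B ≠ 0 → RankOne B)
    (C : ι × κ → F) (hC0 : C ≠ 0) (hC : ¬RankOne C) :
    ct (fun B => a B ≠ 0 ∧ a (C - B) ≠ 0) ≤ (Fintype.card F : ℝ) ^ 4 := by
  by_cases hne : ∃ B, a B ≠ 0 ∧ a (C - B) ≠ 0
  swap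
  · have : ct (fun B => a B ≠ 0 ∧ a (C - B) ≠ 0) = 0 :=
      sum_eq_zero fun B _ => ind_neg fun h => hne ⟨B, h⟩
    rw [this]
    positivity
  obtain ⟨B0, h0, h0'⟩ := hne
  obtain ⟨-, v1, w1, hB0⟩ := ha _ h0
  obtain ⟨-, v2, w2, hB0'⟩ := ha _ h0'
  have hC' : ¬∃ x y, C = tens x y := fun ⟨x, y, h⟩ => hC ⟨hC0, x, y, h⟩
  have e0 : C = tens v1 w1 + tens v2 w2 := by rw [← hB0, ← hB0']; abel
  have hex : ∀ B, a B ≠ 0 ∧ a (C - B) ≠ 0 → ∃ c : F × F × F × F,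
      B = tens (c.1 • v1 + c.2.1 • v2) (c.2.2.1 • w1 + c.2.2.2 • w2) := by
    rintro B ⟨h, h'⟩
    obtain ⟨-, v, w, hB⟩ := ha _ h
    obtain ⟨-, v', w', hB'⟩ := ha _ h'
    have e1 : tens v w + tens v' w' = C := by rw [← hB, ← hB']; abel
    obtain ⟨α, β, hv⟩ := mem_span_of_rank_two (e1.trans e0) (by rwa [e1])
    have htr : tens w v + tens w' v' = tens w1 v1 + tens w2 v2 := by
      have := congrArg transp (e1.trans e0)
      simpa only [transp_add, transp_tens] using this
    obtain ⟨γ, δ, hw⟩ := mem_span_of_rank_two htr (by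
      rintro ⟨x, y, hxy⟩
      apply hC'
      refine ⟨y, x, ?_⟩
      rw [← e1, ← transp_tens x y, ← hxy, transp_add, transp_tens, transp_tens])
    exact ⟨(α, β, γ, δ), by simp only [hv, hw, hB]⟩
  choose! g hg using hex
  calc ct (fun B => a B ≠ 0 ∧ a (C - B) ≠ 0) ≤ ct (fun _ : F × F × F × F => True) :=
        ct_le_of_injective g (fun x y hx hy h => by rw [hg x hx, hg y hy, h]) fun _ _ => trivial
    _ ≤ Fintype.card (F × F × F × F) := ct_le_card _
    _ = _ := by
        simp only [Fintype.card_prod]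
        push_cast
        ring

theorem conv_rank_one_le (a : (ι × κ → F) → ℂ) (ha : ∀ B, a B ≠ 0 → RankOne B)
    {v0 : ι → F} {w0 : κ → F} (hv0 : v0 ≠ 0) (hw0 : w0 ≠ 0) :
    ‖conv a (tens v0 w0)‖ ^ 2 ≤ 3 * (‖conv (fun v => a (tens v w0)) v0‖ ^ 2 +
      ‖conv (fun w => a (tens v0 w)) w0‖ ^ 2 +
      Fintype.card F * ∑ B, ‖a B‖ ^ 2 * ‖a (tens v0 w0 - B)‖ ^ 2) := by
  classical
  set C := tens v0 w0 with hC
  set g : (ι × κ → F) → ℂ := fun B => a B * a (C - B) with hg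
  set R : Finset (ι × κ → F) := univ.image fun v : ι → F => tens v w0 with hR
  set L : Finset (ι × κ → F) := univ.image fun w : κ → F => tens v0 w with hL
  have hsum : conv a C = ∑ B ∈ R ∪ L, g B := by
    unfold conv
    symm
    refine sum_subset (subset_univ _) fun B _ hB => ?_
    by_contra hne
    obtain ⟨h1, h2⟩ := mul_ne_zero_iff.1 hne
    obtain ⟨hB0, v, w, hvw⟩ := ha _ h1
    obtain ⟨-, v', w', hvw'⟩ := ha _ h2
    have e : tens v w + tens v' w' = tens v0 w0 := by rw [← hvw, ← hvw', ← hC]; abel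
    have hw : w ≠ 0 := right_ne_zero_of_tens (hvw ▸ hB0)
    apply hB
    rw [mem_union]
    rcases rank_one_sum e hv0 hw0 hw with ⟨x, hx⟩ | ⟨y, hy⟩
    · left
      exact mem_image.2 ⟨x, mem_univ _, by rw [← hx, hvw]⟩
    · right
      exact mem_image.2 ⟨y, mem_univ _, by rw [← hy, hvw]⟩
  have hRsum : ∑ B ∈ R, g B = conv (fun v => a (tens v w0)) v0 := by
    rw [hR, sum_image]
    · unfold conv
      refine sum_congr rfl fun v _ => ?_
      simp only [hg]
      congr 2
      rw [hC]
      ext p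
      simp [tens, sub_mul]
    · intro v _ v' _ h
      obtain ⟨k, hk⟩ := Function.ne_iff.1 hw0
      ext i
      exact mul_right_cancel₀ hk (congrFun h (i, k))
  have hLsum : ∑ B ∈ L, g B = conv (fun w => a (tens v0 w)) w0 := by
    rw [hL, sum_image]
    · unfold conv
      refine sum_congr rfl fun v _ => ?_
      simp only [hg]
      congr 2
      rw [hC]
      ext p
      simp [tens, mul_sub]
    · intro w _ w' _ h
      obtain ⟨i, hi⟩ := Function.ne_iff.1 hv0
      ext k
      exact mul_left_cancel₀ hi (congrFun h (i, k))
  have hcard : ((R ∩ L).card : ℝ) ≤ Fintype.card F := by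
    have : R ∩ L ⊆ univ.image fun c : F => tens (c • v0) w0 := by
      intro B hB
      rw [mem_inter, hR, hL, mem_image, mem_image] at hB
      obtain ⟨⟨v, -, hv⟩, ⟨w, -, hw⟩⟩ := hB
      by_cases hw' : w = 0
      · refine mem_image.2 ⟨0, mem_univ _, ?_⟩
        rw [zero_smul, zero_tens, ← hw, hw', tens_zero]
      · obtain ⟨c, hc⟩ := left_parallel (hv.trans hw.symm) hv0 hw'
        exact mem_image.2 ⟨c, mem_univ _, by rw [← hc, hv]⟩
    exact_mod_cast (card_le_card this).trans card_image_le
  have hov : ‖∑ B ∈ R ∩ L, g B‖ ^ 2 ≤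
      Fintype.card F * ∑ B, ‖a B‖ ^ 2 * ‖a (C - B)‖ ^ 2 := by
    calc ‖∑ B ∈ R ∩ L, g B‖ ^ 2 ≤ (∑ B ∈ R ∩ L, ‖g B‖) ^ 2 :=
          pow_le_pow_left₀ (norm_nonneg _) (norm_sum_le _ _) 2
      _ ≤ (R ∩ L).card * ∑ B ∈ R ∩ L, ‖g B‖ ^ 2 := sq_sum_le_card_mul_sum_sq
      _ ≤ (R ∩ L).card * ∑ B, ‖g B‖ ^ 2 := by
          refine mul_le_mul_of_nonneg_left ?_ (Nat.cast_nonneg _)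
          exact sum_le_sum_of_subset_of_nonneg (subset_univ _) fun _ _ _ => by positivity
      _ ≤ Fintype.card F * ∑ B, ‖g B‖ ^ 2 :=
          mul_le_mul_of_nonneg_right hcard (sum_nonneg fun _ _ => by positivity)
      _ = _ := by simp only [hg, norm_mul, mul_pow]
  have hdecomp : conv a C = conv (fun v => a (tens v w0)) v0 +
      conv (fun w => a (tens v0 w)) w0 - ∑ B ∈ R ∩ L, g B := by
    rw [hsum, ← hRsum, ← hLsum, ← sum_union_inter]
    ring
  have hn : ‖conv a C‖ ≤ ‖conv (fun v => a (tens v w0)) v0‖ +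
      ‖conv (fun w => a (tens v0 w)) w0‖ + ‖∑ B ∈ R ∩ L, g B‖ := by
    rw [hdecomp]
    exact (norm_sub_le _ _).trans (add_le_add_left (norm_add_le _ _) _)
  set X := ‖conv (fun v => a (tens v w0)) v0‖
  set Y := ‖conv (fun w => a (tens v0 w)) w0‖
  set Z := ‖∑ B ∈ R ∩ L, g B‖
  have h2 : ‖conv a C‖ ^ 2 ≤ (X + Y + Z) ^ 2 := pow_le_pow_left₀ (norm_nonneg _) hn 2
  nlinarith [sq_nonneg (X - Y), sq_nonneg (X - Z), sq_nonneg (Y - Z)]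

theorem sum_rankOne_le (φ : (ι × κ → F) → ℝ) (hφ : ∀ B, 0 ≤ φ B) :
    ∑ C, ind (RankOne C) * φ C ≤
      ∑ v : ι → F, ∑ w : κ → F, ind (v ≠ 0 ∧ w ≠ 0) * φ (tens v w) := by
  have h1 : ∀ (v : ι → F) (w : κ → F), ind (v ≠ 0 ∧ w ≠ 0) * φ (tens v w) =
      ∑ C, ind (v ≠ 0 ∧ w ≠ 0) * ind (C = tens v w) * φ C := by
    intro v w
    rw [sum_eq_single (tens v w)]
    · simp [ind]
    · intro b _ hb
      simp [ind_neg hb]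
    · simp
  simp only [h1]
  have h2 : ∑ v : ι → F, ∑ w : κ → F, ∑ C, ind (v ≠ 0 ∧ w ≠ 0) * ind (C = tens v w) * φ C =
      ∑ C, (∑ v : ι → F, ∑ w : κ → F, ind (v ≠ 0 ∧ w ≠ 0) * ind (C = tens v w)) * φ C := by
    simp only [sum_mul]
    rw [sum_comm]
    conv_rhs => rw [sum_comm]
    rw [sum_comm]
    exact sum_congr rfl fun v _ => sum_comm
  rw [h2]
  refine sum_le_sum fun C _ => mul_le_mul_of_nonneg_right ?_ (hφ C)
  by_cases hC : RankOne C
  · obtain ⟨h0, v, w, hvw⟩ := hC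
    rw [ind_pos ⟨h0, v, w, hvw⟩]
    rw [hvw] at h0
    have h3 : ind (v ≠ 0 ∧ w ≠ 0) * ind (C = tens v w) = 1 := by
      rw [ind_pos ⟨left_ne_zero_of_tens h0, right_ne_zero_of_tens h0⟩, ind_pos hvw, one_mul]
    rw [← h3]
    refine le_trans ?_ (single_le_sum (f := fun v => ∑ w : κ → F, ind (v ≠ 0 ∧ w ≠ 0) *
      ind (C = tens v w)) (fun _ _ => sum_nonneg fun _ _ =>
      mul_nonneg (ind_nonneg _) (ind_nonneg _)) (mem_univ v))
    exact single_le_sum (f := fun w => ind (v ≠ 0 ∧ w ≠ 0) *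
      ind (C = tens v w)) (fun _ _ => mul_nonneg (ind_nonneg _) (ind_nonneg _)) (mem_univ w)
  · rw [ind_neg hC]
    exact sum_nonneg fun _ _ => sum_nonneg fun _ _ => mul_nonneg (ind_nonneg _) (ind_nonneg _)

theorem sum_pairs_le (φ : (ι × κ → F) → ℝ) (hφ : ∀ B, 0 ≤ φ B) :
    ∑ v : ι → F, ∑ w : κ → F, ind (v ≠ 0 ∧ w ≠ 0) * φ (tens v w) ≤
      Fintype.card F * ∑ C, φ C := by
  have h1 : ∀ (v : ι → F) (w : κ → F), ind (v ≠ 0 ∧ w ≠ 0) * φ (tens v w) =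
      ∑ C, ind ((v ≠ 0 ∧ w ≠ 0) ∧ C = tens v w) * φ C := by
    intro v w
    rw [sum_eq_single (tens v w)]
    · simp only [and_true]
    · intro b _ hb
      simp [ind_and, ind_neg hb]
    · simp
  simp only [h1]
  have h2 : ∑ v : ι → F, ∑ w : κ → F, ∑ C, ind ((v ≠ 0 ∧ w ≠ 0) ∧ C = tens v w) * φ C =
      ∑ C, ct (fun z : (ι → F) × (κ → F) => (z.1 ≠ 0 ∧ z.2 ≠ 0) ∧ C = tens z.1 z.2) * φ C := by
    simp only [ct, sum_mul]
    conv_rhs => rw [sum_comm]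
    rw [Fintype.sum_prod_type]
  rw [h2, mul_sum]
  refine sum_le_sum fun C _ => mul_le_mul_of_nonneg_right ?_ (hφ C)
  by_cases hC : ∃ i k, C (i, k) ≠ 0
  · obtain ⟨i, k, hik⟩ := hC
    refine le_trans (ct_le_of_injective (q := fun _ : F => True) (fun z => z.1 i) ?_
      fun _ _ => trivial) (ct_le_card _)
    rintro ⟨v, w⟩ ⟨v', w'⟩ ⟨-, hx⟩ ⟨-, hy⟩ h
    simp only at h hx hy
    have hvi : v i ≠ 0 := by
      intro h0
      apply hik
      simp [hx, tens, h0]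
    have hw : w = w' := by
      ext k
      have := congrFun (hx.symm.trans hy) (i, k)
      simp only [tens, ← h] at this
      exact mul_left_cancel₀ hvi this
    have hwk : w k ≠ 0 := by
      intro h0
      apply hik
      simp [hx, tens, h0]
    have hv : v = v' := by
      ext j
      have := congrFun (hx.symm.trans hy) (j, k)
      simp only [tens, ← hw] at this
      exact mul_right_cancel₀ hwk this
    rw [hv, hw]
  · have hC0 : C = 0 := by
      ext ⟨i, k⟩
      by_contra h
      exact hC ⟨i, k, h⟩
    have : ct (fun z : (ι → F) × (κ → F) => (z.1 ≠ 0 ∧ z.2 ≠ 0) ∧ C = tens z.1 z.2) = 0 := by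
      refine sum_eq_zero fun z _ => ind_neg ?_
      rintro ⟨⟨h1, h2⟩, h3⟩
      exact tens_ne_zero h1 h2 (h3.symm.trans hC0)
    rw [this]
    exact Nat.cast_nonneg _

/-- Fourth-moment bound for coefficient functions supported on rank-one matrices. -/
theorem sum_conv_sq_le (a : (ι × κ → F) → ℂ) (ha : ∀ B, a B ≠ 0 → RankOne B)
    (hneg : ∀ B, ‖a (-B)‖ = ‖a B‖) {ε : ℝ}
    (hrow : ∀ w : κ → F, w ≠ 0 → ∀ z, ‖ft (fun v => a (tens v w)) z‖ ≤ ε)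
    (hcol : ∀ v : ι → F, v ≠ 0 → ∀ z, ‖ft (fun w => a (tens v w)) z‖ ≤ ε) :
    ∑ C, ‖conv a C‖ ^ 2 ≤
      (1 + (Fintype.card F : ℝ) ^ 4 + 3 * (Fintype.card F : ℝ) ^ 2) * (∑ B, ‖a B‖ ^ 2) ^ 2 +
      6 * Fintype.card F * ε ^ 2 * ∑ B, ‖a B‖ ^ 2 := by
  set q : ℝ := (Fintype.card F : ℝ) with hq
  have hq0 : 0 ≤ q := Nat.cast_nonneg _
  set W := ∑ B, ‖a B‖ ^ 2 with hW
  set G : (ι × κ → F) → ℝ := fun C => ∑ B, ‖a B‖ ^ 2 * ‖a (C - B)‖ ^ 2 with hG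
  have hGnn : ∀ C, 0 ≤ G C := fun C => sum_nonneg fun _ _ => by positivity
  have hGsum : ∑ C, G C = W ^ 2 := by
    simp only [hG]
    rw [sum_comm, sq, hW, sum_mul]
    refine sum_congr rfl fun B _ => ?_
    rw [← mul_sum]
    congr 1
    exact Equiv.sum_comp (Equiv.subRight B) fun C => ‖a C‖ ^ 2
  have ha0 : a 0 = 0 := by
    by_contra h
    exact (ha _ h).1 rfl
  have hpt : ∀ C, ‖conv a C‖ ^ 2 ≤
      ind (C = 0) * W ^ 2 + q ^ 4 * G C + ind (RankOne C) * ‖conv a C‖ ^ 2 := by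
    intro C
    by_cases hC0 : C = 0
    · have h1 : ‖conv a C‖ ≤ W := by
        rw [hC0]
        refine (norm_sum_le _ _).trans (le_of_eq (sum_congr rfl fun B _ => ?_))
        rw [norm_mul, zero_sub, hneg, sq]
      have h2 : ‖conv a C‖ ^ 2 ≤ W ^ 2 := pow_le_pow_left₀ (norm_nonneg _) h1 2
      rw [ind_pos hC0, one_mul]
      have := mul_nonneg (ind_nonneg (RankOne C)) (sq_nonneg ‖conv a C‖)
      have := mul_nonneg (pow_nonneg hq0 4) (hGnn C)
      linarith
    · rw [ind_neg hC0, zero_mul, zero_add]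
      by_cases hC : RankOne C
      · rw [ind_pos hC, one_mul]
        have := mul_nonneg (pow_nonneg hq0 4) (hGnn C)
        linarith
      · rw [ind_neg hC, zero_mul, add_zero]
        exact conv_sq_le a C (rank_two_count a ha C hC0 hC)
  have hrows : ∑ v : ι → F, ∑ w : κ → F, ind (v ≠ 0 ∧ w ≠ 0) *
      ‖conv (fun v => a (tens v w)) v‖ ^ 2 ≤ ε ^ 2 * (q * W) := by
    rw [sum_comm]
    have h1 : ∀ w : κ → F, ∑ v : ι → F, ind (v ≠ 0 ∧ w ≠ 0) *
        ‖conv (fun v => a (tens v w)) v‖ ^ 2 ≤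
        ε ^ 2 * ∑ v : ι → F, ind (v ≠ 0 ∧ w ≠ 0) * ‖a (tens v w)‖ ^ 2 := by
      intro w
      by_cases hw : w = 0
      · simp [hw, ind]
      · refine le_trans (sum_le_sum fun v _ => mul_le_of_le_one_left (sq_nonneg _) (ind_le_one _)) ?_
        refine (sum_norm_conv_sq_le _ (hrow w hw)).trans (le_of_eq ?_)
        congr 1
        refine sum_congr rfl fun v _ => ?_
        by_cases hv : v = 0
        · simp [hv, zero_tens, ha0]
        · rw [ind_pos ⟨hv, hw⟩, one_mul]
    refine (sum_le_sum fun w _ => h1 w).trans ?_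
    rw [← mul_sum, sum_comm]
    exact mul_le_mul_of_nonneg_left (sum_pairs_le (fun B => ‖a B‖ ^ 2) fun _ => sq_nonneg _)
      (sq_nonneg _)
  have hcols : ∑ v : ι → F, ∑ w : κ → F, ind (v ≠ 0 ∧ w ≠ 0) *
      ‖conv (fun w => a (tens v w)) w‖ ^ 2 ≤ ε ^ 2 * (q * W) := by
    have h1 : ∀ v : ι → F, ∑ w : κ → F, ind (v ≠ 0 ∧ w ≠ 0) *
        ‖conv (fun w => a (tens v w)) w‖ ^ 2 ≤
        ε ^ 2 * ∑ w : κ → F, ind (v ≠ 0 ∧ w ≠ 0) * ‖a (tens v w)‖ ^ 2 := by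
      intro v
      by_cases hv : v = 0
      · simp [hv, ind]
      · refine le_trans (sum_le_sum fun w _ => mul_le_of_le_one_left (sq_nonneg _) (ind_le_one _)) ?_
        refine (sum_norm_conv_sq_le _ (hcol v hv)).trans (le_of_eq ?_)
        congr 1
        refine sum_congr rfl fun w _ => ?_
        by_cases hw : w = 0
        · simp [hw, tens_zero, ha0]
        · rw [ind_pos ⟨hv, hw⟩, one_mul]
    refine (sum_le_sum fun v _ => h1 v).trans ?_
    rw [← mul_sum]
    exact mul_le_mul_of_nonneg_left (sum_pairs_le (fun B => ‖a B‖ ^ 2) fun _ => sq_nonneg _)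
      (sq_nonneg _)
  have hone : ∑ C, ind (RankOne C) * ‖conv a C‖ ^ 2 ≤
      3 * (ε ^ 2 * (q * W) + ε ^ 2 * (q * W) + q * (q * W ^ 2)) := by
    refine (sum_rankOne_le (fun C => ‖conv a C‖ ^ 2) fun _ => sq_nonneg _).trans ?_
    calc ∑ v : ι → F, ∑ w : κ → F, ind (v ≠ 0 ∧ w ≠ 0) * ‖conv a (tens v w)‖ ^ 2
        ≤ ∑ v : ι → F, ∑ w : κ → F, 3 * (ind (v ≠ 0 ∧ w ≠ 0) *
            ‖conv (fun v => a (tens v w)) v‖ ^ 2 + ind (v ≠ 0 ∧ w ≠ 0) *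
            ‖conv (fun w => a (tens v w)) w‖ ^ 2 + q * (ind (v ≠ 0 ∧ w ≠ 0) * G (tens v w))) := by
          refine sum_le_sum fun v _ => sum_le_sum fun w _ => ?_
          by_cases h : v ≠ 0 ∧ w ≠ 0
          · rw [ind_pos h]
            simp only [one_mul]
            exact conv_rank_one_le a ha h.1 h.2
          · simp [ind_neg h]
      _ = 3 * (∑ v : ι → F, ∑ w : κ → F, ind (v ≠ 0 ∧ w ≠ 0) *
            ‖conv (fun v => a (tens v w)) v‖ ^ 2 +
            ∑ v : ι → F, ∑ w : κ → F, ind (v ≠ 0 ∧ w ≠ 0) *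
            ‖conv (fun w => a (tens v w)) w‖ ^ 2 +
            q * ∑ v : ι → F, ∑ w : κ → F, ind (v ≠ 0 ∧ w ≠ 0) * G (tens v w)) := by
          simp only [mul_sum, ← sum_add_distrib]
      _ ≤ _ := by
          have h3 := sum_pairs_le G hGnn
          rw [hGsum] at h3
          have h4 := mul_le_mul_of_nonneg_left h3 hq0
          linarith
  calc ∑ C, ‖conv a C‖ ^ 2
      ≤ ∑ C, (ind (C = 0) * W ^ 2 + q ^ 4 * G C + ind (RankOne C) * ‖conv a C‖ ^ 2) :=
        sum_le_sum fun C _ => hpt C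
    _ = W ^ 2 + q ^ 4 * W ^ 2 + ∑ C, ind (RankOne C) * ‖conv a C‖ ^ 2 := by
        rw [sum_add_distrib, sum_add_distrib, ← sum_mul, ← mul_sum, hGsum, sum_ind_eq', one_mul]
    _ ≤ _ := by linarith

end Conv

section LevelOne
variable {F : Type} [Field F] [Fintype F] {ι κ : Type} [Fintype ι] [DecidableEq ι]
  [Fintype κ] [DecidableEq κ]

theorem two_le_card_field (F : Type) [Field F] [Fintype F] : (2 : ℝ) ≤ Fintype.card F := by
  exact_mod_cast Fintype.one_lt_card (α := F)

theorem sum_class {σ : Type} [Fintype σ] [DecidableEq σ] (S : (ι × κ → F) → Prop)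
    (g : (ι × κ → F) → σ → F) (b : (σ → F) → ι × κ → F) (hb : ∀ v T, b v ⬝ᵥ T = v ⬝ᵥ g T)
    (z : σ → F) :
    ∑ v, (starRingEnd ℂ) (hatS S (b v)) * chi F (v ⬝ᵥ z) =
      ((Fintype.card (σ → F) * ct (fun T => S T ∧ g T = z) : ℝ) : ℂ) := by
  have h1 : ∀ v, (starRingEnd ℂ) (hatS S (b v)) * chi F (v ⬝ᵥ z) =
      ∑ T, (ind (S T) : ℂ) * chi F ((z - g T) ⬝ᵥ v) := by
    intro v
    unfold hatS ft
    rw [map_sum, sum_mul]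
    refine sum_congr rfl fun T _ => ?_
    rw [map_mul, Complex.conj_ofReal, ← chi_neg, mul_assoc, ← chi_add, dotProduct_comm T, hb,
      dotProduct_comm (z - g T), dotProduct_sub]
    congr 3
    ring
  simp only [h1]
  rw [sum_comm, ct, mul_sum]
  push_cast
  refine sum_congr rfl fun T _ => ?_
  rw [← mul_sum]
  by_cases h : g T = z
  · rw [h, sub_self, sum_chi_dot_zero, ind_and, ind_pos (rfl : z = z)]
    push_cast
    ring
  · rw [sum_chi_dot_of_ne _ (sub_ne_zero.2 (Ne.symm h)), ind_and, ind_neg h]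
    simp

/-- Normalised rank-one part of the Fourier transform of the indicator of `S`. -/
def rankOneCoeff (S : (ι × κ → F) → Prop) (B : ι × κ → F) : ℂ :=
  ind (RankOne B) * (starRingEnd ℂ) (hatS S B) / Fintype.card (ι × κ → F)

theorem rankOneCoeff_supp (S : (ι × κ → F) → Prop) (B : ι × κ → F)
    (h : rankOneCoeff S B ≠ 0) : RankOne B := by
  by_contra hB
  exact h (by simp [rankOneCoeff, ind_neg hB])

theorem rankOneCoeff_neg (S : (ι × κ → F) → Prop) (B : ι × κ → F) :
    ‖rankOneCoeff S (-B)‖ = ‖rankOneCoeff S B‖ := by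
  have h1 : RankOne (-B) ↔ RankOne B := by
    have h : ∀ B : ι × κ → F, RankOne B → RankOne (-B) := by
      rintro B ⟨h0, v, w, rfl⟩
      refine ⟨neg_ne_zero.2 h0, -v, w, ?_⟩
      ext p
      simp [tens]
    exact ⟨fun hB => neg_neg B ▸ h _ hB, h B⟩
  simp only [rankOneCoeff, h1, hatS_neg, norm_div, norm_mul, RCLike.norm_conj]

theorem norm_rankOneCoeff_sq (S : (ι × κ → F) → Prop) (B : ι × κ → F) :
    ‖rankOneCoeff S B‖ ^ 2 =
      ind (RankOne B) * ‖hatS S B‖ ^ 2 / (Fintype.card (ι × κ → F) : ℝ) ^ 2 := by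
  simp only [rankOneCoeff, norm_div, norm_mul, RCLike.norm_conj, div_pow, mul_pow]
  by_cases h : RankOne B <;> simp [ind, h]

theorem norm_ft_class_le {σ : Type} [Fintype σ] [DecidableEq σ] (S : (ι × κ → F) → Prop)
    (g : (ι × κ → F) → σ → F) (b : (σ → F) → ι × κ → F) (hb : ∀ v T, b v ⬝ᵥ T = v ⬝ᵥ g T)
    (hb0 : b 0 = 0) (hb1 : ∀ v, v ≠ 0 → RankOne (b v)) (z : σ → F) {M : ℝ}
    (hM : Fintype.card (σ → F) * ct (fun T => S T ∧ g T = z) ≤ M) (hM' : ct S ≤ M) :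
    ‖ft (fun v => rankOneCoeff S (b v)) z‖ ≤ M / Fintype.card (ι × κ → F) := by
  set N : ℝ := (Fintype.card (ι × κ → F) : ℝ) with hN
  have hN0 : 0 < N := by
    rw [hN]
    exact_mod_cast Fintype.card_pos
  classical
  have h1 : ft (fun v => rankOneCoeff S (b v)) z =
      (((Fintype.card (σ → F) * ct (fun T => S T ∧ g T = z) - ct S) / N : ℝ) : ℂ) := by
    have h2 : ∀ v, rankOneCoeff S (b v) * chi F (v ⬝ᵥ z) =
        ((starRingEnd ℂ) (hatS S (b v)) * chi F (v ⬝ᵥ z) -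
          if v = 0 then (ct S : ℂ) else 0) / (N : ℂ) := by
      intro v
      by_cases hv : v = 0
      · have : ¬RankOne (0 : ι × κ → F) := fun h => h.1 rfl
        simp [hv, hb0, rankOneCoeff, ind_neg this, hatS_zero]
      · simp only [rankOneCoeff, ind_pos (hb1 v hv), if_neg hv, hN]
        push_cast
        ring
    unfold ft
    simp only [h2]
    rw [← sum_div, sum_sub_distrib, sum_class S g b hb]
    simp
  rw [h1, Complex.norm_real, Real.norm_eq_abs, abs_div, abs_of_pos hN0]
  refine div_le_div_of_nonneg_right ?_ hN0.le
  rw [abs_le]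
  have h3 := ct_nonneg (fun T => S T ∧ g T = z)
  have h4 : (0 : ℝ) ≤ Fintype.card (σ → F) * ct (fun T => S T ∧ g T = z) :=
    mul_nonneg (Nat.cast_nonneg _) h3
  have h5 := ct_nonneg S
  constructor <;> linarith

theorem row_density_le (S : (ι × κ → F) → Prop)
    (hE : ∀ T u, S T → (Fintype.card F : ℝ) ^ Fintype.card κ ≤
      Fintype.card F * ct (fun l => S (T + tens u l)))
    (v : ι → F) (hv : v ≠ 0) (z : κ → F) :
    (Fintype.card F : ℝ) ^ Fintype.card κ * ct (fun T => S T ∧ vm v T = z) ≤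
      Fintype.card F * ct S := by
  obtain ⟨i, hi⟩ := Function.ne_iff.1 hv
  set u0 : ι → F := Pi.single i (v i)⁻¹ with hu0
  have hvu : v ⬝ᵥ u0 = 1 := by
    rw [hu0, dotProduct_single]
    exact mul_inv_cancel₀ hi
  have h1 : ∀ T, (Fintype.card F : ℝ) ^ Fintype.card κ * ind (S T ∧ vm v T = z) ≤
      Fintype.card F * ct (fun l => (S T ∧ vm v T = z) ∧ S (T + tens u0 l)) := by
    intro T
    by_cases h : S T ∧ vm v T = z
    · rw [ind_pos h, mul_one]
      simpa only [h, true_and, and_self] using hE T u0 h.1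
    · rw [ind_neg h, mul_zero]
      exact mul_nonneg (Nat.cast_nonneg _) (ct_nonneg _)
  rw [ct, mul_sum]
  refine (sum_le_sum fun T _ => h1 T).trans ?_
  rw [← mul_sum]
  refine mul_le_mul_of_nonneg_left ?_ (Nat.cast_nonneg _)
  rw [← ct_prod fun x : (ι × κ → F) × (κ → F) =>
    (S x.1 ∧ vm v x.1 = z) ∧ S (x.1 + tens u0 x.2)]
  refine ct_le_of_injective (fun x => x.1 + tens u0 x.2) ?_ fun x hx => hx.2
  rintro ⟨T, l⟩ ⟨T', l'⟩ ⟨⟨-, h1⟩, -⟩ ⟨⟨-, h2⟩, -⟩ h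
  simp only at h h1 h2
  have h3 := congrArg (vm v) h
  simp only [vm_add, vm_tens, h1, h2, hvu, one_smul] at h3
  have h4 : l = l' := add_left_cancel h3
  rw [h4] at h ⊢
  rw [add_right_cancel h]

theorem rankOne_weight_lower (S : (ι × κ → F) → Prop)
    (hE : ∀ T u, S T → (Fintype.card F : ℝ) ^ Fintype.card κ ≤
      Fintype.card F * ct (fun l => S (T + tens u l))) :
    Fintype.card F * Fintype.card (ι × κ → F) * ct S ≤
      (Fintype.card F : ℝ) ^ 2 * ct S ^ 2 +
      Fintype.card F * ∑ B, ind (RankOne B) * ‖hatS S B‖ ^ 2 +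
      Fintype.card (ι × κ → F) * ct S := by
  set q : ℝ := (Fintype.card F : ℝ) with hq
  have hq2 : (2 : ℝ) ≤ q := two_le_card_field F
  set N : ℝ := (Fintype.card (ι × κ → F) : ℝ) with hN
  have hcorr := sum_correlation S
  have h1 : q ^ Fintype.card ι * (q ^ Fintype.card κ * ct S) ≤
      q * ∑ u : ι → F, ∑ l : κ → F, ∑ T, ind (S T) * ind (S (T + tens u l)) := by
    have h2 : ∀ u : ι → F, q ^ Fintype.card κ * ct S ≤
        q * ∑ l : κ → F, ∑ T, ind (S T) * ind (S (T + tens u l)) := by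
      intro u
      rw [sum_comm, ct, mul_sum, mul_sum]
      refine sum_le_sum fun T _ => ?_
      rw [← mul_sum]
      by_cases h : S T
      · rw [ind_pos h, mul_one, one_mul]
        exact hE T u h
      · simp [ind_neg h]
    rw [mul_sum]
    calc q ^ Fintype.card ι * (q ^ Fintype.card κ * ct S)
        = ∑ _u : ι → F, q ^ Fintype.card κ * ct S := by simp [hq]
      _ ≤ _ := sum_le_sum fun u _ => h2 u
  have h3 : ∀ B : ι × κ → F, q ^ 2 * (‖hatS S B‖ ^ 2 * kerCt B) ≤ q ^ Fintype.card κ *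
      (q ^ 2 * (ind (B = 0) * ct S ^ 2) + q * (ind (RankOne B) * ‖hatS S B‖ ^ 2) +
        ‖hatS S B‖ ^ 2) := by
    intro B
    have hnn := sq_nonneg ‖hatS S B‖
    have hind := ind_nonneg (RankOne B)
    by_cases hB : B = 0
    · rw [hB, ind_pos rfl, one_mul, kerCt_zero, hatS_zero, Complex.norm_real, Real.norm_eq_abs,
        sq_abs]
      have : 0 ≤ q ^ Fintype.card κ * (q * (ind (RankOne (0 : ι × κ → F)) * ct S ^ 2) +
        ct S ^ 2) := by
        have := ind_nonneg (RankOne (0 : ι × κ → F))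
        positivity
      linarith
    · rw [ind_neg hB, zero_mul, mul_zero, zero_add]
      by_cases h1 : RankOne B
      · rw [ind_pos h1, one_mul]
        have h5 := mul_le_mul_of_nonneg_left (kerCt_le B hB)
          (by positivity : 0 ≤ q * ‖hatS S B‖ ^ 2)
        have : 0 ≤ q ^ Fintype.card κ * ‖hatS S B‖ ^ 2 := by positivity
        linarith
      · rw [ind_neg h1, zero_mul, mul_zero, zero_add]
        have h5 := mul_le_mul_of_nonneg_left (kerCt_le_of_not_rankOne B hB h1) hnn
        linarith
  have h4 : q ^ 2 * ∑ B : ι × κ → F, ‖hatS S B‖ ^ 2 * kerCt B ≤ q ^ Fintype.card κ *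
      (q ^ 2 * ct S ^ 2 + q * (∑ B : ι × κ → F, ind (RankOne B) * ‖hatS S B‖ ^ 2) +
        N * ct S) := by
    rw [mul_sum]
    refine (sum_le_sum fun B _ => h3 B).trans (le_of_eq ?_)
    rw [← mul_sum, sum_add_distrib, sum_add_distrib, ← mul_sum, ← sum_mul, sum_ind_eq', one_mul,
      ← mul_sum, sum_norm_hatS_sq]
  have hqi : 0 < q ^ Fintype.card ι := by positivity
  have hqk : 0 < q ^ Fintype.card κ := by positivity
  have hN0 : 0 ≤ N := Nat.cast_nonneg _
  refine le_of_mul_le_mul_left ?_ hqk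
  refine le_trans ?_ h4
  refine le_of_mul_le_mul_left ?_ hqi
  have h5 := mul_le_mul_of_nonneg_left h1 (mul_nonneg (by positivity : 0 ≤ q) hN0)
  calc q ^ Fintype.card ι * (q ^ Fintype.card κ * (q * N * ct S))
      = q * N * (q ^ Fintype.card ι * (q ^ Fintype.card κ * ct S)) := by ring
    _ ≤ _ := h5
    _ = q ^ 2 * (N * ∑ u : ι → F, ∑ l : κ → F, ∑ T, ind (S T) * ind (S (T + tens u l))) := by
        ring
    _ = _ := by rw [hcorr]; ring

theorem rankOne_weight_moment (S : (ι × κ → F) → Prop) :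
    (Fintype.card (ι × κ → F) * ∑ B, ‖rankOneCoeff S B‖ ^ 2) ^ 4 ≤
      ct S ^ 3 * (Fintype.card (ι × κ → F) * ∑ C, ‖conv (rankOneCoeff S) C‖ ^ 2) := by
  set N : ℝ := (Fintype.card (ι × κ → F) : ℝ) with hN
  have hN0 : 0 < N := by
    rw [hN]
    exact_mod_cast Fintype.card_pos
  set a := rankOneCoeff S with ha
  have h1 : ∑ T, (ind (S T) : ℂ) * ft a T = ((N * ∑ B, ‖a B‖ ^ 2 : ℝ) : ℂ) := by
    have h2 : ∑ T, (ind (S T) : ℂ) * ft a T = ∑ B, a B * hatS S B := by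
      unfold hatS ft
      simp only [mul_sum]
      rw [sum_comm]
      refine sum_congr rfl fun B _ => sum_congr rfl fun T _ => ?_
      rw [dotProduct_comm]
      ring
    rw [h2, mul_sum]
    push_cast
    refine sum_congr rfl fun B _ => ?_
    have h3 := norm_rankOneCoeff_sq S B
    have h4 : (‖a B‖ ^ 2 : ℂ) = ((‖a B‖ ^ 2 : ℝ) : ℂ) := by push_cast; rfl
    rw [h4, h3]
    have hNc : (N : ℂ) ≠ 0 := by exact_mod_cast hN0.ne'
    simp only [ha, rankOneCoeff, hN]
    push_cast
    rw [← Complex.conj_mul']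
    simp only [hN] at hNc
    field_simp
  have h2 : N * ∑ B, ‖a B‖ ^ 2 ≤ ∑ T, ind (S T) * ‖ft a T‖ := by
    have hnn : 0 ≤ N * ∑ B, ‖a B‖ ^ 2 := mul_nonneg hN0.le (sum_nonneg fun _ _ => sq_nonneg _)
    calc N * ∑ B, ‖a B‖ ^ 2 = ‖((N * ∑ B, ‖a B‖ ^ 2 : ℝ) : ℂ)‖ := by
          rw [Complex.norm_real, Real.norm_eq_abs, abs_of_nonneg hnn]
      _ ≤ _ := by
          rw [← h1]
          refine (norm_sum_le _ _).trans (le_of_eq (sum_congr rfl fun T _ => ?_))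
          rw [norm_mul, Complex.norm_real, Real.norm_eq_abs, abs_of_nonneg (ind_nonneg _)]
  have hs : ∑ T, ind (S T) ^ 2 = ct S :=
    sum_congr rfl fun T _ => by rw [sq, ← ind_and, and_self]
  have h3 : (∑ T, ind (S T) * ‖ft a T‖) ^ 2 ≤ ct S * ∑ T, ind (S T) * ‖ft a T‖ ^ 2 := by
    have h4 : ∀ T, ind (S T) * ‖ft a T‖ = ind (S T) * (ind (S T) * ‖ft a T‖) := by
      intro T
      rw [← mul_assoc, ← ind_and, and_self]
    rw [sum_congr rfl fun T _ => h4 T]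
    refine (sum_mul_sq_le_sq_mul_sq _ _ _).trans (le_of_eq ?_)
    rw [hs]
    congr 1
    refine sum_congr rfl fun T _ => ?_
    rw [mul_pow, sq (ind _), ← ind_and, and_self]
  have h5 : (∑ T, ind (S T) * ‖ft a T‖ ^ 2) ^ 2 ≤ ct S * ∑ T, ‖ft a T‖ ^ 4 := by
    refine (sum_mul_sq_le_sq_mul_sq _ _ _).trans (le_of_eq ?_)
    rw [hs]
    congr 1
    exact sum_congr rfl fun T _ => by ring
  rw [← sum_norm_ft_pow_four]
  have hS := ct_nonneg S
  calc (N * ∑ B, ‖a B‖ ^ 2) ^ 4 ≤ (∑ T, ind (S T) * ‖ft a T‖) ^ 4 :=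
        pow_le_pow_left₀ (mul_nonneg hN0.le (sum_nonneg fun _ _ => sq_nonneg _)) h2 4
    _ = ((∑ T, ind (S T) * ‖ft a T‖) ^ 2) ^ 2 := by ring
    _ ≤ (ct S * ∑ T, ind (S T) * ‖ft a T‖ ^ 2) ^ 2 :=
        pow_le_pow_left₀ (sq_nonneg _) h3 2
    _ = ct S ^ 2 * (∑ T, ind (S T) * ‖ft a T‖ ^ 2) ^ 2 := by ring
    _ ≤ ct S ^ 2 * (ct S * ∑ T, ‖ft a T‖ ^ 4) := mul_le_mul_of_nonneg_left h5 (sq_nonneg _)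
    _ = _ := by ring

/-- A small nonempty set with good local density correlates with a condition `T w = b`. -/
theorem level_one (S : (ι × κ → F) → Prop) (hne : ∃ T, S T)
    (hE : ∀ T u, S T → (Fintype.card F : ℝ) ^ Fintype.card κ ≤
      Fintype.card F * ct (fun l => S (T + tens u l)))
    (hsmall : (Fintype.card F : ℝ) ^ 30 * ct S ≤ Fintype.card (ι × κ → F)) :
    ∃ w : κ → F, w ≠ 0 ∧ ∃ b : ι → F, (Fintype.card (ι × κ → F) : ℝ) <
      32 * Fintype.card F * (Fintype.card (ι → F) * ct (fun T => S T ∧ mv T w = b)) := by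
  by_contra! hcon
  set q : ℝ := (Fintype.card F : ℝ) with hq
  have hq2 : (2 : ℝ) ≤ q := two_le_card_field F
  set N : ℝ := (Fintype.card (ι × κ → F) : ℝ) with hN
  have hN0 : 0 < N := by
    rw [hN]
    exact_mod_cast Fintype.card_pos
  have hS1 : 1 ≤ ct S := ct_pos hne
  set μ := ct S / N with hμ
  have hμ0 : 0 < μ := by positivity
  have hSμ : ct S = μ * N := by rw [hμ]; field_simp
  have hμq : q ^ 30 * μ ≤ 1 := by
    rw [hμ, ← mul_div_assoc, div_le_one hN0]
    exact hsmall
  set W := ∑ B, ‖rankOneCoeff S B‖ ^ 2 with hW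
  have hWeq : ∑ B : ι × κ → F, ind (RankOne B) * ‖hatS S B‖ ^ 2 = W * N ^ 2 := by
    rw [hW]
    simp only [norm_rankOneCoeff_sq]
    rw [← sum_div, ← hN]
    field_simp
  have hWle : W ≤ μ := by
    have : W * N ^ 2 ≤ N * ct S := by
      rw [← hWeq, ← sum_norm_hatS_sq]
      exact sum_le_sum fun B _ => mul_le_of_le_one_left (sq_nonneg _) (ind_le_one _)
    rw [hSμ] at this
    have h2 : W * N ^ 2 ≤ μ * N ^ 2 := by linarith
    exact le_of_mul_le_mul_right h2 (by positivity)
  have hq26 : (2 : ℝ) ^ 26 ≤ q ^ 26 := pow_le_pow_left₀ (by norm_num) hq2 26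
  have hq4μ : q ^ 4 * μ ≤ 1 / 2 ^ 26 := by
    rw [le_div_iff₀ (by positivity)]
    calc q ^ 4 * μ * 2 ^ 26 ≤ q ^ 4 * μ * q ^ 26 :=
          mul_le_mul_of_nonneg_left hq26 (by positivity)
      _ = q ^ 30 * μ := by ring
      _ ≤ 1 := hμq
  have hqq : q ≤ q ^ 4 := by
    nlinarith [pow_le_pow_left₀ (by norm_num) hq2 3]
  have hqq2 : q ^ 2 ≤ q ^ 4 := by
    nlinarith [pow_le_pow_left₀ (by norm_num) hq2 2]
  have hWlow : μ / 4 ≤ W := by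
    have h1 := rankOne_weight_lower S hE
    rw [hWeq, hSμ] at h1
    have h2 : q * μ ≤ q ^ 2 * μ ^ 2 + q * W + μ := by
      refine le_of_mul_le_mul_right ?_ (by positivity : 0 < N ^ 2)
      calc q * μ * N ^ 2 = q * N * (μ * N) := by ring
        _ ≤ _ := h1
        _ = _ := by ring
    have h3 : q * μ ≤ 1 / 4 := by
      have := mul_le_mul_of_nonneg_right hqq hμ0.le
      norm_num at hq4μ
      linarith
    have h4 : q * (q * μ) * μ ≤ q * (1 / 4) * μ := by gcongr
    nlinarith
  have hε : (0 : ℝ) < 1 / (32 * q) := by positivity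
  have hSε : ct S ≤ N / (32 * q) := by
    rw [hSμ, le_div_iff₀ (by positivity)]
    have h1 : μ * (32 * q) ≤ 1 := by
      have := mul_le_mul_of_nonneg_right hqq hμ0.le
      norm_num at hq4μ
      linarith
    nlinarith
  have hconv := sum_conv_sq_le (rankOneCoeff S) (rankOneCoeff_supp S) (rankOneCoeff_neg S)
    (ε := 1 / (32 * q)) ?_ ?_
  rotate_left
  · intro w hw z
    have h1 := norm_ft_class_le S (fun T => mv T w) (fun v => tens v w)
      (fun v T => tens_dot v w T) (zero_tens w)
      (fun v hv => ⟨tens_ne_zero hv hw, v, w, rfl⟩) z (M := N / (32 * q)) ?_ hSε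
    · refine h1.trans (le_of_eq ?_)
      rw [← hN]
      field_simp
    · rw [le_div_iff₀ (by positivity)]
      have := hcon w hw z
      linarith
  · intro v hv z
    have h1 := norm_ft_class_le S (fun T => vm v T) (fun w => tens v w)
      (fun w T => tens_dot' v w T) (tens_zero v)
      (fun w hw => ⟨tens_ne_zero hv hw, v, w, rfl⟩) z (M := N / (32 * q)) ?_ hSε
    · refine h1.trans (le_of_eq ?_)
      rw [← hN]
      field_simp
    · have h2 := row_density_le S hE v hv z
      have h3 : ((Fintype.card (κ → F) : ℕ) : ℝ) = q ^ Fintype.card κ := by simp [hq]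
      rw [h3]
      refine h2.trans ?_
      rw [hSμ, le_div_iff₀ (by positivity)]
      have h4 : q * μ * (32 * q) ≤ 1 := by
        have := mul_le_mul_of_nonneg_right hqq2 hμ0.le
        norm_num at hq4μ
        nlinarith
      nlinarith
  have hmom := rankOne_weight_moment S
  rw [← hW] at hconv hmom
  set Q := ∑ C, ‖conv (rankOneCoeff S) C‖ ^ 2 with hQ
  have h1 : W ^ 4 ≤ μ ^ 3 * Q := by
    rw [hSμ] at hmom
    refine le_of_mul_le_mul_right ?_ (by positivity : 0 < N ^ 4)
    calc W ^ 4 * N ^ 4 = (N * W) ^ 4 := by ring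
      _ ≤ _ := hmom
      _ = _ := by rw [← hN]; ring
  have hW0 : 0 < W := by linarith
  have h2 : Q ≤ W * ((1 + q ^ 4 + 3 * q ^ 2) * μ + 6 * q * (1 / (32 * q)) ^ 2) := by
    refine hconv.trans ?_
    have : (1 + q ^ 4 + 3 * q ^ 2) * W ^ 2 ≤ (1 + q ^ 4 + 3 * q ^ 2) * (W * μ) := by
      have : W ^ 2 ≤ W * μ := by nlinarith
      exact mul_le_mul_of_nonneg_left this (by positivity)
    rw [← hq]
    linarith
  have h3 : (1 + q ^ 4 + 3 * q ^ 2) * μ + 6 * q * (1 / (32 * q)) ^ 2 < 1 / 64 := by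
    have h4 : 6 * q * (1 / (32 * q)) ^ 2 = 6 / 1024 / q := by
      field_simp
      norm_num
    have h5 : 6 / 1024 / q ≤ 3 / 1024 := by
      rw [div_le_iff₀ (by positivity)]
      linarith
    have h6 : (1 + q ^ 4 + 3 * q ^ 2) * μ ≤ 5 * (q ^ 4 * μ) := by
      have : 1 ≤ q ^ 4 := one_le_pow₀ (by linarith)
      nlinarith
    rw [h4]
    norm_num at hq4μ
    linarith
  have h4 : W ^ 3 < μ ^ 3 * (1 / 64) := by
    refine lt_of_mul_lt_mul_left ?_ hW0.le
    calc W * W ^ 3 = W ^ 4 := by ring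
      _ ≤ μ ^ 3 * Q := h1
      _ ≤ μ ^ 3 * (W * ((1 + q ^ 4 + 3 * q ^ 2) * μ + 6 * q * (1 / (32 * q)) ^ 2)) :=
          mul_le_mul_of_nonneg_left h2 (by positivity)
      _ < μ ^ 3 * (W * (1 / 64)) := by gcongr
      _ = _ := by ring
  have h5 : (μ / 4) ^ 3 ≤ W ^ 3 := pow_le_pow_left₀ (by positivity) hWlow 3
  linarith [show (μ / 4) ^ 3 = μ ^ 3 * (1 / 64) by ring]

end LevelOne

/-! ### Affine tests -/

section Tests
variable {F : Type} [Field F] [Fintype F] {ι J : Type} [Fintype ι] [DecidableEq ι]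
  [Fintype J] [DecidableEq J]

/-- Homogenisation of a vector: the coordinate `none` is set to `1`. -/
def hat (x : J → F) : Option J → F := fun o => o.elim 1 x

/-- The affine map encoded by a matrix with an extra column `none`. -/
def app (T : ι × Option J → F) (x : J → F) : ι → F := mv T (hat x)

/-- The value of the test `h` on `f ∘ T`. -/
def rho (f : (ι → F) → F) (h : (J → F) → F) (T : ι × Option J → F) : F :=
  ∑ x, f (app T x) * h x

/-- Some test from the family `H` rejects `f ∘ T`. -/
def Rej {E : Type} (f : (ι → F) → F) (H : E → (J → F) → F) (T : ι × Option J → F) : Prop :=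
  ∃ e, rho f (H e) T ≠ 0

/-- The functional equal to `1` on all homogenised vectors. -/
def one' (F J : Type) [Field F] [DecidableEq J] : Option J → F := Pi.single none 1

theorem one'_dot (x : J → F) : one' F J ⬝ᵥ hat x = 1 := by
  simp [one', hat]

theorem app_add (T D : ι × Option J → F) (x : J → F) : app (T + D) x = app T x + app D x :=
  mv_add _ _ _

theorem app_tens (u : ι → F) (l : Option J → F) (x : J → F) :
    app (tens u l) x = (l ⬝ᵥ hat x) • u := mv_tens _ _ _

theorem sum_affine_ne (g : F → F) {c : F} (hc : c ≠ 0) (d : F) :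
    ∑ τ, g (τ * c + d) = ∑ z, g z :=
  Equiv.sum_comp ((Equiv.mulRight₀ c hc).trans (Equiv.addRight d)) g

theorem sum_const_field (y : F) : ∑ _τ : F, y = 0 := by
  rw [sum_const, card_univ, nsmul_eq_mul, FiniteField.cast_card_eq_zero, zero_mul]

/-- Translating along all multiples of the constant direction averages over a full line. -/
theorem sum_rho_one (f : (ι → F) → F) (h : (J → F) → F) (T : ι × Option J → F) (u : ι → F)
    (l : Option J → F) :
    ∑ τ : F, rho f h (T + tens u (l + τ • one' F J)) =
      ∑ x, (∑ z : F, f (app T x + z • u)) * h x := by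
  unfold rho
  rw [sum_comm]
  refine sum_congr rfl fun x _ => ?_
  rw [← sum_mul]
  congr 1
  rw [← sum_affine_ne (fun z => f (app T x + z • u)) one_ne_zero (l ⬝ᵥ hat x)]
  refine sum_congr rfl fun τ _ => ?_
  rw [app_add, app_tens, add_dotProduct, smul_dotProduct, one'_dot, smul_eq_mul, add_comm (l ⬝ᵥ _)]

theorem push_count {Z : Type} [Fintype Z] {κ : Type} [Fintype κ] [DecidableEq κ]
    (S : (ι × κ → F) → Prop) (w : κ → F) (b : ι → F)
    (D : Z → ι × κ → F) (hD : Function.Injective fun z => mv (D z) w) :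
    ct (fun x : (ι × κ → F) × Z => mv x.1 w = b ∧ S (x.1 + D x.2)) ≤ ct S := by
  refine ct_le_of_injective (fun x => x.1 + D x.2) ?_ fun x hx => hx.2
  rintro ⟨T, z⟩ ⟨T', z'⟩ ⟨h1, -⟩ ⟨h2, -⟩ h
  simp only at h h1 h2
  have h3 := congrArg (fun T => mv T w) h
  simp only [mv_add, h1, h2] at h3
  have h4 : z = z' := hD (add_left_cancel h3)
  rw [h4] at h ⊢
  rw [add_right_cancel h]

theorem local_density {E : Type} (f : (ι → F) → F) (H : E → (J → F) → F)
    (T : ι × Option J → F) (u : ι → F) (hT : Rej f H T) :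
    (Fintype.card F : ℝ) ^ Fintype.card (Option J) ≤
      Fintype.card F * ct (fun l => Rej f H (T + tens u l)) := by
  classical
  obtain ⟨e, he⟩ := hT
  set q := Fintype.card F with hq
  have hq1 : 1 < q := Fintype.one_lt_card
  let eq := Fintype.equivFin (Option J)
  set m := Fintype.card (Option J) with hm
  let L : (J → F) → F → MvPolynomial (Fin m) F := fun x c =>
    (∑ k, MvPolynomial.C (hat x (eq.symm k)) * MvPolynomial.X k) - MvPolynomial.C c
  let Q : MvPolynomial (Fin m) F := ∑ x, ∑ c, MvPolynomial.C (f (app T x + c • u) * H e x) *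
    (1 - L x c ^ (q - 1))
  have hL : ∀ x c (l : Fin m → F), MvPolynomial.eval l (L x c) =
      (fun o => l (eq o)) ⬝ᵥ hat x - c := by
    intro x c l
    simp only [L, map_sub, map_sum, map_mul, MvPolynomial.eval_C, MvPolynomial.eval_X]
    congr 1
    rw [dotProduct, ← Equiv.sum_comp eq.symm]
    exact sum_congr rfl fun k _ => by simp [mul_comm]
  have hQ : ∀ l : Fin m → F, MvPolynomial.eval l Q =
      rho f (H e) (T + tens u fun o => l (eq o)) := by
    intro l
    simp only [Q, map_sum, map_mul, MvPolynomial.eval_C, map_sub, map_one, map_pow, hL]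
    unfold rho
    refine sum_congr rfl fun x _ => ?_
    rw [sum_eq_single ((fun o => l (eq o)) ⬝ᵥ hat x)]
    · rw [sub_self, zero_pow (by omega), app_add, app_tens]
      ring
    · intro c _ hc
      rw [FiniteField.pow_card_sub_one_eq_one _ (sub_ne_zero.2 hc.symm)]
      ring
    · simp
  have hQ0 : Q ≠ 0 := by
    intro h0
    apply he
    have := hQ 0
    rw [h0, map_zero] at this
    have h1 : (T + tens u fun o => (0 : Fin m → F) (eq o)) = T := by
      ext p
      simp [tens]
    rw [h1] at this
    exact this.symm
  have hdeg : Q.totalDegree ≤ q - 1 := by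
    refine (MvPolynomial.totalDegree_finsetSum _ _).trans (Finset.sup_le fun x _ => ?_)
    refine (MvPolynomial.totalDegree_finsetSum _ _).trans (Finset.sup_le fun c _ => ?_)
    refine (MvPolynomial.totalDegree_mul _ _).trans ?_
    rw [MvPolynomial.totalDegree_C, zero_add]
    refine (MvPolynomial.totalDegree_sub _ _).trans (max_le (by simp) ?_)
    refine (MvPolynomial.totalDegree_pow _ _).trans ?_
    have : (L x c).totalDegree ≤ 1 := by
      refine (MvPolynomial.totalDegree_sub _ _).trans (max_le ?_ (by simp))
      refine (MvPolynomial.totalDegree_finsetSum _ _).trans (Finset.sup_le fun k _ => ?_)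
      refine (MvPolynomial.totalDegree_mul _ _).trans ?_
      rw [MvPolynomial.totalDegree_C, zero_add]
      simp
    calc (q - 1) * (L x c).totalDegree ≤ (q - 1) * 1 := Nat.mul_le_mul_left _ this
      _ = q - 1 := mul_one _
  have hsz := MvPolynomial.schwartz_zippel_totalDegree hQ0 (univ : Finset F)
  rw [Fintype.piFinset_univ, card_univ, ← hq] at hsz
  have hz : ((#{l : Fin m → F | MvPolynomial.eval l Q = 0} : ℕ) : ℝ) * q ≤ (q - 1) * q ^ m := by
    have h1 : ((#{l : Fin m → F | MvPolynomial.eval l Q = 0} : ℚ≥0) / q ^ m) ≤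
        ((q - 1 : ℕ) : ℚ≥0) / q :=
      hsz.trans (by gcongr)
    rw [div_le_div_iff₀ (by positivity) (by positivity)] at h1
    have h2 : (#{l : Fin m → F | MvPolynomial.eval l Q = 0}) * q ≤ (q - 1) * q ^ m := by
      exact_mod_cast h1
    have h3 : (((#{l : Fin m → F | MvPolynomial.eval l Q = 0}) * q : ℕ) : ℝ) ≤
        (((q - 1) * q ^ m : ℕ) : ℝ) := by exact_mod_cast h2
    push_cast [Nat.cast_sub hq1.le] at h3
    exact h3
  have hzc : ct (fun l : Fin m → F => MvPolynomial.eval l Q = 0) =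
      (#{l : Fin m → F | MvPolynomial.eval l Q = 0} : ℝ) := by
    rw [ct_eq_natCard, Nat.card_eq_fintype_card, Fintype.card_subtype]
  have hnz : ct (fun l : Fin m → F => ¬MvPolynomial.eval l Q = 0) ≤
      ct (fun l => Rej f H (T + tens u l)) := by
    refine ct_le_of_injective (fun l o => l (eq o)) ?_ ?_
    · intro l l' _ _ h
      ext k
      simpa using congrFun h (eq.symm k)
    · intro l hl
      exact ⟨e, by rwa [← hQ]⟩
  rw [ct_not, hzc] at hnz
  have hcard : ((Fintype.card (Fin m → F) : ℕ) : ℝ) = (q : ℝ) ^ m := by simp [hq]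
  rw [hcard] at hnz
  have hq0 : (0 : ℝ) ≤ q := Nat.cast_nonneg _
  have := mul_le_mul_of_nonneg_left hnz hq0
  nlinarith

theorem rho_eq_zero_of_directions (f : (ι → F) → F) (h : (J → F) → F) (T : ι × Option J → F)
    (u1 u2 : ι → F) (l : Option J → F)
    (h1 : ∀ τ1 τ2 : F, ¬(τ1 = 0 ∧ τ2 = 0) → rho f h (T + tens (τ1 • u1 + τ2 • u2) l) = 0)
    (h2 : ∀ τ1 τ2 : F, τ1 ≠ 0 →
      rho f h (T + (tens (τ1 • u1) l + tens (τ2 • u2) (one' F J))) = 0)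
    (h3 : ∀ τ1 τ2 : F, τ1 ≠ 0 → rho f h (T + tens u2 (τ1 • l + τ2 • one' F J)) = 0) :
    rho f h T = 0 := by
  classical
  have hT : T + 0 = T := add_zero T
  have hconst : ∀ τ2 : F, rho f h (T + tens (τ2 • u2) (one' F J)) = rho f h T := by
    have e1 : ∀ τ2 : F, ∑ τ1 : F, rho f h (T + tens u2 (τ1 • l + τ2 • one' F J)) =
        rho f h (T + tens (τ2 • u2) (one' F J)) := by
      intro τ2
      rw [sum_eq_single 0]
      · rw [zero_smul, zero_add, tens_smul]
      · exact fun τ1 _ hτ => h3 τ1 τ2 hτ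
      · simp
    have e2 : ∀ τ2 : F, ∑ τ1 : F, rho f h (T + tens u2 (τ1 • l + τ2 • one' F J)) =
        ∑ x, (if l ⬝ᵥ hat x = 0 then 0 else ∑ z : F, f (app T x + z • u2)) * h x := by
      intro τ2
      unfold rho
      rw [sum_comm]
      refine sum_congr rfl fun x _ => ?_
      rw [← sum_mul]
      congr 1
      have e3 : ∀ τ1 : F, app (T + tens u2 (τ1 • l + τ2 • one' F J)) x =
          app T x + (τ1 * (l ⬝ᵥ hat x) + τ2) • u2 := by
        intro τ1
        rw [app_add, app_tens, add_dotProduct, smul_dotProduct, smul_dotProduct, one'_dot]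
        simp
      simp only [e3]
      split_ifs with hx
      · simp only [hx, mul_zero]
        exact sum_const_field _
      · exact sum_affine_ne (fun z => f (app T x + z • u2)) hx τ2
    intro τ2
    rw [← e1, e2, ← e2 0, e1, zero_smul, zero_tens, hT]
  have e1 : ∑ τ2 : F, ∑ τ1 : F, rho f h (T + tens (τ1 • u1 + τ2 • u2) l) = rho f h T := by
    rw [sum_eq_single 0]
    · rw [sum_eq_single 0]
      · rw [zero_smul, zero_smul, add_zero, zero_tens, hT]
      · exact fun τ1 _ hτ => h1 τ1 0 fun hh => hτ hh.1
      · simp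
    · exact fun τ2 _ hτ => sum_eq_zero fun τ1 _ => h1 τ1 τ2 fun hh => hτ hh.2
    · simp
  have e2 : ∑ τ2 : F, ∑ τ1 : F,
      rho f h (T + (tens (τ1 • u1) l + tens (τ2 • u2) (one' F J))) = 0 := by
    have : ∀ τ2 : F, ∑ τ1 : F, rho f h (T + (tens (τ1 • u1) l + tens (τ2 • u2) (one' F J))) =
        rho f h T := by
      intro τ2
      rw [sum_eq_single 0]
      · rw [zero_smul, zero_tens, zero_add, hconst]
      · exact fun τ1 _ hτ => h2 τ1 τ2 hτ
      · simp
    simp only [this]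
    exact sum_const_field _
  rw [← e1, ← e2]
  unfold rho
  have e3 : ∀ g : F → F → (J → F) → F,
      ∑ τ2 : F, ∑ τ1 : F, ∑ x, g τ2 τ1 x = ∑ x, ∑ τ2 : F, ∑ τ1 : F, g τ2 τ1 x := by
    intro g
    rw [sum_comm]
    rw [sum_comm]
    simp only [fun τ2 : F => sum_comm (s := univ) (t := univ) (f := fun τ1 x => g τ2 τ1 x)]
    exact sum_comm
  rw [e3, e3]
  refine sum_congr rfl fun x _ => ?_
  simp only [← sum_mul]
  congr 1
  have e4 : ∀ τ2 τ1 : F, app (T + tens (τ1 • u1 + τ2 • u2) l) x =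
      app T x + ((τ1 * (l ⬝ᵥ hat x) + 0) • u1 + (τ2 * (l ⬝ᵥ hat x) + 0) • u2) := by
    intro τ2 τ1
    rw [app_add, app_tens, smul_add, smul_smul, smul_smul]
    simp [mul_comm]
  have e5 : ∀ τ2 τ1 : F, app (T + (tens (τ1 • u1) l + tens (τ2 • u2) (one' F J))) x =
      app T x + ((τ1 * (l ⬝ᵥ hat x) + 0) • u1 + τ2 • u2) := by
    intro τ2 τ1
    rw [app_add, app_add, app_tens, app_tens, one'_dot, one_smul, smul_smul]
    simp [mul_comm]
  simp only [e4, e5]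
  by_cases hx : l ⬝ᵥ hat x = 0
  · simp only [hx, mul_zero]
    simp only [sum_const_field]
  · have e6 : ∀ y : F, ∑ τ1 : F, f (app T x + ((τ1 * (l ⬝ᵥ hat x) + 0) • u1 + y • u2)) =
        ∑ z1 : F, f (app T x + (z1 • u1 + y • u2)) := fun y =>
      sum_affine_ne (fun z => f (app T x + (z • u1 + y • u2))) hx 0
    simp only [e6]
    exact sum_affine_ne (fun y => ∑ z1 : F, f (app T x + (z1 • u1 + y • u2))) hx 0

end Tests

section Directions
variable {F : Type} [Field F] [Fintype F] {ι J : Type} [Fintype ι] [DecidableEq ι]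
  [Fintype J] [DecidableEq J]

theorem push_count_prod {Z₁ Z₂ : Type} [Fintype Z₁] [Fintype Z₂] {κ : Type} [Fintype κ]
    [DecidableEq κ] (S : (ι × κ → F) → Prop) (w : κ → F) (b : ι → F)
    (D : Z₁ → Z₂ → ι × κ → F) (hD : ∀ z₂, Function.Injective fun z => mv (D z z₂) w) :
    ct (fun x : ((ι × κ → F) × Z₁) × Z₂ => mv x.1.1 w = b ∧ S (x.1.1 + D x.1.2 x.2)) ≤
      Fintype.card Z₂ * ct S := by
  rw [ct_prod_right]
  calc _ ≤ ∑ _z₂ : Z₂, ct S := sum_le_sum fun z₂ _ => push_count S w b (fun z => D z z₂) (hD z₂)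
    _ = _ := by rw [sum_const, card_univ, nsmul_eq_mul]

theorem card_fun_pos : (0 : ℝ) < Fintype.card (ι → F) := by
  exact_mod_cast Fintype.card_pos

theorem ct_ignore_right {α β : Type*} [Fintype α] [Fintype β] (p : α → Prop) :
    ct (fun x : α × β => p x.1) = Fintype.card β * ct p := by
  rw [ct_prod_right]
  simp only [sum_const, card_univ, nsmul_eq_mul]

theorem ct_rej_of_direction {E : Type} (f : (ι → F) → F) (H : E → (J → F) → F)
    {w : Option J → F} (hw : w ≠ 0) (hw0 : w none = 0) (b : ι → F) :
    Fintype.card (ι → F) * ct (fun T => Rej f H T ∧ mv T w = b) ≤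
      3 * (Fintype.card F : ℝ) ^ 2 * ct (Rej f H) := by
  classical
  obtain ⟨j, hj⟩ := Function.ne_iff.1 hw
  set l : Option J → F := Pi.single j 1 with hl
  have hlw : l ⬝ᵥ w = w j := by simp [hl]
  have h1w : one' F J ⬝ᵥ w = 0 := by simp [one', hw0]
  have hne : l ⬝ᵥ w ≠ 0 := by rw [hlw]; exact hj
  set S := Rej f H with hS
  let ev1 : F × F → (((ι × Option J → F) × (ι → F)) × (ι → F)) → Prop := fun τ x =>
    mv x.1.1 w = b ∧ ¬(τ.1 = 0 ∧ τ.2 = 0) ∧ S (x.1.1 + tens (τ.1 • x.1.2 + τ.2 • x.2) l)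
  let ev2 : F × F → (((ι × Option J → F) × (ι → F)) × (ι → F)) → Prop := fun τ x =>
    mv x.1.1 w = b ∧ τ.1 ≠ 0 ∧
      S (x.1.1 + (tens (τ.1 • x.1.2) l + tens (τ.2 • x.2) (one' F J)))
  let ev3 : F × F → (((ι × Option J → F) × (ι → F)) × (ι → F)) → Prop := fun τ x =>
    mv x.1.1 w = b ∧ τ.1 ≠ 0 ∧ S (x.1.1 + tens x.2 (τ.1 • l + τ.2 • one' F J))
  set Q : ℝ := (Fintype.card (ι → F) : ℝ) with hQ
  have hQ0 : 0 < Q := card_fun_pos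
  have hsw : ∀ p : (((ι × Option J → F) × (ι → F)) × (ι → F)) → Prop,
      ct (fun x : ((ι × Option J → F) × (ι → F)) × (ι → F) => p ((x.1.1, x.2), x.1.2)) = ct p :=
    fun p => ct_equiv (⟨fun x => ((x.1.1, x.2), x.1.2), fun x => ((x.1.1, x.2), x.1.2),
      fun _ => rfl, fun _ => rfl⟩ : _ ≃ _) p
  have hinj : ∀ (c : F) (v : ι → F), c ≠ 0 → Function.Injective fun u : ι → F => c • u + v :=
    fun c v hc u u' h => by
      have := add_right_cancel (b := v) h
      exact smul_right_injective _ hc this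
  have b1 : ∀ τ, ct (ev1 τ) ≤ Q * ct S := by
    rintro ⟨τ1, τ2⟩
    by_cases h1 : τ1 = 0
    · by_cases h2 : τ2 = 0
      · refine le_trans (le_of_eq ?_) (mul_nonneg hQ0.le (ct_nonneg _))
        exact sum_eq_zero fun x _ => ind_neg fun hx => hx.2.1 ⟨h1, h2⟩
      · rw [← hsw]
        refine (ct_mono ?_).trans (push_count_prod S w b
          (fun z1 z2 => tens (τ1 • z2 + τ2 • z1) l) ?_)
        · exact fun x hx => ⟨hx.1, hx.2.2⟩
        · intro z2
          have := hinj ((l ⬝ᵥ w) * τ2) ((l ⬝ᵥ w) • τ1 • z2) (mul_ne_zero hne h2)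
          refine fun a a' h => this ?_
          simp only [mv_tens, smul_add, smul_smul] at h ⊢
          rw [add_comm, h, add_comm]
    · refine (ct_mono ?_).trans (push_count_prod S w b
        (fun z1 z2 => tens (τ1 • z1 + τ2 • z2) l) ?_)
      · exact fun x hx => ⟨hx.1, hx.2.2⟩
      · intro z2
        have := hinj ((l ⬝ᵥ w) * τ1) ((l ⬝ᵥ w) • τ2 • z2) (mul_ne_zero hne h1)
        refine fun a a' h => this ?_
        simpa only [mv_tens, smul_add, smul_smul] using h
  have b2 : ∀ τ, ct (ev2 τ) ≤ Q * ct S := by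
    rintro ⟨τ1, τ2⟩
    by_cases h1 : τ1 = 0
    · refine le_trans (le_of_eq ?_) (mul_nonneg hQ0.le (ct_nonneg _))
      exact sum_eq_zero fun x _ => ind_neg fun hx => hx.2.1 h1
    · refine (ct_mono ?_).trans (push_count_prod S w b
        (fun z1 z2 => tens (τ1 • z1) l + tens (τ2 • z2) (one' F J)) ?_)
      · exact fun x hx => ⟨hx.1, hx.2.2⟩
      · intro z2
        have := hinj ((l ⬝ᵥ w) * τ1) 0 (mul_ne_zero hne h1)
        refine fun a a' h => this ?_
        simpa only [mv_add, mv_tens, h1w, zero_smul, zero_mul, smul_smul] using h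
  have b3 : ∀ τ, ct (ev3 τ) ≤ Q * ct S := by
    rintro ⟨τ1, τ2⟩
    by_cases h1 : τ1 = 0
    · refine le_trans (le_of_eq ?_) (mul_nonneg hQ0.le (ct_nonneg _))
      exact sum_eq_zero fun x _ => ind_neg fun hx => hx.2.1 h1
    · rw [← hsw]
      refine (ct_mono ?_).trans (push_count_prod S w b
        (fun z1 _ => tens z1 (τ1 • l + τ2 • one' F J)) ?_)
      · exact fun x hx => ⟨hx.1, hx.2.2⟩
      · intro z2
        have := hinj (τ1 * (l ⬝ᵥ w)) 0 (mul_ne_zero h1 hne)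
        refine fun a a' h => this ?_
        simpa only [mv_tens, add_dotProduct, smul_dotProduct, h1w, smul_eq_mul, mul_zero,
          add_zero] using h
  have hcov : ct (fun x : ((ι × Option J → F) × (ι → F)) × (ι → F) =>
      S x.1.1 ∧ mv x.1.1 w = b) ≤
      ct (fun x => ((∃ τ, ev1 τ x) ∨ (∃ τ, ev2 τ x)) ∨ (∃ τ, ev3 τ x)) := by
    refine ct_mono fun x hx => ?_
    by_contra hcon
    obtain ⟨⟨e, he⟩, hb⟩ := hx
    refine he (rho_eq_zero_of_directions f (H e) x.1.1 x.1.2 x.2 l ?_ ?_ ?_)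
    · intro τ1 τ2 hτ
      by_contra h0
      exact hcon (Or.inl (Or.inl ⟨(τ1, τ2), hb, hτ, e, h0⟩))
    · intro τ1 τ2 hτ
      by_contra h0
      exact hcon (Or.inl (Or.inr ⟨(τ1, τ2), hb, hτ, e, h0⟩))
    · intro τ1 τ2 hτ
      by_contra h0
      exact hcon (Or.inr ⟨(τ1, τ2), hb, hτ, e, h0⟩)
  have hL : ct (fun x : ((ι × Option J → F) × (ι → F)) × (ι → F) =>
      S x.1.1 ∧ mv x.1.1 w = b) = Q * (Q * ct (fun T => S T ∧ mv T w = b)) := by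
    rw [ct_ignore_right (fun x : (ι × Option J → F) × (ι → F) => S x.1 ∧ mv x.1 w = b),
      ct_ignore_right (fun T => S T ∧ mv T w = b)]
  have hsum : ∀ ev : F × F → (((ι × Option J → F) × (ι → F)) × (ι → F)) → Prop,
      (∀ τ, ct (ev τ) ≤ Q * ct S) → ct (fun x => ∃ τ, ev τ x) ≤
        (Fintype.card F : ℝ) ^ 2 * (Q * ct S) := by
    intro ev hev
    refine (ct_exists_le _).trans ((sum_le_sum fun τ _ => hev τ).trans (le_of_eq ?_))
    rw [sum_const, card_univ, nsmul_eq_mul, Fintype.card_prod]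
    push_cast
    ring
  have := (hcov.trans (ct_or_le _ _)).trans
    (add_le_add ((ct_or_le _ _).trans (add_le_add (hsum _ b1) (hsum _ b2))) (hsum _ b3))
  rw [hL] at this
  refine le_of_mul_le_mul_left (a := Q) ?_ hQ0
  linarith

/-- A sparse nonempty rejecting set is dense among the maps sending some point `a` to some
value `b`. -/
theorem level_one_affine {E : Type} (f : (ι → F) → F) (H : E → (J → F) → F)
    (hne : ∃ T, Rej f H T)
    (hsmall : (Fintype.card F : ℝ) ^ 30 * ct (Rej f H) ≤ Fintype.card (ι × Option J → F)) :
    ∃ (a : J → F) (b : ι → F), (Fintype.card (ι × Option J → F) : ℝ) <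
      32 * Fintype.card F * (Fintype.card (ι → F) * ct (fun T => Rej f H T ∧ app T a = b)) := by
  classical
  obtain ⟨w, hw, b, h⟩ := level_one (Rej f H) hne
    (fun T u hT => local_density f H T u hT) hsmall
  have hq : (2 : ℝ) ≤ Fintype.card F := two_le_card_field F
  have hS : 0 < ct (Rej f H) := lt_of_lt_of_le one_pos (ct_pos hne)
  by_cases hw0 : w none = 0
  · have h1 := ct_rej_of_direction f H hw hw0 b
    have h2 : (32 * Fintype.card F : ℝ) * (3 * (Fintype.card F : ℝ) ^ 2 * ct (Rej f H)) ≤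
        (Fintype.card F : ℝ) ^ 30 * ct (Rej f H) := by
      have : (96 : ℝ) ≤ (Fintype.card F : ℝ) ^ 27 := by
        calc (96 : ℝ) ≤ 2 ^ 27 := by norm_num
          _ ≤ _ := by gcongr
      calc _ = 96 * ((Fintype.card F : ℝ) ^ 3 * ct (Rej f H)) := by ring
        _ ≤ (Fintype.card F : ℝ) ^ 27 * ((Fintype.card F : ℝ) ^ 3 * ct (Rej f H)) := by gcongr
        _ = _ := by ring
    have h3 : (32 * Fintype.card F : ℝ) *
        (Fintype.card (ι → F) * ct (fun T => Rej f H T ∧ mv T w = b)) ≤ _ :=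
      mul_le_mul_of_nonneg_left h1 (by positivity)
    linarith
  · refine ⟨fun j => (w none)⁻¹ * w (some j), (w none)⁻¹ • b, h.trans_le ?_⟩
    have hhat : hat (fun j => (w none)⁻¹ * w (some j)) = (w none)⁻¹ • w := by
      funext o
      cases o with
      | none => simp [hat, hw0]
      | some j => simp [hat]
    gcongr
    refine ct_mono fun T hT => ⟨hT.1, ?_⟩
    rw [app, hhat, mv_smul, hT.2]

end Directions

section Constancy
variable {F : Type} [Field F] [Fintype F] {ι κ : Type} [Fintype ι] [DecidableEq ι]
  [Fintype κ] [DecidableEq κ]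

theorem level_set_correlation_le (S : (ι × κ → F) → Prop) :
    Fintype.card F * (Fintype.card (ι × κ → F) *
      (∑ u : ι → F, ∑ l : κ → F, ∑ T, ind (S T) * ind (S (T + tens u l)))) ≤
    Fintype.card (ι → F) * (Fintype.card F : ℝ) ^ Fintype.card κ *
      ((Fintype.card F - 1) * ct S ^ 2 + Fintype.card (ι × κ → F) * ct S) := by
  classical
  have hsc := sum_correlation S
  have hq := one_le_card_field F
  have hcard : (Fintype.card (ι → F) : ℝ) = (Fintype.card F : ℝ) ^ Fintype.card ι := by simp
  set q : ℝ := (Fintype.card F : ℝ) with hqd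
  set L : ℝ := q ^ Fintype.card κ with hL
  have hterm : ∀ B : ι × κ → F, q * (‖hatS S B‖ ^ 2 * kerCt B) ≤
      L * ‖hatS S B‖ ^ 2 + (if B = 0 then (q - 1) * L * ct S ^ 2 else 0) := by
    intro B
    split_ifs with hB
    · rw [hB, kerCt_zero, hatS_zero]
      simp only [Complex.norm_real, Real.norm_eq_abs, sq_abs]
      apply le_of_eq
      ring
    · have := kerCt_le B hB
      have h2 : 0 ≤ ‖hatS S B‖ ^ 2 := by positivity
      nlinarith
  rw [hsc, hcard]
  have : q * ∑ B, ‖hatS S B‖ ^ 2 * kerCt B ≤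
      L * (Fintype.card (ι × κ → F) * ct S) + (q - 1) * L * ct S ^ 2 := by
    rw [mul_sum]
    refine (sum_le_sum fun B _ => hterm B).trans ?_
    rw [sum_add_distrib, ← mul_sum, sum_norm_hatS_sq, sum_ite_eq' univ]
    simp
  have h0 : 0 ≤ q ^ Fintype.card ι := by positivity
  nlinarith

theorem exists_majority (g : (ι × κ → F) → F) :
    ∃ C, (Fintype.card F - 1) * (Fintype.card (ι → F) * (Fintype.card F : ℝ) ^ Fintype.card κ *
      ct (fun M => g M ≠ C)) ≤
      Fintype.card F * ∑ u : ι → F, ∑ l : κ → F, ct (fun M => g M ≠ g (M + tens u l)) := by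
  classical
  obtain ⟨C, -, hC⟩ := exists_max_image (univ : Finset F) (fun c => ct fun M => g M = c)
    ⟨0, mem_univ _⟩
  refine ⟨C, ?_⟩
  have hq := one_le_card_field F
  have hcorr : ∑ c, (∑ u : ι → F, ∑ l : κ → F, ∑ T, ind (g T = c) * ind (g (T + tens u l) = c)) =
      ∑ u : ι → F, ∑ l : κ → F, (Fintype.card (ι × κ → F) - ct (fun M => g M ≠ g (M + tens u l))) := by
    rw [sum_comm]
    refine sum_congr rfl fun u _ => ?_
    rw [sum_comm]
    refine sum_congr rfl fun l _ => ?_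
    rw [sum_comm, ct_not, sub_sub_cancel]
    refine sum_congr rfl fun T _ => ?_
    rw [sum_eq_single (g T)]
    · rw [ind_pos rfl, one_mul]
      unfold ind
      simp only [eq_comm]
    · intro c _ hc
      rw [ind_neg (Ne.symm hc), zero_mul]
    · simp
  have hY : ∑ c, ct (fun M => g M = c) = Fintype.card (ι × κ → F) := by
    unfold ct
    rw [sum_comm]
    simp [sum_ind_eq]
  set N : ℝ := (Fintype.card (ι × κ → F) : ℝ) with hN
  have hN0 : 0 < N := by
    rw [hN]; exact_mod_cast Fintype.card_pos
  set q : ℝ := (Fintype.card F : ℝ) with hqd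
  set L : ℝ := q ^ Fintype.card κ with hL
  set Q : ℝ := (Fintype.card (ι → F) : ℝ) with hQ
  have hL0 : 0 ≤ L := by positivity
  have hQ0 : 0 ≤ Q := by positivity
  have hsq : ∑ c, ct (fun M => g M = c) ^ 2 ≤ ct (fun M => g M = C) * N := by
    rw [← hY, mul_sum]
    refine sum_le_sum fun c _ => ?_
    rw [sq]
    exact mul_le_mul_of_nonneg_right (hC c (mem_univ _)) (ct_nonneg _)
  have hsum := sum_le_sum fun c (_ : c ∈ (univ : Finset F)) =>
    level_set_correlation_le (F := F) (fun M : ι × κ → F => g M = c)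
  rw [← mul_sum, ← mul_sum, hcorr, ← mul_sum, sum_add_distrib, ← mul_sum, ← mul_sum, hY] at hsum
  have hD : ∑ u : ι → F, ∑ l : κ → F, (N - ct (fun M => g M ≠ g (M + tens u l))) =
      Q * L * N - ∑ u : ι → F, ∑ l : κ → F, ct (fun M => g M ≠ g (M + tens u l)) := by
    simp only [sum_sub_distrib, sum_const, card_univ, nsmul_eq_mul]
    rw [hQ, hL]
    simp only [Fintype.card_fun, Nat.cast_pow]
    ring
  rw [hD] at hsum
  set D := ∑ u : ι → F, ∑ l : κ → F, ct (fun M => g M ≠ g (M + tens u l)) with hDd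
  rw [ct_not]
  rw [← hN]
  have h1 : Q * L * ((q - 1) * ∑ c, ct (fun M => g M = c) ^ 2 + N * N) ≤
      Q * L * ((q - 1) * (ct (fun M => g M = C) * N) + N * N) := by
    have : 0 ≤ q - 1 := by linarith
    gcongr
  have h2 : N * ((q - 1) * (Q * L * (N - ct fun M => g M = C))) ≤ N * (q * D) := by
    have := hsum.trans h1
    nlinarith
  exact le_of_mul_le_mul_left h2 hN0

end Constancy

section Fibres
variable {F : Type} [Field F] [Fintype F] {ι J : Type} [Fintype ι] [DecidableEq ι]
  [Fintype J] [DecidableEq J]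

/-- The affine map with linear part `M` sending `a` to `b`. -/
def aff (a : J → F) (b : ι → F) (M : ι × J → F) : ι × Option J → F :=
  fun p => p.2.elim (b p.1 - ∑ j, M (p.1, j) * a j) fun j => M (p.1, j)

/-- The affine functional with linear part `l` vanishing at `a`. -/
def vanishAt (a : J → F) (l : J → F) : Option J → F := fun o => o.elim (-(l ⬝ᵥ a)) l

theorem vanishAt_dot (a l x : J → F) : vanishAt a l ⬝ᵥ hat x = l ⬝ᵥ (x - a) := by
  simp [vanishAt, hat, dotProduct, Fintype.sum_option, mul_sub, sum_sub_distrib]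
  ring

theorem app_aff (a : J → F) (b : ι → F) (M : ι × J → F) (x : J → F) :
    app (aff a b M) x = b + mv M (x - a) := by
  funext i
  simp [app, mv, aff, hat, Fintype.sum_option, mul_sub, sum_sub_distrib]
  ring

theorem app_aff_self (a : J → F) (b : ι → F) (M : ι × J → F) : app (aff a b M) a = b := by
  rw [app_aff, sub_self]
  funext i
  simp [mv]

theorem aff_injective (a : J → F) (b : ι → F) : Function.Injective (aff a b) := by
  intro M M' h
  ext ⟨i, j⟩
  exact congrFun h (i, some j)

theorem exists_aff {a : J → F} {b : ι → F} {T : ι × Option J → F} (h : app T a = b) :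
    ∃ M, aff a b M = T := by
  refine ⟨fun p => T (p.1, some p.2), ?_⟩
  funext ⟨i, o⟩
  cases o with
  | some j => rfl
  | none =>
    rw [← h]
    simp [aff, app, mv, hat, Fintype.sum_option]

theorem aff_add_tens (a : J → F) (b : ι → F) (M : ι × J → F) (u : ι → F) (l : J → F) :
    aff a b (M + tens u l) = aff a b M + tens u (vanishAt a l) := by
  funext ⟨i, o⟩
  cases o with
  | some j => rfl
  | none =>
    simp [aff, tens, vanishAt, dotProduct, add_mul, sum_add_distrib, mul_sum, mul_assoc]
    ring

theorem ct_fibre (a : J → F) (b : ι → F) (p : (ι × Option J → F) → Prop) :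
    ct (fun T => app T a = b ∧ p T) = ct fun M => p (aff a b M) := by
  refine le_antisymm ?_ (ct_le_of_injective (aff a b) (fun x y _ _ h => aff_injective a b h)
    fun M hM => ⟨app_aff_self a b M, hM⟩)
  have h1 : ∀ T, app T a = b → aff a b (fun p => T (p.1, some p.2)) = T := by
    intro T hT
    obtain ⟨M, rfl⟩ := exists_aff hT
    rfl
  refine ct_le_of_injective (fun T p => T (p.1, some p.2)) ?_ ?_
  · intro T T' hT hT' h
    rw [← h1 T hT.1, ← h1 T' hT'.1]
    exact congrArg (aff a b) h
  · intro T hT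
    rw [h1 T hT.1]
    exact hT.2

theorem card_fibre :
    (Fintype.card (ι → F) : ℝ) * Fintype.card (ι × J → F) = Fintype.card (ι × Option J → F) := by
  simp only [Fintype.card_fun, Fintype.card_prod, Fintype.card_option]
  push_cast
  ring

theorem ct_eq_of_app (a : J → F) (b : ι → F) :
    Fintype.card (ι → F) * ct (fun T : ι × Option J → F => app T a = b) =
      Fintype.card (ι × Option J → F) := by
  have := ct_fibre a b (fun _ => True)
  simp only [and_true] at this
  rw [this, ← card_fibre]
  simp [ct, ind]

theorem ct_fibre_push {Z : Type} [Fintype Z] (S : (ι × Option J → F) → Prop) (a : J → F)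
    (b : ι → F) (D : Z → ι × Option J → F) (hD : Function.Injective fun z => app (D z) a) :
    ct (fun x : (ι × J → F) × Z => S (aff a b x.1 + D x.2)) ≤ ct S := by
  refine le_trans ?_ (push_count S (hat a) b D hD)
  refine ct_le_of_injective (fun x => (aff a b x.1, x.2)) ?_ ?_
  · rintro ⟨M, z⟩ ⟨M', z'⟩ _ _ h
    simp only [Prod.mk.injEq] at h
    rw [aff_injective a b h.1, h.2]
  · exact fun x hx => ⟨app_aff_self a b x.1, hx⟩

theorem rho_eq_of_lines (f : (ι → F) → F) (h : (J → F) → F) (T : ι × Option J → F) (u : ι → F)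
    (l : Option J → F)
    (h1 : ∀ τ : F, τ ≠ 0 → rho f h (T + tens u (τ • one' F J)) = 0)
    (h2 : ∀ τ : F, τ ≠ 0 → rho f h (T + tens u (l + τ • one' F J)) = 0) :
    rho f h T = rho f h (T + tens u l) := by
  have e1 := sum_rho_one f h T u 0
  have e2 := sum_rho_one f h T u l
  rw [← e1] at e2
  rw [sum_eq_single 0 (fun τ _ hτ => h2 τ hτ) (by simp),
    sum_eq_single 0 (fun τ _ hτ => by rw [zero_add]; exact h1 τ hτ) (by simp)] at e2
  simpa [tens_zero] using e2.symm

theorem smul_right_injective_fun {c : F} (hc : c ≠ 0) :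
    Function.Injective fun u : ι → F => c • u := smul_right_injective _ hc

/-- On maps sending `a` to `b`, each test value is almost constant. -/
theorem almost_constant {E : Type} (f : (ι → F) → F) (H : E → (J → F) → F) (e : E)
    (a : J → F) (b : ι → F) :
    ∃ C, Fintype.card (ι → F) * ct (fun T => app T a = b ∧ rho f (H e) T ≠ C) ≤
      4 * Fintype.card F * ct (Rej f H) := by
  classical
  obtain ⟨C, hC⟩ := exists_majority fun M : ι × J → F => rho f (H e) (aff a b M)
  refine ⟨C, ?_⟩
  rw [ct_fibre]
  have hq := two_le_card_field F
  set q : ℝ := (Fintype.card F : ℝ) with hqd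
  set Q : ℝ := (Fintype.card (ι → F) : ℝ) with hQ
  set L : ℝ := q ^ Fintype.card J with hL
  have hL0 : 0 < L := by positivity
  have hdot : ∀ (l : J → F) (τ : F), (vanishAt a l + τ • one' F J) ⬝ᵥ hat a = τ := by
    intro l τ
    rw [add_dotProduct, vanishAt_dot, smul_dotProduct, one'_dot]
    simp
  have hinj : ∀ (l : J → F) (τ : F), τ ≠ 0 → Function.Injective
      fun u : ι → F => app (tens u (vanishAt a l + τ • one' F J)) a := by
    intro l τ hτ
    simp only [app_tens, hdot]
    exact smul_right_injective_fun hτ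
  have hl : ∀ l : J → F, ∑ u : ι → F, ct (fun M : ι × J → F => rho f (H e) (aff a b M) ≠
      rho f (H e) (aff a b (M + tens u l))) ≤ 2 * q * ct (Rej f H) := by
    intro l
    let ev : (J → F) → F → (ι × J → F) × (ι → F) → Prop := fun l τ x =>
      τ ≠ 0 ∧ Rej f H (aff a b x.1 + tens x.2 (vanishAt a l + τ • one' F J))
    have hev : ∀ l τ, ct (ev l τ) ≤ ct (Rej f H) := by
      intro l τ
      by_cases hτ : τ = 0
      · refine le_trans (le_of_eq ?_) (ct_nonneg _)
        exact sum_eq_zero fun x _ => ind_neg fun hx => hx.1 hτ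
      · exact (ct_mono fun x hx => hx.2).trans
          (ct_fibre_push (Rej f H) a b (fun u => tens u (vanishAt a l + τ • one' F J))
            (hinj l τ hτ))
    have hs : ∀ l, ct (fun x => ∃ τ, ev l τ x) ≤ q * ct (Rej f H) := by
      intro l
      refine (ct_exists_le _).trans ((sum_le_sum fun τ _ => hev l τ).trans (le_of_eq ?_))
      rw [sum_const, card_univ, nsmul_eq_mul]
    rw [← ct_prod_right (fun x : (ι × J → F) × (ι → F) => rho f (H e) (aff a b x.1) ≠
      rho f (H e) (aff a b (x.1 + tens x.2 l)))]
    have hv0 : vanishAt a 0 = (0 : Option J → F) := by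
      funext o
      cases o <;> simp [vanishAt]
    refine (ct_mono (q := fun x => (∃ τ, ev 0 τ x) ∨ ∃ τ, ev l τ x) ?_).trans
      ((ct_or_le _ _).trans ?_)
    · intro x hx
      by_contra hcon
      rw [aff_add_tens] at hx
      refine hx (rho_eq_of_lines f (H e) _ x.2 _ ?_ ?_)
      · intro τ hτ
        by_contra h0
        refine hcon (Or.inl ⟨τ, hτ, e, ?_⟩)
        rwa [hv0, zero_add]
      · intro τ hτ
        by_contra h0
        exact hcon (Or.inr ⟨τ, hτ, e, h0⟩)
    · have := add_le_add (hs 0) (hs l)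
      linarith
  have hD : ∑ u : ι → F, ∑ l : J → F, ct (fun M : ι × J → F => rho f (H e) (aff a b M) ≠
      rho f (H e) (aff a b (M + tens u l))) ≤ L * (2 * q * ct (Rej f H)) := by
    rw [sum_comm]
    refine (sum_le_sum fun l _ => hl l).trans (le_of_eq ?_)
    rw [sum_const, card_univ, nsmul_eq_mul]
    simp [hL, hqd]
  have h3 : (q - 1) * (Q * L * ct fun M => rho f (H e) (aff a b M) ≠ C) ≤
      q * (L * (2 * q * ct (Rej f H))) :=
    hC.trans (mul_le_mul_of_nonneg_left hD (by linarith))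
  have h4 : L * ((q - 1) * (Q * ct fun M => rho f (H e) (aff a b M) ≠ C)) ≤
      L * (q * (2 * q * ct (Rej f H))) := by linarith
  have h5 := le_of_mul_le_mul_left h4 hL0
  have h6 : q * (2 * q * ct (Rej f H)) ≤ (q - 1) * (4 * q * ct (Rej f H)) := by
    have := ct_nonneg (Rej f H)
    have : 0 ≤ q * ct (Rej f H) := by positivity
    nlinarith
  exact le_of_mul_le_mul_left (h5.trans h6) (by linarith)

end Fibres

section Monomials
variable {F : Type} [Field F] [Fintype F] {ι X Y : Type} [Fintype ι] [DecidableEq ι]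
  [Fintype X] [DecidableEq X] [Fintype Y] [DecidableEq Y]

/-- A function of the first block of coordinates times a monomial in the second block. -/
def blockTest (G : (X → F) → F) (e : Y → ℕ) (x : X ⊕ Y → F) : F :=
  G (fun i => x (Sum.inl i)) * ∏ j, x (Sum.inr j) ^ e j

/-- The functional `x ↦ x j - c`. -/
def coordSub {J : Type} [DecidableEq J] (j : J) (c : F) : Option J → F :=
  Pi.single (some j) 1 - c • one' F J

theorem coordSub_dot {J : Type} [Fintype J] [DecidableEq J] (j : J) (c : F) (x : J → F) :
    coordSub j c ⬝ᵥ hat x = x j - c := by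
  rw [coordSub, sub_dotProduct, smul_dotProduct, one'_dot]
  simp [hat]

open Classical in
theorem sum_rho_coordSub {J : Type} [Fintype J] [DecidableEq J] (f : (ι → F) → F)
    (h : (J → F) → F) (T : ι × Option J → F)
    (u : ι → F) (j : J) (c : F) :
    ∑ τ : F, rho f h (T + tens u (τ • coordSub j c)) =
      ∑ x, (if x j = c then 0 else ∑ z : F, f (app T x + z • u)) * h x := by
  unfold rho
  rw [sum_comm]
  refine sum_congr rfl fun x _ => ?_
  rw [← sum_mul]
  congr 1
  have e3 : ∀ τ : F, app (T + tens u (τ • coordSub j c)) x = app T x + (τ * (x j - c) + 0) • u := by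
    intro τ
    rw [app_add, app_tens, smul_dotProduct, coordSub_dot, smul_eq_mul, add_zero]
  simp only [e3]
  split_ifs with hx
  · rw [hx]
    simp only [sub_self, mul_zero]
    exact sum_const_field _
  · exact sum_affine_ne (fun z => f (app T x + z • u)) (sub_ne_zero.2 hx) 0

/-- All tests from the family vanish on `T + D` for the relevant shifts `D` in direction `u`. -/
def GoodDir (S : (ι × Option (X ⊕ Y) → F) → Prop) (a : X ⊕ Y → F)
    (T : ι × Option (X ⊕ Y) → F) (u : ι → F) : Prop :=
  (∀ τ : F, τ ≠ 0 → ¬S (T + tens u (τ • one' F (X ⊕ Y)))) ∧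
  ∀ (j : Y) (c τ : F), c ≠ a (Sum.inr j) → τ ≠ 0 → ¬S (T + tens u (τ • coordSub (Sum.inr j) c))

variable {V : (Y → ℕ) → Prop}

theorem rho_update (f : (ι → F) → F) (G : (X → F) → F)
    (hV : ∀ e j, V e → V (Function.update e j 0)) (a : X ⊕ Y → F)
    (T : ι × Option (X ⊕ Y) → F) (u : ι → F)
    (hg : GoodDir (Rej f fun e : {e // V e} => blockTest G e.1) a T u) (j : Y) (e : Y → ℕ)
    (he : V e) :
    rho f (blockTest G e) T =
      a (Sum.inr j) ^ e j * rho f (blockTest G (Function.update e j 0)) T := by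
  classical
  set A : (X ⊕ Y → F) → F := fun x => ∑ z : F, f (app T x + z • u) with hA
  have hacc : ∀ {T'}, ¬Rej f (fun e : {e // V e} => blockTest G e.1) T' → ∀ e, V e →
      rho f (blockTest G e) T' = 0 := by
    intro T' h e he
    by_contra h0
    exact h ⟨⟨e, he⟩, h0⟩
  have h1 : ∀ e, V e → rho f (blockTest G e) T = ∑ x, A x * blockTest G e x := by
    intro e he
    rw [hA, ← sum_rho_one f (blockTest G e) T u 0,
      sum_eq_single 0 (fun τ _ hτ => by rw [zero_add]; exact hacc (hg.1 τ hτ) e he) (by simp)]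
    simp [tens_zero]
  have h2 : ∀ e, V e → ∀ c, c ≠ a (Sum.inr j) →
      ∑ x, (if x (Sum.inr j) = c then A x * blockTest G e x else 0) = 0 := by
    intro e he c hc
    have h3 := sum_rho_coordSub f (blockTest G e) T u (Sum.inr j) c
    rw [sum_eq_single 0 (fun τ _ hτ => hacc (hg.2 j c τ hc hτ) e he) (by simp), zero_smul,
      tens_zero, add_zero, h1 e he, ← sub_eq_zero, ← sum_sub_distrib] at h3
    refine Eq.trans (sum_congr rfl fun x _ => ?_) h3
    split_ifs <;> simp [hA]
  have h3 : ∀ e, V e → rho f (blockTest G e) T =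
      ∑ x, (if x (Sum.inr j) = a (Sum.inr j) then A x * blockTest G e x else 0) := by
    intro e he
    rw [h1 e he]
    have : ∀ x, A x * blockTest G e x =
        ∑ c, (if x (Sum.inr j) = c then A x * blockTest G e x else 0) := by
      intro x; simp
    rw [sum_congr rfl fun x _ => this x, sum_comm, sum_eq_single (a (Sum.inr j))]
    · exact fun c _ hc => h2 e he c hc
    · simp
  rw [h3 e he, h3 _ (hV e j he), mul_sum]
  refine sum_congr rfl fun x _ => ?_
  split_ifs with hx
  · unfold blockTest
    rw [← mul_prod_erase univ (fun i => x (Sum.inr i) ^ e i) (mem_univ j),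
      ← mul_prod_erase univ (fun i => x (Sum.inr i) ^ Function.update e j 0 i) (mem_univ j)]
    have : ∏ i ∈ univ.erase j, x (Sum.inr i) ^ Function.update e j 0 i =
        ∏ i ∈ univ.erase j, x (Sum.inr i) ^ e i :=
      prod_congr rfl fun i hi => by rw [Function.update_of_ne (ne_of_mem_erase hi)]
    rw [this, hx]
    simp
    ring
  · simp

theorem rho_eq_prod (f : (ι → F) → F) (G : (X → F) → F)
    (hV : ∀ e j, V e → V (Function.update e j 0)) (a : X ⊕ Y → F)
    (T : ι × Option (X ⊕ Y) → F) (u : ι → F)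
    (hg : GoodDir (Rej f fun e : {e // V e} => blockTest G e.1) a T u) (e : Y → ℕ)
    (he : V e) :
    rho f (blockTest G e) T = (∏ j, a (Sum.inr j) ^ e j) * rho f (blockTest G 0) T := by
  classical
  have key : ∀ s : Finset Y, V (fun j => if j ∈ s then 0 else e j) ∧
      rho f (blockTest G e) T = (∏ j ∈ s, a (Sum.inr j) ^ e j) *
        rho f (blockTest G fun j => if j ∈ s then 0 else e j) T := by
    intro s
    induction s using Finset.induction_on with
    | empty => simpa using he
    | insert j s hj ih =>
      have hup : Function.update (fun j => if j ∈ s then 0 else e j) j 0 =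
          fun i => if i ∈ insert j s then 0 else e i := by
        funext i
        by_cases hi : i = j
        · subst hi; simp
        · rw [Function.update_of_ne hi]
          simp [hi]
      have h1 := hV _ j ih.1
      have h2 := rho_update f G hV a T u hg j _ ih.1
      rw [hup] at h1 h2
      refine ⟨h1, ?_⟩
      rw [ih.2, h2, prod_insert hj]
      simp only [hj, if_false]
      ring
  have := (key univ).2
  simp only [mem_univ, if_true] at this
  exact this

theorem ct_not_goodDir (S : (ι × Option (X ⊕ Y) → F) → Prop) (a : X ⊕ Y → F)
    (b : ι → F) :
    Fintype.card (ι → F) * ct (fun T => app T a = b ∧ ∀ u, ¬GoodDir S a T u) ≤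
      (Fintype.card F + Fintype.card Y * (Fintype.card F : ℝ) ^ 2) * ct S := by
  classical
  rw [ct_fibre]
  let ev1 : F → (ι × (X ⊕ Y) → F) × (ι → F) → Prop := fun τ x =>
    τ ≠ 0 ∧ S (aff a b x.1 + tens x.2 (τ • one' F (X ⊕ Y)))
  let ev2 : Y × F × F → (ι × (X ⊕ Y) → F) × (ι → F) → Prop := fun y x =>
    (y.2.1 ≠ a (Sum.inr y.1) ∧ y.2.2 ≠ 0) ∧
      S (aff a b x.1 + tens x.2 (y.2.2 • coordSub (Sum.inr y.1) y.2.1))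
  have b1 : ∀ τ, ct (ev1 τ) ≤ ct S := by
    intro τ
    by_cases hτ : τ = 0
    · refine le_trans (le_of_eq ?_) (ct_nonneg _)
      exact sum_eq_zero fun x _ => ind_neg fun hx => hx.1 hτ
    · refine (ct_mono fun x hx => hx.2).trans
        (ct_fibre_push S a b (fun u => tens u (τ • one' F (X ⊕ Y))) ?_)
      simp only [app_tens, smul_dotProduct, one'_dot, smul_eq_mul, mul_one]
      exact smul_right_injective_fun hτ
  have b2 : ∀ y, ct (ev2 y) ≤ ct S := by
    rintro ⟨j, c, τ⟩
    by_cases hτ : c ≠ a (Sum.inr j) ∧ τ ≠ 0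
    · refine (ct_mono fun x hx => hx.2).trans
        (ct_fibre_push S a b (fun u => tens u (τ • coordSub (Sum.inr j) c)) ?_)
      simp only [app_tens, smul_dotProduct, coordSub_dot, smul_eq_mul]
      exact smul_right_injective_fun (mul_ne_zero hτ.2 (sub_ne_zero.2 hτ.1.symm))
    · refine le_trans (le_of_eq ?_) (ct_nonneg _)
      exact sum_eq_zero fun x _ => ind_neg fun hx => hτ hx.1
  rw [← ct_ignore_right (β := ι → F) (fun M : ι × (X ⊕ Y) → F => ∀ u, ¬GoodDir S a (aff a b M) u)]
  refine (ct_mono (q := fun x => (∃ τ, ev1 τ x) ∨ ∃ y, ev2 y x) ?_).trans ((ct_or_le _ _).trans ?_)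
  · intro x hx
    by_contra hcon
    refine hx x.2 ⟨fun τ hτ h0 => hcon (Or.inl ⟨τ, hτ, h0⟩), fun j c τ hc hτ h0 =>
      hcon (Or.inr ⟨(j, c, τ), ⟨hc, hτ⟩, h0⟩)⟩
  · rw [add_mul]
    refine add_le_add ((ct_exists_le _).trans ((sum_le_sum fun τ _ => b1 τ).trans (le_of_eq ?_)))
      ((ct_exists_le _).trans ((sum_le_sum fun y _ => b2 y).trans (le_of_eq ?_)))
    · rw [sum_const, card_univ, nsmul_eq_mul]
    · rw [sum_const, card_univ, nsmul_eq_mul, Fintype.card_prod, Fintype.card_prod]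
      push_cast
      ring

/-- On maps sending `a` to `b`, all test values are almost always `C` times the monomials of the
second block of `a`. -/
theorem almost_monomial (f : (ι → F) → F) (G : (X → F) → F)
    (hV : ∀ e j, V e → V (Function.update e j 0)) (hV0 : V 0)
    (hY : (Fintype.card Y : ℝ) ≤ 10 * Fintype.card F) (a : X ⊕ Y → F) (b : ι → F) :
    ∃ C : F, Fintype.card (ι → F) * ct (fun T => app T a = b ∧
        ¬∀ e, V e → rho f (blockTest G e) T = C * ∏ j, a (Sum.inr j) ^ e j) ≤
      12 * (Fintype.card F : ℝ) ^ 3 * ct (Rej f fun e : {e // V e} => blockTest G e.1) := by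
  classical
  set S := Rej f fun e : {e // V e} => blockTest G e.1 with hS
  obtain ⟨C, hC⟩ := almost_constant f (fun e : {e // V e} => blockTest G e.1) ⟨0, hV0⟩ a b
  refine ⟨C, ?_⟩
  have h1 := ct_not_goodDir S a b
  have h2 : ct (fun T => app T a = b ∧
        ¬∀ e, V e → rho f (blockTest G e) T = C * ∏ j, a (Sum.inr j) ^ e j) ≤
      ct (fun T => app T a = b ∧ rho f (blockTest G 0) T ≠ C) +
        ct (fun T => app T a = b ∧ ∀ u, ¬GoodDir S a T u) := by
    refine le_trans (ct_mono ?_) (ct_or_le _ _)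
    intro T hT
    by_contra hcon
    refine hT.2 fun e he => ?_
    rw [not_or, not_and, not_and, not_not] at hcon
    have h4 := hcon.2 hT.1
    push Not at h4
    obtain ⟨u, hu⟩ := h4
    rw [rho_eq_prod f G hV a T u hu e he, hcon.1 hT.1, mul_comm]
  have hq := two_le_card_field F
  have hQ0 : (0 : ℝ) < Fintype.card (ι → F) := card_fun_pos
  have hS0 := ct_nonneg S
  refine (mul_le_mul_of_nonneg_left h2 hQ0.le).trans ?_
  rw [mul_add]
  refine (add_le_add hC h1).trans ?_
  rw [← hS, ← add_mul]
  refine mul_le_mul_of_nonneg_right ?_ hS0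
  set q : ℝ := (Fintype.card F : ℝ)
  have h5 : (Fintype.card Y : ℝ) * q ^ 2 ≤ 10 * q * q ^ 2 := by gcongr
  nlinarith [mul_nonneg (sub_nonneg.2 hq) (sub_nonneg.2 hq), sq_nonneg q]

end Monomials

section Blocks
variable {F : Type} [Field F] [Fintype F] [DecidableEq F] {ι β K Y : Type} [Fintype ι] [DecidableEq ι]
  [Fintype β] [DecidableEq β] [Fintype K] [DecidableEq K] [Fintype Y] [DecidableEq Y]

/-- The product of copies of `g` over disjoint blocks of coordinates. -/
def blockProd (g : (K → F) → F) (x : β × K → F) : F := ∏ i, g fun l => x (i, l)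

theorem rho_aff_zero (f : (ι → F) → F) (G : (β × K → F) → F) (a : β × K ⊕ Y → F) (b : ι → F)
    (M : ι × (β × K ⊕ Y) → F) :
    rho f (blockTest G 0) (aff a b M) =
      ∑ z : β × K ⊕ Y → F, f (b + mv M z) * G fun i => z (Sum.inl i) + a (Sum.inl i) := by
  unfold rho
  rw [← Equiv.sum_comp (Equiv.addRight a)]
  refine sum_congr rfl fun z _ => ?_
  rw [app_aff]
  simp [blockTest]

/-- Rescaling of the columns of a matrix by invertible factors. -/
def colScale {J : Type} (d : J → Fˣ) : (ι × J → F) ≃ (ι × J → F) where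
  toFun M p := M p * d p.2
  invFun M p := M p * (d p.2)⁻¹
  left_inv M := by funext p; simp
  right_inv M := by funext p; simp

theorem mv_colScale {J : Type} [Fintype J] (d : J → Fˣ) (M : ι × J → F) (z : J → F) :
    mv (colScale d M) z = mv M (fun j => d j * z j) := by
  funext i
  simp [mv, colScale, mul_assoc]

/-- Columns of block `i` are scaled by `c`. -/
def blockUnit (i : β) (c : Fˣ) : β × K ⊕ Y → Fˣ := Sum.elim (fun p => if p.1 = i then c else 1) 1

theorem rho_blockScale (f : (ι → F) → F) (G : (β × K → F) → F) (a : β × K ⊕ Y → F) (b : ι → F)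
    (M : ι × (β × K ⊕ Y) → F) (d : β × K ⊕ Y → Fˣ) :
    rho f (blockTest G 0) (aff a b (colScale (fun j => (d j)⁻¹) M)) =
      ∑ z : β × K ⊕ Y → F, f (b + mv M z) *
        G fun i => d (Sum.inl i) * z (Sum.inl i) + a (Sum.inl i) := by
  rw [rho_aff_zero]
  let E : (β × K ⊕ Y → F) ≃ (β × K ⊕ Y → F) :=
    { toFun := fun z j => d j * z j
      invFun := fun z j => ((d j)⁻¹ : Fˣ) * z j
      left_inv := fun z => by funext j; simp
      right_inv := fun z => by funext j; simp }
  rw [← Equiv.sum_comp E]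
  refine sum_congr rfl fun z _ => ?_
  rw [mv_colScale]
  have h1 : (fun j => (((d j)⁻¹ : Fˣ) : F) * E z j) = z := by
    funext j; simp [E]
  rw [h1]
  rfl

theorem sum_field_eq (φ : F → F) : ∑ κ, φ κ = φ 0 + ∑ κ : Fˣ, φ κ := by
  classical
  rw [Fintype.sum_eq_add_sum_subtype_ne φ 0]
  congr 1
  exact (Equiv.sum_comp unitsEquivNeZero (fun x : {x : F // x ≠ 0} => φ x)).symm

/-- The sum obtained from the zeroth test by deleting one block. -/
def deleted (f : (ι → F) → F) (g : (K → F) → F) (i : β) (a : β × K ⊕ Y → F) (b : ι → F)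
    (M : ι × (β × K ⊕ Y) → F) : F :=
  ∑ z : β × K ⊕ Y → F, f (b + mv M z) *
    ∏ i' ∈ univ.erase i, g fun l => z (Sum.inl (i', l)) + a (Sum.inl (i', l))

theorem sum_rho_blockScale (f : (ι → F) → F) (g : (K → F) → F)
    (hg : ∀ x a : K → F, ∑ κ : F, g (κ • x + a) = 0) (i : β) (a : β × K ⊕ Y → F) (b : ι → F)
    (M : ι × (β × K ⊕ Y) → F) :
    ∑ κ : Fˣ, rho f (blockTest (blockProd g) 0)
        (aff a b (colScale (fun j => (blockUnit i κ j)⁻¹) M)) =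
      -(g (fun l => a (Sum.inl (i, l))) * deleted f g i a b M) := by
  simp only [rho_blockScale]
  rw [sum_comm]
  rw [eq_neg_iff_add_eq_zero, deleted, mul_sum, ← sum_add_distrib]
  refine sum_eq_zero fun z _ => ?_
  have h1 : ∀ κ : Fˣ, blockProd g (fun j => (blockUnit (Y := Y) i κ (Sum.inl j) : F) *
        z (Sum.inl j) + a (Sum.inl j)) =
      g ((κ : F) • (fun l => z (Sum.inl (i, l))) + fun l => a (Sum.inl (i, l))) *
      ∏ i' ∈ univ.erase i, g fun l => z (Sum.inl (i', l)) + a (Sum.inl (i', l)) := by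
    intro κ
    rw [blockProd, ← mul_prod_erase univ _ (mem_univ i)]
    congr 1
    · congr 1
      funext l
      simp [blockUnit]
    · refine prod_congr rfl fun i' hi' => ?_
      simp [blockUnit, ne_of_mem_erase hi']
  simp only [h1]
  have h2 := hg (fun l => z (Sum.inl (i, l))) (fun l => a (Sum.inl (i, l)))
  rw [sum_field_eq, zero_smul, zero_add] at h2
  rw [← mul_sum, ← sum_mul]
  rw [add_comm] at h2
  rw [eq_neg_of_add_eq_zero_left h2]
  ring

variable {f : (ι → F) → F} {g : (K → F) → F} {b : ι → F} {C : (β × K ⊕ Y → F) → F}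

theorem exists_deleted_eq (hg : ∀ x a : K → F, ∑ κ : F, g (κ • x + a) = 0)
    (hC : ∀ a, 4 * Fintype.card F *
      ct (fun M => rho f (blockTest (blockProd g) 0) (aff a b M) ≠ C a) <
        Fintype.card (ι × (β × K ⊕ Y) → F)) (i : β) (a a' : β × K ⊕ Y → F) :
    ∃ M, C a = g (fun l => a (Sum.inl (i, l))) * deleted f g i a b M ∧
      C a' = g (fun l => a' (Sum.inl (i, l))) * deleted f g i a' b M := by
  classical
  have key : ∀ (a : β × K ⊕ Y → F) M, (∀ κ : Fˣ, rho f (blockTest (blockProd g) 0)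
      (aff a b (colScale (fun j => (blockUnit i κ j)⁻¹) M)) = C a) →
      C a = g (fun l => a (Sum.inl (i, l))) * deleted f g i a b M := by
    intro a M h
    have h1 := sum_rho_blockScale f g hg i a b M
    simp only [h] at h1
    have h2 := sum_field_eq fun _ : F => C a
    rw [sum_const_field, h1] at h2
    linear_combination -h2
  let bad : (β × K ⊕ Y → F) → (ι × (β × K ⊕ Y) → F) → Prop := fun a M =>
    ∃ κ : Fˣ, rho f (blockTest (blockProd g) 0)
      (aff a b (colScale (fun j => (blockUnit i κ j)⁻¹) M)) ≠ C a
  have hbad : ∀ a, 4 * ct (bad a) < Fintype.card (ι × (β × K ⊕ Y) → F) := by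
    intro a
    refine lt_of_le_of_lt ?_ (hC a)
    rw [mul_assoc]
    refine mul_le_mul_of_nonneg_left ?_ (by norm_num)
    refine (ct_exists_le _).trans ?_
    simp only [fun κ : Fˣ => ct_equiv (colScale (ι := ι) fun j => (blockUnit (Y := Y) (K := K) i κ j)⁻¹)
      (fun M => rho f (blockTest (blockProd g) 0) (aff a b M) ≠ C a)]
    rw [sum_const, card_univ, nsmul_eq_mul]
    refine mul_le_mul_of_nonneg_right ?_ (ct_nonneg _)
    exact_mod_cast Fintype.card_le_of_injective (fun κ : Fˣ => (κ : F)) Units.val_injective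
  have h2 : 0 < ct fun M => ¬(bad a M ∨ bad a' M) := by
    rw [ct_not]
    have := ct_or_le (bad a) (bad a')
    have h3 := hbad a
    have h4 := hbad a'
    have h5 : (0 : ℝ) ≤ Fintype.card (ι × (β × K ⊕ Y) → F) := Nat.cast_nonneg _
    linarith
  obtain ⟨M, hM⟩ := exists_of_ct_pos h2
  rw [not_or] at hM
  simp only [bad, not_exists, not_not] at hM
  exact ⟨M, key a M hM.1, key a' M hM.2⟩

theorem eq_of_block_eq (hC : ∀ a, 4 * Fintype.card F *
      ct (fun M => rho f (blockTest (blockProd g) 0) (aff a b M) ≠ C a) <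
        Fintype.card (ι × (β × K ⊕ Y) → F)) {a a' : β × K ⊕ Y → F}
    (h : ∀ i, a (Sum.inl i) = a' (Sum.inl i)) : C a = C a' := by
  classical
  have hbad : ∀ a, 4 * ct (fun M => rho f (blockTest (blockProd g) 0) (aff a b M) ≠ C a) <
      Fintype.card (ι × (β × K ⊕ Y) → F) := by
    intro a
    refine lt_of_le_of_lt ?_ (hC a)
    have := one_le_card_field F
    nlinarith [ct_nonneg (fun M => rho f (blockTest (blockProd g) 0) (aff a b M) ≠ C a)]
  have h2 : 0 < ct fun M => ¬(rho f (blockTest (blockProd g) 0) (aff a b M) ≠ C a ∨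
      rho f (blockTest (blockProd g) 0) (aff a' b M) ≠ C a') := by
    rw [ct_not]
    have := ct_or_le (fun M => rho f (blockTest (blockProd g) 0) (aff a b M) ≠ C a)
      (fun M => rho f (blockTest (blockProd g) 0) (aff a' b M) ≠ C a')
    have h3 := hbad a
    have h4 := hbad a'
    have h5 : (0 : ℝ) ≤ Fintype.card (ι × (β × K ⊕ Y) → F) := Nat.cast_nonneg _
    linarith
  obtain ⟨M, hM⟩ := exists_of_ct_pos h2
  rw [not_or, not_not, not_not] at hM
  rw [← hM.1, ← hM.2, rho_aff_zero, rho_aff_zero]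
  simp only [h]

theorem deleted_congr (i : β) {a a' : β × K ⊕ Y → F}
    (h : ∀ p : β × K, p.1 ≠ i → a (Sum.inl p) = a' (Sum.inl p)) (M : ι × (β × K ⊕ Y) → F) :
    deleted f g i a b M = deleted f g i a' b M := by
  unfold deleted
  refine sum_congr rfl fun z _ => ?_
  congr 1
  refine prod_congr rfl fun i' hi' => ?_
  simp only [h (i', _) (ne_of_mem_erase hi')]

theorem exists_blockProd_eq (hg : ∀ x a : K → F, ∑ κ : F, g (κ • x + a) = 0)
    (hC : ∀ a, 4 * Fintype.card F *
      ct (fun M => rho f (blockTest (blockProd g) 0) (aff a b M) ≠ C a) <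
        Fintype.card (ι × (β × K ⊕ Y) → F)) {a₀ : β × K ⊕ Y → F} (h₀ : C a₀ ≠ 0) :
    ∃ v ≠ 0, ∀ a, C a = v * blockProd g fun i => a (Sum.inl i) := by
  classical
  have hg0 : ∀ i, g (fun l => a₀ (Sum.inl (i, l))) ≠ 0 := by
    intro i h
    obtain ⟨M, hM, -⟩ := exists_deleted_eq hg hC i a₀ a₀
    rw [h, zero_mul] at hM
    exact h₀ hM
  have hP0 : blockProd g (fun i => a₀ (Sum.inl i)) ≠ 0 :=
    prod_ne_zero_iff.2 fun i _ => hg0 i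
  refine ⟨C a₀ / blockProd g (fun i => a₀ (Sum.inl i)), div_ne_zero h₀ hP0, fun a => ?_⟩
  let mix : Finset β → β × K ⊕ Y → F := fun s =>
    Sum.elim (fun p => if p.1 ∈ s then a (Sum.inl p) else a₀ (Sum.inl p)) fun j => a₀ (Sum.inr j)
  have key : ∀ s : Finset β, C (mix s) * ∏ i ∈ s, g (fun l => a₀ (Sum.inl (i, l))) =
      C a₀ * ∏ i ∈ s, g (fun l => a (Sum.inl (i, l))) := by
    intro s
    induction s using Finset.induction_on with
    | empty =>
      simp only [prod_empty, mul_one]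
      congr 1
      funext j
      rcases j with p | j <;> simp [mix]
    | insert i s hi ih =>
      obtain ⟨M, h1, h2⟩ := exists_deleted_eq hg hC i (mix s) (mix (insert i s))
      rw [deleted_congr i (a := mix (insert i s)) (a' := mix s)] at h2
      · have e1 : (fun l => mix s (Sum.inl (i, l))) = fun l => a₀ (Sum.inl (i, l)) := by
          funext l; simp [mix, hi]
        have e2 : (fun l => mix (insert i s) (Sum.inl (i, l))) = fun l => a (Sum.inl (i, l)) := by
          funext l; simp [mix]
        rw [e1] at h1
        rw [e2] at h2
        rw [prod_insert hi, prod_insert hi]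
        rw [h1] at ih
        rw [h2]
        linear_combination g (fun l => a (Sum.inl (i, l))) * ih
      · intro p hp
        simp [mix, hp]
  have h1 := key univ
  have h2 : C (mix univ) = C a := eq_of_block_eq hC fun i => by simp [mix]
  rw [h2] at h1
  rw [div_mul_eq_mul_div, eq_div_iff hP0]
  exact h1

end Blocks

section Correction
variable {F : Type} [Field F] [Fintype F] [DecidableEq F] {ι β K Y : Type} [Fintype ι]
  [DecidableEq ι]
  [Fintype β] [DecidableEq β] [Fintype K] [DecidableEq K] [Fintype Y] [DecidableEq Y]
variable {V : (Y → ℕ) → Prop}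

/-- If few affine maps reject `f`, then some value `b` of the domain carries an error: on almost
every map through `b`, the tests evaluate to a fixed multiple of their value at the preimage. -/
theorem exists_error (f : (ι → F) → F) (g : (K → F) → F)
    (hg : ∀ x a : K → F, ∑ κ : F, g (κ • x + a) = 0)
    (hV : ∀ e j, V e → V (Function.update e j 0)) (hV0 : V 0)
    (hY : (Fintype.card Y : ℝ) ≤ 10 * Fintype.card F)
    (hne : ∃ T : ι × Option (β × K ⊕ Y) → F,
      Rej f (fun e : {e // V e} => blockTest (blockProd g) e.1) T)
    (hsmall : (Fintype.card F : ℝ) ^ 30 *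
      ct (Rej f fun e : {e // V e} => blockTest (blockProd (β := β) g) e.1) ≤
        Fintype.card (ι × Option (β × K ⊕ Y) → F)) :
    ∃ (b : ι → F) (v : F), v ≠ 0 ∧ (∃ x : β × K → F, blockProd g x ≠ 0) ∧
      ∀ a : β × K ⊕ Y → F, Fintype.card (ι → F) * ct (fun T => app T a = b ∧
        ¬∀ e, V e → rho f (blockTest (blockProd g) e) T = v * blockTest (blockProd g) e a) ≤
      12 * (Fintype.card F : ℝ) ^ 3 *
        ct (Rej f fun e : {e // V e} => blockTest (blockProd (β := β) g) e.1) := by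
  obtain ⟨a₀, b, hab⟩ := level_one_affine f _ hne hsmall
  choose C hC using fun a => almost_monomial f (blockProd (β := β) g) hV hV0 hY a b
  have hq := two_le_card_field F
  set S := Rej f fun e : {e // V e} => blockTest (blockProd (β := β) g) e.1 with hS
  have hS1 : 1 ≤ ct S := ct_pos hne
  have hQ0 : (0 : ℝ) < Fintype.card (ι → F) := card_fun_pos
  have hpow : (384 : ℝ) * (Fintype.card F : ℝ) ^ 4 ≤ (Fintype.card F : ℝ) ^ 30 := by
    calc (384 : ℝ) * (Fintype.card F : ℝ) ^ 4 ≤ 2 ^ 26 * (Fintype.card F : ℝ) ^ 4 := by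
          gcongr; norm_num
      _ ≤ (Fintype.card F : ℝ) ^ 26 * (Fintype.card F : ℝ) ^ 4 := by gcongr
      _ = _ := by ring
  have hbig : (384 : ℝ) * (Fintype.card F : ℝ) ^ 4 * ct S ≤
      Fintype.card (ι × Option (β × K ⊕ Y) → F) :=
    (mul_le_mul_of_nonneg_right hpow (by linarith)).trans hsmall
  have hC0 : C a₀ ≠ 0 := by
    intro h0
    have h1 : ct (fun T => S T ∧ app T a₀ = b) ≤ ct (fun T => app T a₀ = b ∧
        ¬∀ e, V e → rho f (blockTest (blockProd g) e) T = C a₀ * ∏ j, a₀ (Sum.inr j) ^ e j) := by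
      refine ct_mono fun T hT => ⟨hT.2, fun hall => ?_⟩
      obtain ⟨⟨e, he⟩, hr⟩ := hT.1
      apply hr
      rw [hall e he, h0, zero_mul]
    have h2 := (mul_le_mul_of_nonneg_left h1 hQ0.le).trans (hC a₀)
    have h3 := mul_le_mul_of_nonneg_left h2 (a := 32 * (Fintype.card F : ℝ)) (by positivity)
    linarith
  have hC4 : ∀ a, 4 * Fintype.card F *
      ct (fun M => rho f (blockTest (blockProd g) 0) (aff a b M) ≠ C a) <
        (Fintype.card (ι × (β × K ⊕ Y) → F) : ℝ) := by
    intro a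
    have h1 : ct (fun M => rho f (blockTest (blockProd g) 0) (aff a b M) ≠ C a) ≤
        ct (fun T => app T a = b ∧
        ¬∀ e, V e → rho f (blockTest (blockProd g) e) T = C a * ∏ j, a (Sum.inr j) ^ e j) := by
      rw [← ct_fibre a b fun T => rho f (blockTest (blockProd g) 0) T ≠ C a]
      refine ct_mono fun T hT => ⟨hT.1, fun hall => hT.2 ?_⟩
      rw [hall 0 hV0]
      simp
    have h2 := (mul_le_mul_of_nonneg_left h1 hQ0.le).trans (hC a)
    have h3 := mul_le_mul_of_nonneg_left h2 (a := 4 * (Fintype.card F : ℝ)) (by positivity)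
    rw [← card_fibre (J := β × K ⊕ Y)] at hbig
    refine lt_of_mul_lt_mul_left ?_ hQ0.le
    have h4 : 0 < (Fintype.card F : ℝ) ^ 4 * ct S := by positivity
    linarith
  obtain ⟨v, hv, hCv⟩ := exists_blockProd_eq hg hC4 hC0
  refine ⟨b, v, hv, ⟨_, right_ne_zero_of_mul (hCv a₀ ▸ hC0)⟩, fun a => ?_⟩
  have := hC a
  simp only [hCv a, mul_assoc] at this ⊢
  exact this

/-- Modification of `f` at the point `b`. -/
def correct (f : (ι → F) → F) (b : ι → F) (v : F) : (ι → F) → F := fun y =>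
  f y - if y = b then v else 0

theorem rho_correct {J : Type} [Fintype J] [DecidableEq J] (f : (ι → F) → F) (b : ι → F) (v : F)
    (h : (J → F) → F) (T : ι × Option J → F) :
    rho (correct f b v) h T = rho f h T - ∑ x, if app T x = b then v * h x else 0 := by
  unfold rho correct
  rw [← sum_sub_distrib]
  refine sum_congr rfl fun x _ => ?_
  split_ifs <;> ring

theorem ct_two_points {J : Type} [Fintype J] [DecidableEq J] {a a' : J → F} (h : a ≠ a')
    (b : ι → F) :
    (Fintype.card (ι → F) : ℝ) ^ 2 *
      ct (fun T : ι × Option J → F => app T a = b ∧ app T a' = b) ≤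
      Fintype.card (ι × Option J → F) := by
  obtain ⟨j, hj⟩ := Function.ne_iff.1 h.symm
  have hdot : vanishAt a (Pi.single j 1) ⬝ᵥ hat a' ≠ 0 := by
    rw [vanishAt_dot]
    simpa [sub_eq_zero] using hj
  have h1 := push_count (fun T : ι × Option J → F => app T a = b) (hat a') b
    (fun u : ι → F => tens u (vanishAt a (Pi.single j 1))) (by
      simp only [mv_tens]
      exact smul_right_injective_fun hdot)
  have h2 : ct (fun x : (ι × Option J → F) × (ι → F) => app x.1 a = b ∧ app x.1 a' = b) ≤
      ct (fun T : ι × Option J → F => app T a = b) := by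
    refine le_trans (ct_mono fun x hx => ⟨hx.2, ?_⟩) h1
    rw [app_add, app_tens, vanishAt_dot]
    simpa using hx.1
  rw [ct_ignore_right (fun T : ι × Option J → F => app T a = b ∧ app T a' = b)] at h2
  rw [← ct_eq_of_app a b, sq, mul_assoc]
  gcongr

/-- Correcting the error at `b` lowers the number of rejecting maps proportionally to the size of
the support of the tests. -/
theorem ct_rej_correct_le (f : (ι → F) → F) (g : (K → F) → F) (hV0 : V 0)
    (hn : 8 * (Fintype.card (β × K ⊕ Y → F) : ℝ) ≤ Fintype.card (ι → F))
    (hsmall : (Fintype.card F : ℝ) ^ 30 *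
      ct (Rej f fun e : {e // V e} => blockTest (blockProd (β := β) g) e.1) ≤
        Fintype.card (ι × Option (β × K ⊕ Y) → F)) {b : ι → F} {v : F} (hv : v ≠ 0)
    (hb : ∀ a : β × K ⊕ Y → F, Fintype.card (ι → F) * ct (fun T => app T a = b ∧
        ¬∀ e, V e → rho f (blockTest (blockProd g) e) T = v * blockTest (blockProd g) e a) ≤
      12 * (Fintype.card F : ℝ) ^ 3 *
        ct (Rej f fun e : {e // V e} => blockTest (blockProd (β := β) g) e.1)) :
    2 * (Fintype.card (ι → F) *
        ct (Rej (correct f b v) fun e : {e // V e} => blockTest (blockProd (β := β) g) e.1)) +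
      ct (fun x : β × K ⊕ Y → F => blockProd g (fun i => x (Sum.inl i)) ≠ 0) *
        Fintype.card (ι × Option (β × K ⊕ Y) → F) ≤
    2 * (Fintype.card (ι → F) *
      ct (Rej f fun e : {e // V e} => blockTest (blockProd (β := β) g) e.1)) := by
  classical
  set H : {e // V e} → (β × K ⊕ Y → F) → F := fun e => blockTest (blockProd (β := β) g) e.1 with hH
  set P : (β × K ⊕ Y → F) → Prop := fun x => blockProd g (fun i => x (Sum.inl i)) ≠ 0 with hP
  set bad : (β × K ⊕ Y → F) → (ι × Option (β × K ⊕ Y) → F) → Prop := fun a T => app T a = b ∧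
    ¬∀ e, V e → rho f (blockTest (blockProd g) e) T = v * blockTest (blockProd g) e a with hbad
  have hP0 : ∀ x (e : Y → ℕ), ¬P x → blockTest (blockProd g) e x = 0 := by
    intro x e hx
    have : blockProd g (fun i => x (Sum.inl i)) = 0 := not_not.1 hx
    rw [blockTest, this, zero_mul]
  have hpt : ∀ T, (∑ a, (ind (P a ∧ app T a = b) - 2 * ind (P a ∧ bad a T) -
      2 * ∑ a', ind (P a ∧ a ≠ a' ∧ app T a = b ∧ (P a' ∧ app T a' = b)))) +
      ind (Rej (correct f b v) H T) ≤ ind (Rej f H T) := by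
    intro T
    by_cases hhit : ∃ a, P a ∧ app T a = b
    · obtain ⟨a, ha, hab⟩ := hhit
      by_cases htwo : ∃ a', a ≠ a' ∧ P a' ∧ app T a' = b
      · obtain ⟨a', haa', ha', hab'⟩ := htwo
        have h1 : ∀ x, ind (P x ∧ app T x = b) - 2 * ind (P x ∧ bad x T) -
            2 * ∑ a', ind (P x ∧ x ≠ a' ∧ app T x = b ∧ (P a' ∧ app T a' = b)) ≤
            -ind (a = x) := by
          intro x
          have h0 := ind_nonneg (P x ∧ bad x T)
          by_cases hx : P x ∧ app T x = b
          · obtain ⟨y, hy⟩ : ∃ y, x ≠ y ∧ P y ∧ app T y = b := by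
              by_cases hxa : x = a
              · exact ⟨a', hxa ▸ haa', ha', hab'⟩
              · exact ⟨a, hxa, ha, hab⟩
            have h2 : 1 ≤ ∑ a', ind (P x ∧ x ≠ a' ∧ app T x = b ∧ (P a' ∧ app T a' = b)) :=
              ct_pos (p := fun a' => P x ∧ x ≠ a' ∧ app T x = b ∧ (P a' ∧ app T a' = b))
                ⟨y, hx.1, hy.1, hx.2, hy.2⟩
            rw [ind_pos hx]
            have h3 := ind_le_one (a = x)
            linarith
          · have h2 : 0 ≤ ∑ a', ind (P x ∧ x ≠ a' ∧ app T x = b ∧ (P a' ∧ app T a' = b)) :=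
              sum_nonneg fun _ _ => ind_nonneg _
            rw [ind_neg hx, ind_neg (p := a = x)]
            · linarith
            · rintro rfl
              exact hx ⟨ha, hab⟩
        have h4 := sum_le_sum fun x (_ : x ∈ (univ : Finset (β × K ⊕ Y → F))) => h1 x
        rw [sum_neg_distrib, sum_ind_eq] at h4
        have h5 := ind_le_one (Rej (correct f b v) H T)
        have h6 := ind_nonneg (Rej f H T)
        linarith
      · have hone : ∀ x, P x ∧ app T x = b → x = a := by
          intro x hx
          by_contra hne
          exact htwo ⟨x, Ne.symm hne, hx⟩
        rw [sum_eq_single a]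
        · have h2 : 0 ≤ ∑ a', ind (P a ∧ a ≠ a' ∧ app T a = b ∧ (P a' ∧ app T a' = b)) :=
            sum_nonneg fun _ _ => ind_nonneg _
          rw [ind_pos ⟨ha, hab⟩]
          by_cases hbd : bad a T
          · rw [ind_pos (p := P a ∧ bad a T) ⟨ha, hbd⟩]
            have h5 := ind_le_one (Rej (correct f b v) H T)
            have h6 := ind_nonneg (Rej f H T)
            linarith
          · have hgood : ∀ e, V e → rho f (blockTest (blockProd g) e) T =
                v * blockTest (blockProd g) e a := by
              by_contra hcon
              exact hbd ⟨hab, hcon⟩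
            have hr : Rej f H T := by
              refine ⟨⟨0, hV0⟩, ?_⟩
              simp only [hH]
              rw [hgood 0 hV0]
              refine mul_ne_zero hv ?_
              simpa [blockTest] using ha
            have hr' : ¬Rej (correct f b v) H T := by
              rintro ⟨⟨e, he⟩, hne⟩
              apply hne
              simp only [hH]
              rw [rho_correct, hgood e he, sum_eq_single a]
              · rw [if_pos hab, sub_self]
              · intro x _ hx
                split_ifs with hxb
                · rw [hP0 x e (fun hPx => hx (hone x ⟨hPx, hxb⟩)), mul_zero]
                · rfl
              · simp
            rw [ind_pos hr, ind_neg hr']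
            have h7 := ind_nonneg (P a ∧ bad a T)
            linarith
        · intro x _ hx
          rw [ind_neg (p := P x ∧ app T x = b) fun h => hx (hone x h),
            ind_neg (p := P x ∧ bad x T) fun h => hx (hone x ⟨h.1, h.2.1⟩),
            sum_eq_zero fun y _ => ind_neg fun h => hx (hone x ⟨h.1, h.2.2.1⟩)]
          ring
        · simp
    · have h0 : ∀ x, ¬(P x ∧ app T x = b) := fun x hx => hhit ⟨x, hx⟩
      rw [sum_eq_zero]
      · rw [zero_add]
        refine ind_mono ?_
        rintro ⟨⟨e, he⟩, hne⟩
        refine ⟨⟨e, he⟩, ?_⟩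
        simp only [hH] at hne ⊢
        rw [rho_correct, sum_eq_zero, sub_zero] at hne
        · exact hne
        · intro x _
          split_ifs with hxb
          · rw [hP0 x e (fun hPx => h0 x ⟨hPx, hxb⟩), mul_zero]
          · rfl
      · intro x _
        rw [ind_neg (h0 x), ind_neg (p := P x ∧ bad x T) fun h => h0 x ⟨h.1, h.2.1⟩,
          sum_eq_zero fun y _ => ind_neg fun h => h0 x ⟨h.1, h.2.2.1⟩]
        ring
  have hsum := sum_le_sum fun T (_ : T ∈ (univ : Finset (ι × Option (β × K ⊕ Y) → F))) => hpt T
  rw [sum_add_distrib, sum_comm] at hsum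
  have hq := two_le_card_field F
  have hS0 := ct_nonneg (Rej f H)
  have hQ0 : (0 : ℝ) < Fintype.card (ι → F) := card_fun_pos
  set N : ℝ := (Fintype.card (ι × Option (β × K ⊕ Y) → F) : ℝ) with hN
  set Q : ℝ := (Fintype.card (ι → F) : ℝ) with hQ
  have hN0 : 0 ≤ N := Nat.cast_nonneg _
  have hterm : ∀ a, ind (P a) * N ≤ 2 * (Q * ∑ T, (ind (P a ∧ app T a = b) -
      2 * ind (P a ∧ bad a T) -
      2 * ∑ a', ind (P a ∧ a ≠ a' ∧ app T a = b ∧ (P a' ∧ app T a' = b)))) := by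
    intro a
    rw [sum_sub_distrib, sum_sub_distrib, ← mul_sum, ← mul_sum, sum_comm]
    by_cases ha : P a
    · rw [ind_pos ha, one_mul]
      have e1 : ∑ T : ι × Option (β × K ⊕ Y) → F, ind (P a ∧ app T a = b) =
          ct fun T : ι × Option (β × K ⊕ Y) → F => app T a = b := by
        simp only [ha, true_and]
        rfl
      have e2 : ∑ T, ind (P a ∧ bad a T) = ct (bad a) := by
        simp only [ha, true_and]
        rfl
      have e3 : ∀ a', Q ^ 2 * ∑ T : ι × Option (β × K ⊕ Y) → F,
          ind (P a ∧ a ≠ a' ∧ app T a = b ∧ (P a' ∧ app T a' = b)) ≤ N := by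
        intro a'
        by_cases haa : a = a'
        · rw [sum_eq_zero fun T _ => ind_neg fun h => h.2.1 haa, mul_zero]
          exact hN0
        · refine le_trans ?_ (ct_two_points haa b)
          refine mul_le_mul_of_nonneg_left ?_ (by positivity)
          exact ct_mono fun T hT => ⟨hT.2.2.1, hT.2.2.2.2⟩
      have e4 : Q ^ 2 * ∑ a', ∑ T : ι × Option (β × K ⊕ Y) → F,
          ind (P a ∧ a ≠ a' ∧ app T a = b ∧ (P a' ∧ app T a' = b)) ≤
          Fintype.card (β × K ⊕ Y → F) * N := by
        rw [mul_sum]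
        refine (sum_le_sum fun a' _ => e3 a').trans (le_of_eq ?_)
        rw [sum_const, card_univ, nsmul_eq_mul]
      rw [e1, e2]
      have e5 := ct_eq_of_app (ι := ι) a b
      have e6 := hb a
      have e7 : 8 * (Q * ∑ a', ∑ T : ι × Option (β × K ⊕ Y) → F,
          ind (P a ∧ a ≠ a' ∧ app T a = b ∧ (P a' ∧ app T a' = b))) ≤ N := by
        refine le_of_mul_le_mul_left ?_ hQ0
        have := mul_le_mul_of_nonneg_right hn hN0
        linarith
      have e8 : 96 * ((Fintype.card F : ℝ) ^ 3 * ct (Rej f H)) ≤ N := by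
        refine le_trans ?_ hsmall
        calc 96 * ((Fintype.card F : ℝ) ^ 3 * ct (Rej f H)) ≤
            2 ^ 27 * ((Fintype.card F : ℝ) ^ 3 * ct (Rej f H)) := by
              gcongr; norm_num
          _ ≤ (Fintype.card F : ℝ) ^ 27 * ((Fintype.card F : ℝ) ^ 3 * ct (Rej f H)) := by gcongr
          _ = _ := by ring
      rw [← hN, ← hQ] at e5
      change Q * ct (bad a) ≤ _ at e6
      rw [mul_sub, mul_sub Q, e5]
      linarith
    · rw [ind_neg ha, zero_mul]
      rw [sum_eq_zero fun T _ => ind_neg fun h => ha h.1,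
        sum_eq_zero fun T _ => ind_neg fun h => ha h.1,
        sum_eq_zero fun a' _ => sum_eq_zero fun T _ => ind_neg fun h => ha h.1]
      simp
  have hfin := sum_le_sum fun a (_ : a ∈ (univ : Finset (β × K ⊕ Y → F))) => hterm a
  rw [← sum_mul, ← mul_sum, ← mul_sum] at hfin
  have h9 := mul_le_mul_of_nonneg_left hsum (mul_nonneg zero_le_two hQ0.le)
  change _ ≤ 2 * Q * ct (Rej f H) at h9
  change ct P * N ≤ _ at hfin
  rw [mul_add] at h9
  change _ + 2 * Q * ct (Rej (correct f b v) H) ≤ _ at h9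
  linarith

/-- If few affine maps reject `f`, then `f` is close to a function rejected by no affine map. -/
theorem exists_close_accepted (g : (K → F) → F)
    (hg : ∀ x a : K → F, ∑ κ : F, g (κ • x + a) = 0)
    (hV : ∀ e j, V e → V (Function.update e j 0)) (hV0 : V 0)
    (hY : (Fintype.card Y : ℝ) ≤ 10 * Fintype.card F)
    (hn : 8 * (Fintype.card (β × K ⊕ Y → F) : ℝ) ≤ Fintype.card (ι → F)) (f : (ι → F) → F)
    (hsmall : (Fintype.card F : ℝ) ^ 30 *
      ct (Rej f fun e : {e // V e} => blockTest (blockProd (β := β) g) e.1) ≤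
        Fintype.card (ι × Option (β × K ⊕ Y) → F)) :
    ∃ f₁ : (ι → F) → F,
      (∀ T, ¬Rej f₁ (fun e : {e // V e} => blockTest (blockProd (β := β) g) e.1) T) ∧
      ct (fun x : β × K ⊕ Y → F => blockProd g (fun i => x (Sum.inl i)) ≠ 0) *
        ct (fun y => f y ≠ f₁ y) * Fintype.card (ι × Option (β × K ⊕ Y) → F) ≤
      2 * (Fintype.card (ι → F) *
        ct (Rej f fun e : {e // V e} => blockTest (blockProd (β := β) g) e.1)) := by
  classical
  set H : {e // V e} → (β × K ⊕ Y → F) → F := fun e => blockTest (blockProd (β := β) g) e.1 with hH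
  have key : ∀ (k : ℕ) (f : (ι → F) → F), 2 * ct (Rej f H) ≤ k →
      (Fintype.card F : ℝ) ^ 30 * ct (Rej f H) ≤ Fintype.card (ι × Option (β × K ⊕ Y) → F) →
      ∃ f₁ : (ι → F) → F, (∀ T, ¬Rej f₁ H T) ∧
      ct (fun x : β × K ⊕ Y → F => blockProd g (fun i => x (Sum.inl i)) ≠ 0) *
        ct (fun y => f y ≠ f₁ y) * Fintype.card (ι × Option (β × K ⊕ Y) → F) ≤
      2 * (Fintype.card (ι → F) * ct (Rej f H)) := by
    intro k
    induction k with
    | zero =>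
      intro f h0 _
      refine ⟨f, ?_, ?_⟩
      · intro T hT
        have := ct_pos ⟨T, hT⟩
        norm_num at h0
        linarith
      · have h1 : ct (fun y => f y ≠ f y) = 0 := by simp [ct, ind]
        rw [h1]
        have := ct_nonneg (Rej f H)
        simp only [mul_zero, zero_mul]
        positivity
    | succ k ih =>
      intro f hk hs
      by_cases hne : ∃ T, Rej f H T
      · obtain ⟨b, v, hv, ⟨x, hx⟩, hb⟩ := exists_error f g hg hV hV0 hY hne hs
        have h1 := ct_rej_correct_le f g hV0 hn hs hv hb
        rw [← hH] at h1
        set W := ct (fun x : β × K ⊕ Y → F => blockProd g (fun i => x (Sum.inl i)) ≠ 0) with hW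
        have hW1 : 1 ≤ W := ct_pos ⟨Sum.elim x 0, hx⟩
        have hQ0 : (0 : ℝ) < Fintype.card (ι → F) := card_fun_pos
        have hM1 : (1 : ℝ) ≤ Fintype.card (ι × (β × K ⊕ Y) → F) := by
          exact_mod_cast Fintype.card_pos
        have hN := card_fibre (F := F) (ι := ι) (J := β × K ⊕ Y)
        have hdec : 2 * ct (Rej (correct f b v) H) + 1 ≤ 2 * ct (Rej f H) := by
          refine le_of_mul_le_mul_left ?_ hQ0
          have h2 : (Fintype.card (ι → F) : ℝ) * 1 ≤ W * Fintype.card (ι × Option (β × K ⊕ Y) → F) := by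
            rw [← hN]
            have := mul_le_mul_of_nonneg_left hM1 hQ0.le
            have h3 : (0 : ℝ) ≤ Fintype.card (ι → F) * Fintype.card (ι × (β × K ⊕ Y) → F) := by
              positivity
            nlinarith
          linarith
        have hk' : 2 * ct (Rej (correct f b v) H) ≤ k := by
          push_cast at hk
          linarith
        obtain ⟨f₁, hf₁, hd⟩ := ih (correct f b v) hk' (le_trans (by gcongr; linarith) hs)
        refine ⟨f₁, hf₁, ?_⟩
        have hdist : ct (fun y => f y ≠ f₁ y) ≤ ct (fun y => correct f b v y ≠ f₁ y) + 1 := by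
          have : (1 : ℝ) = ct (fun y => y = b) := (sum_ind_eq' b).symm
          rw [this]
          refine le_trans (ct_mono ?_) (ct_or_le _ _)
          intro y hy
          by_cases hyb : y = b
          · exact Or.inr hyb
          · left
            simpa [correct, hyb] using hy
        have hN0 : (0 : ℝ) ≤ Fintype.card (ι × Option (β × K ⊕ Y) → F) := Nat.cast_nonneg _
        calc W * ct (fun y => f y ≠ f₁ y) * Fintype.card (ι × Option (β × K ⊕ Y) → F)
            ≤ W * (ct (fun y => correct f b v y ≠ f₁ y) + 1) *
              Fintype.card (ι × Option (β × K ⊕ Y) → F) := by gcongr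
          _ ≤ _ := by linarith
      · refine ⟨f, fun T hT => hne ⟨T, hT⟩, ?_⟩
        have h1 : ct (fun y => f y ≠ f y) = 0 := by simp [ct, ind]
        rw [h1]
        have := ct_nonneg (Rej f H)
        simp only [mul_zero, zero_mul]
        positivity
  obtain ⟨k, hk⟩ := exists_nat_ge (2 * ct (Rej f H))
  exact key k f hk hsmall

end Correction

/-! ### Binomial coefficients modulo a prime -/

section Binomials
variable {p : ℕ} [hp : Fact p.Prime]

theorem choose_mul_right_modEq (n k : ℕ) : (p * n).choose (p * k) ≡ n.choose k [MOD p] := by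
  have h := Choose.choose_modEq_choose_mod_mul_choose_div_nat (p := p) (n := p * n) (k := p * k)
  simpa [Nat.mul_div_cancel_left _ hp.out.pos] using h

theorem choose_mul_pow_modEq (m v : ℕ) : (p ^ v * m).choose (p ^ v) ≡ m [MOD p] := by
  induction v with
  | zero => simp [Nat.ModEq.refl]
  | succ v ih =>
    rw [pow_succ', mul_assoc]
    exact (choose_mul_right_modEq _ _).trans ih

theorem choose_mul_pow_add_modEq (m v : ℕ) :
    (p ^ v * m + (p ^ v - 1)).choose (p ^ v) ≡ m [MOD p] := by
  induction v with
  | zero => simp [Nat.ModEq.refl]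
  | succ v ih =>
    have h := Choose.choose_modEq_choose_mod_mul_choose_div_nat (p := p)
      (n := p ^ (v + 1) * m + (p ^ (v + 1) - 1)) (k := p ^ (v + 1))
    have hv : 0 < p ^ v := pow_pos hp.out.pos v
    have hp1 := hp.out.pos
    have e : p ^ (v + 1) * m + (p ^ (v + 1) - 1) = p * (p ^ v * m + (p ^ v - 1)) + (p - 1) := by
      rw [mul_add, Nat.mul_sub, pow_succ', mul_one, mul_assoc]
      have : p ≤ p * p ^ v := Nat.le_mul_of_pos_right p hv
      omega
    have e1 : (p * (p ^ v * m + (p ^ v - 1)) + (p - 1)) / p = p ^ v * m + (p ^ v - 1) := by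
      rw [Nat.mul_add_div hp1, Nat.div_eq_of_lt (by omega), add_zero]
    have e2 : p ^ (v + 1) / p = p ^ v := by rw [pow_succ, Nat.mul_div_cancel _ hp1]
    have e3 : p ^ (v + 1) % p = 0 := by rw [pow_succ, Nat.mul_mod_left]
    rw [e, e1, e2, e3, Nat.choose_zero_right, one_mul, ← e] at h
    exact h.trans ih

/-- Removing the last nonzero digit from `c` keeps the binomial coefficient prime to `p`. -/
theorem not_dvd_choose_sub {b c v m : ℕ} (hc : ¬p ∣ b.choose c)
    (hcv : c = p ^ v * m) (hm : ¬p ∣ m) : ¬p ∣ b.choose (c - p ^ v) := by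
  have hm0 : 0 < m := Nat.pos_of_ne_zero fun h => hm (h ▸ dvd_zero p)
  have hle : p ^ v ≤ c := hcv ▸ Nat.le_mul_of_pos_right _ hm0
  have h1 : ¬p ∣ c.choose (p ^ v) := by
    rw [hcv, (choose_mul_pow_modEq m v).dvd_iff dvd_rfl]
    exact hm
  intro h
  have h2 : b.choose c * c.choose (c - p ^ v) =
      b.choose (c - p ^ v) * (b - (c - p ^ v)).choose (c - (c - p ^ v)) :=
    Nat.choose_mul (Nat.sub_le _ _)
  rw [Nat.choose_symm hle] at h2
  rcases hp.out.dvd_mul.1 (h2 ▸ dvd_mul_of_dvd_left h _) with h3 | h3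
  · exact hc h3
  · exact h1 h3

/-- Extract from `b` a column of total exactly `p ^ k - p ^ (k - 1)`. -/
theorem exists_column {ι : Type} [Fintype ι] [DecidableEq ι] {k : ℕ} (b : ι → ℕ)
    (hb : ∀ i, b i < p ^ (k + 1)) (hD : p ^ (k + 1) - p ^ k ≤ ∑ i, b i) :
    ∃ c : ι → ℕ, (∀ i, c i ≤ b i) ∧ (∀ i, ¬p ∣ (b i).choose (c i)) ∧
      ∑ i, c i = p ^ (k + 1) - p ^ k := by
  have key : ∀ (N : ℕ) (c : ι → ℕ), ∑ i, c i ≤ N → (∀ i, c i ≤ b i) →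
      (∀ i, ¬p ∣ (b i).choose (c i)) → p ^ (k + 1) - p ^ k ≤ ∑ i, c i →
      ∃ c : ι → ℕ, (∀ i, c i ≤ b i) ∧ (∀ i, ¬p ∣ (b i).choose (c i)) ∧
      ∑ i, c i = p ^ (k + 1) - p ^ k := by
    intro N
    induction N with
    | zero => exact fun c h0 h1 h2 h3 => ⟨c, h1, h2, by omega⟩
    | succ N ih =>
      intro c h0 h1 h2 h3
      rcases h3.eq_or_lt with h4 | h4
      · exact ⟨c, h1, h2, h4.symm⟩
      · have hne : (univ.filter fun i => c i ≠ 0).Nonempty := by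
          by_contra hcon
          rw [not_nonempty_iff_eq_empty, filter_eq_empty_iff] at hcon
          rw [sum_eq_zero fun i hi => by simpa using hcon hi] at h4
          omega
        obtain ⟨i, hi, hmin⟩ := exists_min_image _ (fun i => padicValNat p (c i)) hne
        have hi0 : c i ≠ 0 := (mem_filter.1 hi).2
        set v := padicValNat p (c i) with hv
        obtain ⟨m, hm⟩ : p ^ v ∣ c i := pow_padicValNat_dvd
        have hpm : ¬p ∣ m := by
          rintro ⟨m', rfl⟩
          refine pow_succ_padicValNat_not_dvd (p := p) hi0 ⟨m', ?_⟩
          rw [← hv, hm, pow_succ, mul_assoc]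
        have hm0 : 0 < m := Nat.pos_of_ne_zero fun h => hpm (h ▸ dvd_zero p)
        have hle : p ^ v ≤ c i := by
          rw [hm]
          exact Nat.le_mul_of_pos_right _ hm0
        have hvk : v ≤ k := by
          have : p ^ v < p ^ (k + 1) := hle.trans_lt ((h1 i).trans_lt (hb i))
          exact Nat.lt_succ_iff.1 ((Nat.pow_lt_pow_iff_right hp.out.one_lt).1 this)
        have hdS : p ^ v ∣ ∑ i, c i := by
          refine dvd_sum fun j _ => ?_
          by_cases hj : c j = 0
          · rw [hj]
            exact dvd_zero _
          · exact (pow_dvd_pow p (hmin j (mem_filter.2 ⟨mem_univ _, hj⟩))).trans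
              pow_padicValNat_dvd
        have hdD : p ^ v ∣ p ^ (k + 1) - p ^ k :=
          Nat.dvd_sub (pow_dvd_pow p (by omega)) (pow_dvd_pow p hvk)
        have hge : p ^ v ≤ ∑ i, c i - (p ^ (k + 1) - p ^ k) :=
          Nat.le_of_dvd (by omega) (Nat.dvd_sub hdS hdD)
        have hsum : ∑ j, Function.update c i (c i - p ^ v) j + p ^ v = ∑ j, c j := by
          rw [sum_update_of_mem (mem_univ i), ← sum_erase_add _ _ (mem_univ i), sdiff_singleton_eq_erase]
          omega
        have hpos : 0 < p ^ v := pow_pos hp.out.pos v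
        refine ih (Function.update c i (c i - p ^ v)) (by omega) ?_ ?_ (by omega)
        · intro j
          by_cases hj : j = i
          · subst hj
            rw [Function.update_self]
            exact (Nat.sub_le _ _).trans (h1 j)
          · rw [Function.update_of_ne hj]
            exact h1 j
        · intro j
          by_cases hj : j = i
          · subst hj
            rw [Function.update_self]
            exact not_dvd_choose_sub (h2 j) hm hpm
          · rw [Function.update_of_ne hj]
            exact h2 j
  refine key _ b le_rfl (fun _ => le_rfl) (fun i => ?_) hD
  rw [Nat.choose_self]
  exact hp.out.one_lt.ne' ∘ Nat.dvd_one.1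

/-- Greedy distribution of the exponents `b` into `N` columns of capacity `p ^ (k + 1) - p ^ k`. -/
theorem exists_columns {ι : Type} [Fintype ι] [DecidableEq ι] {k : ℕ} (N : ℕ) (b : ι → ℕ)
    (hb : ∀ i, b i < p ^ (k + 1)) :
    ∃ (a : ι → Fin N → ℕ) (c : ι → ℕ),
      (∀ i, ∃ u, ¬p ∣ u ∧ (b i).factorial = u * (c i).factorial * ∏ j, (a i j).factorial) ∧
      (∀ i, b i = c i + ∑ j, a i j) ∧
      ∀ j : Fin N, ∑ i, a i j =
        min (p ^ (k + 1) - p ^ k) (∑ i, b i - j * (p ^ (k + 1) - p ^ k)) := by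
  set D := p ^ (k + 1) - p ^ k with hD
  induction N generalizing b with
  | zero =>
    refine ⟨fun _ => Fin.elim0, b, fun i => ⟨1, hp.out.one_lt.ne' ∘ Nat.dvd_one.1, by simp⟩,
      by simp, fun j => j.elim0⟩
  | succ N ih =>
    obtain ⟨e, he1, he2, he3⟩ : ∃ e : ι → ℕ, (∀ i, e i ≤ b i) ∧ (∀ i, ¬p ∣ (b i).choose (e i)) ∧
        ∑ i, e i = min D (∑ i, b i) := by
      rcases le_total D (∑ i, b i) with h | h
      · rw [min_eq_left h]
        exact exists_column b hb h
      · rw [min_eq_right h]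
        refine ⟨b, fun _ => le_rfl, fun i => ?_, rfl⟩
        rw [Nat.choose_self]
        exact hp.out.one_lt.ne' ∘ Nat.dvd_one.1
    obtain ⟨a, c, h1, h2, h3⟩ := ih (fun i => b i - e i) fun i => (Nat.sub_le _ _).trans_lt (hb i)
    have hsub : ∑ i, (b i - e i) = ∑ i, b i - min D (∑ i, b i) := by
      rw [← he3, sum_tsub_distrib _ fun i _ => he1 i]
    refine ⟨fun i => Fin.cons (e i) (a i), c, fun i => ?_, fun i => ?_, fun j => ?_⟩
    · obtain ⟨u, hu, hu'⟩ := h1 i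
      refine ⟨(b i).choose (e i) * u, hp.out.not_dvd_mul (he2 i) hu, ?_⟩
      rw [Fin.prod_univ_succ]
      simp only [Fin.cons_zero, Fin.cons_succ]
      rw [← Nat.choose_mul_factorial_mul_factorial (he1 i), hu']
      ring
    · rw [Fin.sum_univ_succ]
      simp only [Fin.cons_zero, Fin.cons_succ]
      have := h2 i
      have := he1 i
      omega
    · refine Fin.cases ?_ (fun j => ?_) j
      · simp [he3]
      · simp only [Fin.cons_succ, Fin.val_succ]
        rw [h3 j, hsub, add_mul, one_mul]
        omega

theorem sum_min_sub (D R t : ℕ) : ∑ j ∈ range t, min D (R - j * D) = min (t * D) R := by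
  induction t with
  | zero => simp
  | succ t ih =>
    rw [sum_range_succ, ih, add_mul, one_mul]
    omega

end Binomials

/-! ### The block polynomial -/

section BlockPolynomial

theorem exists_unit_factorial {p : ℕ} [hp : Fact p.Prime] (v N : ℕ) (hN : N < p) :
    ∃ u, ¬p ∣ u ∧ (p ^ v * N + (p ^ v - 1)).factorial =
      u * (p ^ v).factorial ^ N * (p ^ v - 1).factorial := by
  induction N with
  | zero => exact ⟨1, hp.out.one_lt.ne' ∘ Nat.dvd_one.1, by simp⟩
  | succ N ih =>
    obtain ⟨u, hu, hu'⟩ := ih (by omega)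
    refine ⟨(p ^ v * (N + 1) + (p ^ v - 1)).choose (p ^ v) * u, hp.out.not_dvd_mul ?_ hu, ?_⟩
    · rw [(choose_mul_pow_add_modEq (N + 1) v).dvd_iff dvd_rfl]
      exact Nat.not_dvd_of_pos_of_lt N.succ_pos hN
    · have hle : p ^ v ≤ p ^ v * (N + 1) + (p ^ v - 1) :=
        (Nat.le_mul_of_pos_right _ N.succ_pos).trans (Nat.le_add_right _ _)
      have hsub : p ^ v * (N + 1) + (p ^ v - 1) - p ^ v = p ^ v * N + (p ^ v - 1) := by
        rw [mul_add, mul_one]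
        omega
      rw [← Nat.choose_mul_factorial_mul_factorial hle, hsub, hu', pow_succ]
      ring

variable {F : Type} [Field F]

/-- The exponent `(p ^ v - 1, …, p ^ v - 1)`. -/
def topExp (p v : ℕ) : Fin p →₀ ℕ := Finsupp.equivFunOnFinite.symm fun _ => p ^ v - 1

theorem topExp_apply (p v : ℕ) (l : Fin p) : topExp p v l = p ^ v - 1 := rfl

theorem coeff_topExp_ne_zero {p v : ℕ} (hp : p.Prime) [CharP F p] {P : MvPolynomial (Fin p) F}
    (hP : Pdef p (p ^ (v + 1)) hp.pos P) : MvPolynomial.coeff (topExp p v) P ≠ 0 := by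
  have : Fact p.Prime := ⟨hp⟩
  obtain ⟨N, rfl⟩ : ∃ N, p = N + 1 := ⟨p - 1, (Nat.succ_pred_eq_of_pos hp.pos).symm⟩
  have hv : 0 < (N + 1) ^ v := pow_pos hp.pos v
  set e : Fin (N + 1) →₀ ℕ := ∑ i : Fin N, Finsupp.single i.castSucc 1 with he
  have he1 : ∀ i : Fin N, e i.castSucc = 1 := by
    intro i
    rw [he, Finsupp.finsetSum_apply, sum_eq_single i]
    · simp
    · intro j _ hj
      rw [Finsupp.single_eq_of_ne]
      simpa [eq_comm] using hj
    · simp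
  have he2 : e (Fin.last N) = 0 := by
    rw [he, Finsupp.finsetSum_apply]
    exact sum_eq_zero fun j _ => Finsupp.single_eq_of_ne (Fin.castSucc_lt_last j).ne'
  have hm1 : ∀ i : Fin N, (e + topExp (N + 1) v) i.castSucc = (N + 1) ^ v := by
    intro i
    rw [Finsupp.add_apply, he1, topExp_apply]
    omega
  have hm2 : (e + topExp (N + 1) v) (Fin.last N) = (N + 1) ^ v - 1 := by
    rw [Finsupp.add_apply, he2, topExp_apply, zero_add]
  have hsum : (e + topExp (N + 1) v).sum (fun _ m => m) = (N + 1) ^ (v + 1) - 1 := by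
    rw [Finsupp.sum_fintype _ _ fun _ => rfl, Fin.sum_univ_castSucc]
    simp only [hm1, hm2]
    rw [sum_const, card_univ, Fintype.card_fin, smul_eq_mul, pow_succ, mul_add, mul_one, mul_comm N]
    omega
  have hprod : (∏ i : Fin N, MvPolynomial.X i.castSucc : MvPolynomial (Fin (N + 1)) F) =
      MvPolynomial.monomial e 1 := by
    rw [he, MvPolynomial.monomial_sum_one]
    rfl
  have hL : MvPolynomial.coeff (e + topExp (N + 1) v)
      ((∏ i : Fin N, MvPolynomial.X i.castSucc : MvPolynomial (Fin (N + 1)) F) * P) =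
      MvPolynomial.coeff (topExp (N + 1) v) P := by
    rw [hprod, MvPolynomial.coeff_monomial_mul, one_mul]
  have hP' : (∏ i : Fin N, MvPolynomial.X i.castSucc : MvPolynomial (Fin (N + 1)) F) * P =
      ∑ I : Finset (Fin N), MvPolynomial.C ((-1 : F) ^ (I.card + 1)) *
        ((∑ i ∈ I, MvPolynomial.X i.castSucc) + MvPolynomial.X (Fin.last N)) ^
          ((N + 1) ^ (v + 1) - 1) := hP
  rw [← hL, hP', MvPolynomial.coeff_sum]
  have hlin : ∀ I : Finset (Fin N),
      (∑ i ∈ I, MvPolynomial.X i.castSucc : MvPolynomial (Fin (N + 1)) F) +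
        MvPolynomial.X (Fin.last N) =
      ∑ l, (Fin.lastCases (motive := fun _ => F) 1 (fun i => if i ∈ I then 1 else 0) l : F) •
        MvPolynomial.X l := by
    intro I
    rw [Fin.sum_univ_castSucc]
    simp [ite_smul]
  rw [sum_eq_single univ]
  · rw [MvPolynomial.coeff_C_mul, hlin, MvPolynomial.coeff_linearCombination_X_pow_of_fintype,
      if_pos hsum]
    refine mul_ne_zero (pow_ne_zero _ (neg_ne_zero.2 one_ne_zero)) (mul_ne_zero ?_ ?_)
    · rw [Ne, CharP.cast_eq_zero_iff F (N + 1)]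
      obtain ⟨u, hu, hu'⟩ := exists_unit_factorial (p := N + 1) v N (Nat.lt_succ_self N)
      have hspec := Nat.multinomial_spec univ (e + topExp (N + 1) v)
      rw [← Finsupp.multinomial_eq_of_support_subset (subset_univ _), Fin.prod_univ_castSucc,
        ← Finsupp.sum_fintype (e + topExp (N + 1) v) (fun _ m => m) (fun _ => rfl), hsum] at hspec
      simp only [hm1, hm2] at hspec
      rw [prod_const, card_univ, Fintype.card_fin] at hspec
      have hq : (N + 1) ^ (v + 1) - 1 = (N + 1) ^ v * N + ((N + 1) ^ v - 1) := by
        rw [pow_succ, mul_add, mul_one]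
        omega
      rw [hq, hu', mul_comm, mul_assoc u] at hspec
      rwa [Nat.eq_of_mul_eq_mul_right (by positivity) hspec]
    · rw [Finsupp.prod_fintype _ _ fun _ => pow_zero _]
      refine prod_ne_zero_iff.2 fun l _ => pow_ne_zero _ ?_
      refine Fin.lastCases ?_ (fun i => ?_) l <;> simp
  · intro I _ hI
    obtain ⟨i, hi⟩ : ∃ i, i ∉ I := by
      by_contra hcon
      refine hI (eq_univ_of_forall fun i => ?_)
      by_contra h
      exact hcon ⟨i, h⟩
    rw [MvPolynomial.coeff_C_mul, hlin, MvPolynomial.coeff_linearCombination_X_pow_of_fintype,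
      if_pos hsum, Finsupp.prod_fintype _ _ fun _ => pow_zero _,
      prod_eq_zero (mem_univ i.castSucc), mul_zero, mul_zero]
    rw [hm1, Fin.lastCases_castSucc, if_neg hi, zero_pow hv.ne']
  · simp

theorem totalDegree_le_of_Pdef {p q : ℕ} (hp : p.Prime) {P : MvPolynomial (Fin p) F}
    (hP : Pdef p q hp.pos P) (hP0 : P ≠ 0) : P.totalDegree + (p - 1) ≤ q - 1 := by
  have hX : ∀ i : Fin (p - 1),
      (MvPolynomial.X (Fin.castLE (Nat.sub_le p 1) i) : MvPolynomial (Fin p) F) ≠ 0 :=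
    fun i => MvPolynomial.X_ne_zero _
  have hprod : ∀ S : Finset (Fin (p - 1)), (∏ i ∈ S,
      (MvPolynomial.X (Fin.castLE (Nat.sub_le p 1) i) : MvPolynomial (Fin p) F)).totalDegree =
      S.card := by
    intro S
    induction S using Finset.induction_on with
    | empty => simp
    | insert i S hi ih =>
      rw [prod_insert hi, MvPolynomial.totalDegree_mul_of_isDomain (hX i)
        (prod_ne_zero_iff.2 fun j _ => hX j), ih, MvPolynomial.totalDegree_X, card_insert_of_notMem hi,
        add_comm]
  have h := congrArg MvPolynomial.totalDegree hP
  rw [MvPolynomial.totalDegree_mul_of_isDomain (prod_ne_zero_iff.2 fun j _ => hX j) hP0, hprod,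
    card_univ, Fintype.card_fin] at h
  rw [add_comm, h]
  refine (MvPolynomial.totalDegree_finsetSum_le fun I _ => ?_)
  refine (MvPolynomial.totalDegree_mul _ _).trans ?_
  rw [MvPolynomial.totalDegree_C, zero_add]
  refine (MvPolynomial.totalDegree_pow _ _).trans ?_
  refine (Nat.mul_le_mul_left _ ?_).trans_eq (mul_one _)
  refine (MvPolynomial.totalDegree_add _ _).trans (max_le ?_ (MvPolynomial.totalDegree_X _).le)
  exact MvPolynomial.totalDegree_finsetSum_le fun i _ => (MvPolynomial.totalDegree_X _).le

variable [Fintype F]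

theorem sum_pow_card_sub_one : ∑ z : F, z ^ (Fintype.card F - 1) = -1 := by
  classical
  have h1 : Fintype.card F - 1 ≠ 0 := by
    have := Fintype.one_lt_card (α := F)
    omega
  rw [Fintype.sum_eq_add_sum_subtype_ne _ 0, zero_pow h1, zero_add,
    sum_congr rfl fun z _ => FiniteField.pow_card_sub_one_eq_one z.1 z.2, sum_const, card_univ,
    Fintype.card_subtype_compl, Fintype.card_subtype_eq, nsmul_eq_mul, mul_one,
    Nat.cast_sub Fintype.card_pos, FiniteField.cast_card_eq_zero]
  simp

/-- A polynomial of degree less than `q - 1` sums to zero over every affine line. -/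
theorem sum_line_eq_zero {σ : Type} {P : MvPolynomial σ F}
    (hP : P.totalDegree < Fintype.card F - 1) (x a : σ → F) :
    ∑ κ : F, MvPolynomial.eval (κ • x + a) P = 0 := by
  set g : Polynomial F := MvPolynomial.aeval
    (fun l => Polynomial.C (x l) * Polynomial.X + Polynomial.C (a l)) P with hg
  have hdeg : g.natDegree ≤ P.totalDegree * 1 :=
    MvPolynomial.aeval_natDegree_le P le_rfl _ fun i => Polynomial.natDegree_linear_le
  have heval : ∀ κ : F, MvPolynomial.eval (κ • x + a) P = ∑ i ∈ range (g.natDegree + 1),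
      g.coeff i * κ ^ i := by
    intro κ
    have h1 : (Polynomial.evalRingHom κ).comp (algebraMap F (Polynomial F)) = RingHom.id F :=
      RingHom.ext fun r => by simp
    have h2 : (fun l => Polynomial.eval κ (Polynomial.C (x l) * Polynomial.X + Polynomial.C (a l))) =
        κ • x + a := by
      funext l
      simp only [Polynomial.eval_add, Polynomial.eval_mul, Polynomial.eval_C, Polynomial.eval_X,
        Pi.add_apply, Pi.smul_apply, smul_eq_mul, mul_comm]
    rw [← Polynomial.eval_eq_sum_range, hg, MvPolynomial.aeval_def,
      MvPolynomial.polynomial_eval_eval₂, h1, h2]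
    rfl
  simp_rw [heval]
  rw [sum_comm]
  refine sum_eq_zero fun i hi => ?_
  rw [← mul_sum, FiniteField.sum_pow_lt_card_sub_one, mul_zero]
  have := mem_range.1 hi
  omega

/-- Pairing `P` with a constant exponent extracts its top coefficient. -/
theorem sum_monomial_mul_eval {p v : ℕ} (hp : p.Prime) (hF : Fintype.card F = p ^ (v + 1))
    {P : MvPolynomial (Fin p) F} (hdeg : P.totalDegree + (p - 1) ≤ p ^ (v + 1) - 1) :
    ∑ z : Fin p → F, MvPolynomial.eval z P * ∏ l, z l ^ (p ^ (v + 1) - p ^ v) =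
      (-1) ^ p * MvPolynomial.coeff (topExp p v) P := by
  classical
  have hv : 0 < p ^ v := pow_pos hp.pos v
  have hvv : p ^ v < p ^ (v + 1) := Nat.pow_lt_pow_right hp.one_lt (Nat.lt_succ_self v)
  have hterm : ∀ m : Fin p →₀ ℕ, ∑ z : Fin p → F, (∏ l, z l ^ m l) *
      ∏ l, z l ^ (p ^ (v + 1) - p ^ v) = ∏ l, ∑ y : F, y ^ (m l + (p ^ (v + 1) - p ^ v)) := by
    intro m
    rw [prod_univ_sum, Fintype.piFinset_univ]
    refine sum_congr rfl fun z _ => ?_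
    rw [← prod_mul_distrib]
    exact prod_congr rfl fun l _ => (pow_add _ _ _).symm
  simp_rw [MvPolynomial.eval_eq', sum_mul, mul_assoc]
  rw [sum_comm]
  simp_rw [← mul_sum, hterm]
  rw [sum_eq_single (topExp p v)]
  · rw [mul_comm]
    congr 1
    have h1 : ∀ l : Fin p, topExp p v l + (p ^ (v + 1) - p ^ v) = Fintype.card F - 1 := by
      intro l
      rw [topExp_apply, hF]
      omega
    simp_rw [h1, sum_pow_card_sub_one]
    simp
  · intro m hm hne
    have hsm : ∑ l, m l ≤ P.totalDegree := by
      have := MvPolynomial.le_totalDegree hm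
      rwa [Finsupp.sum_fintype _ _ fun _ => rfl] at this
    obtain ⟨l, hl⟩ : ∃ l, m l < p ^ v - 1 := by
      by_contra hcon
      have hge : ∀ l, p ^ v - 1 ≤ m l := fun l => not_lt.1 fun h => hcon ⟨l, h⟩
      apply hne
      ext l
      rw [topExp_apply]
      have h2 : ∑ _l : Fin p, (p ^ v - 1) = p ^ (v + 1) - p := by
        rw [sum_const, card_univ, Fintype.card_fin, smul_eq_mul, Nat.mul_sub, pow_succ', mul_one]
      have h3 := sum_le_sum fun l (_ : l ∈ (univ : Finset (Fin p))) => hge l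
      have h4 : ∑ l : Fin p, (p ^ v - 1) = ∑ l, m l := by
        have := hp.pos
        omega
      exact ((sum_eq_sum_iff_of_le fun l _ => hge l).1 h4 l (mem_univ l)).symm
    rw [prod_eq_zero (mem_univ l), mul_zero]
    refine FiniteField.sum_pow_lt_card_sub_one F _ ?_
    omega
  · intro h
    rw [MvPolynomial.notMem_support_iff.1 h, zero_mul]

end BlockPolynomial

/-! ### Accepted functions have low degree -/

section Accepted
variable {F : Type} [Field F] [Fintype F] {ι J : Type} [Fintype ι] [DecidableEq ι]
  [Fintype J] [DecidableEq J]

theorem app_apply (T : ι × Option J → F) (x : J → F) (i : ι) :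
    app T x i = ∑ o, T (i, o) * hat x o := rfl

/-- The exponent with given row sums. -/
def rowSum (a : ι → Option J → ℕ) : ι →₀ ℕ := Finsupp.equivFunOnFinite.symm fun i => ∑ o, a i o

/-- If all affine maps pass the test `h` on a reduced polynomial, then every coefficient of the
test value, viewed as a polynomial in the entries of the affine map, vanishes. -/
theorem coeff_mul_eq_zero {R : MvPolynomial ι F}
    (hR : R ∈ MvPolynomial.restrictDegree ι F (Fintype.card F - 1)) {h : (J → F) → F}
    (hrho : ∀ T, rho (fun y => MvPolynomial.eval y R) h T = 0) (a : ι → Option J → ℕ) :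
    MvPolynomial.coeff (rowSum a) R * (∏ i, (Nat.multinomial univ (a i) : F)) *
      ∑ x, h x * ∏ i, ∏ o, hat x o ^ a i o = 0 := by
  classical
  set m : (ι → Option J → ℕ) → (ι × Option J →₀ ℕ) := fun a =>
    Finsupp.equivFunOnFinite.symm fun io => a io.1 io.2 with hm
  have hmapp : ∀ a i o, m a (i, o) = a i o := fun _ _ _ => rfl
  have hminj : ∀ {a a'}, m a = m a' → a = a' := by
    intro a a' h
    funext i o
    exact DFunLike.congr_fun h (i, o)
  set w : (ι →₀ ℕ) → (ι → Option J → ℕ) → F := fun b a =>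
    MvPolynomial.coeff b R * (∏ i, (Nat.multinomial univ (a i) : F)) *
      ∑ x, h x * ∏ i, ∏ o, hat x o ^ a i o with hw
  set W : MvPolynomial (ι × Option J) F := ∑ b ∈ R.support,
    ∑ a ∈ Fintype.piFinset fun i => piAntidiag univ (b i), MvPolynomial.monomial (m a) (w b a)
    with hW
  have heval : ∀ T, MvPolynomial.eval T W = 0 := by
    intro T
    rw [← hrho T, hW, map_sum]
    unfold rho
    simp_rw [map_sum, MvPolynomial.eval_eq' _ R, sum_mul, app_apply]
    rw [sum_comm]
    refine sum_congr rfl fun b _ => ?_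
    simp_rw [sum_pow_eq_sum_piAntidiag, prod_univ_sum]
    simp_rw [mul_sum, sum_mul]
    rw [sum_comm]
    refine sum_congr rfl fun a _ => ?_
    rw [MvPolynomial.eval_monomial, Finsupp.prod_fintype _ _ fun _ => pow_zero _, hw]
    simp only [mul_sum, sum_mul]
    refine sum_congr rfl fun x _ => ?_
    rw [Fintype.prod_prod_type]
    simp only [hmapp, mul_pow, prod_mul_distrib]
    ring
  have hdeg : W ∈ MvPolynomial.restrictDegree (ι × Option J) F (Fintype.card F - 1) := by
    refine Submodule.sum_mem _ fun b hb => Submodule.sum_mem _ fun a ha => ?_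
    rw [MvPolynomial.mem_restrictDegree]
    rintro e he ⟨i, o⟩
    rw [mem_singleton.1 (MvPolynomial.support_monomial_subset he), hmapp]
    have h1 := (mem_piAntidiag.1 (Fintype.mem_piFinset.1 ha i)).1
    have h2 := (MvPolynomial.mem_restrictDegree _ R _).1 hR b hb i
    exact (single_le_sum (fun _ _ => Nat.zero_le _) (mem_univ o)).trans (h1.trans_le h2)
  have hW0 := MvPolynomial.eq_zero_of_eval_eq_zero _ _ W heval hdeg
  have hcoeff := congrArg (MvPolynomial.coeff (m a)) hW0
  rw [hW, MvPolynomial.coeff_sum, MvPolynomial.coeff_zero] at hcoeff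
  by_cases hb : rowSum a ∈ R.support
  · rw [sum_eq_single (rowSum a), MvPolynomial.coeff_sum, sum_eq_single a,
      MvPolynomial.coeff_monomial, if_pos rfl] at hcoeff
    · exact hcoeff
    · intro a' _ hne
      rw [MvPolynomial.coeff_monomial, if_neg fun h => hne (hminj h)]
    · intro hcon
      refine absurd (Fintype.mem_piFinset.2 fun i => mem_piAntidiag.2 ⟨rfl, fun _ _ => mem_univ _⟩)
        hcon
    · intro b _ hne
      rw [MvPolynomial.coeff_sum]
      refine sum_eq_zero fun a' ha' => ?_
      rw [MvPolynomial.coeff_monomial, if_neg]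
      intro h
      rw [hminj h] at ha'
      apply hne
      ext i
      exact (mem_piAntidiag.1 (Fintype.mem_piFinset.1 ha' i)).1.symm
    · exact fun h => absurd hb h
  · rw [MvPolynomial.notMem_support_iff.1 hb, zero_mul, zero_mul]

variable {β Y : Type} [Fintype β] [DecidableEq β] [Fintype Y] [DecidableEq Y]

/-- The pairing of a monomial with a block test factors over blocks and free coordinates. -/
theorem sum_blockTest_mul {p D : ℕ} (g : (Fin p → F) → F) (e : Y → ℕ)
    (c : Option (β × Fin p ⊕ Y) → ℕ) (hc : ∀ z, c (some (Sum.inl z)) = D) :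
    ∑ x, blockTest (blockProd (β := β) g) e x * ∏ o, hat x o ^ c o =
      (∑ z : Fin p → F, g z * ∏ l, z l ^ D) ^ Fintype.card β *
        ∏ j, ∑ y : F, y ^ (e j + c (some (Sum.inr j))) := by
  have h1 : (∑ z : Fin p → F, g z * ∏ l, z l ^ D) ^ Fintype.card β =
      ∑ x : β × Fin p → F, blockProd g x * ∏ z, x z ^ D := by
    rw [← card_univ, ← prod_const, prod_univ_sum, Fintype.piFinset_univ,
      ← Equiv.sum_comp (Equiv.curry β (Fin p) F)]
    refine sum_congr rfl fun x _ => ?_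
    rw [prod_mul_distrib, Fintype.prod_prod_type]
    rfl
  have h2 : ∏ j, ∑ y : F, y ^ (e j + c (some (Sum.inr j))) =
      ∑ y : Y → F, ∏ j, y j ^ (e j + c (some (Sum.inr j))) := by
    rw [prod_univ_sum, Fintype.piFinset_univ]
  rw [h1, h2, sum_mul_sum, ← Fintype.sum_prod_type',
    ← Equiv.sum_comp (Equiv.sumArrowEquivProdArrow (β × Fin p) Y F)]
  refine sum_congr rfl fun x _ => ?_
  rw [Fintype.prod_option, Fintype.prod_sum_type]
  simp only [hat, Option.elim_none, Option.elim_some, one_pow, one_mul, hc, blockTest, pow_add,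
    prod_mul_distrib, Equiv.sumArrowEquivProdArrow, Equiv.coe_fn_mk, Function.comp_def]
  ring

end Accepted

section LowDegree
variable {F : Type} [Field F] [Fintype F]

/-- The coordinates of the sparse flat, split into blocks and free coordinates. -/
def coordEquiv (m p t : ℕ) : Fin m × Fin p ⊕ Fin t ≃ Fin (m * p + t) :=
  (Equiv.sumCongr finProdFinEquiv (Equiv.refl _)).trans finSumFinEquiv

theorem coordEquiv_inl (m p t : ℕ) (z : Fin m × Fin p) :
    (coordEquiv m p t (Sum.inl z) : ℕ) = z.2 + p * z.1 := rfl

theorem coordEquiv_inr (m p t : ℕ) (j : Fin t) :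
    coordEquiv m p t (Sum.inr j) = Fin.natAdd (m * p) j := rfl

theorem coordEquiv_inl_lt (m p t : ℕ) (z : Fin m × Fin p) :
    (coordEquiv m p t (Sum.inl z) : ℕ) < m * p := (finProdFinEquiv z).2

theorem exists_reduced {n : ℕ} (f : (Fin n → F) → F) :
    ∃ R ∈ MvPolynomial.restrictDegree (Fin n) F (Fintype.card F - 1),
      ∀ y, MvPolynomial.eval y R = f y := by
  have h : f ∈ (MvPolynomial.restrictDegree (Fin n) F (Fintype.card F - 1)).map
      (MvPolynomial.evalₗ F (Fin n)) := by
    rw [MvPolynomial.map_restrict_dom_evalₗ]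
    trivial
  obtain ⟨R, hR, hRf⟩ := h
  exact ⟨R, hR, fun y => congrFun hRf y⟩

/-- A function accepted by every affine map has degree at most `d`. -/
theorem fDegLE_of_accepted {p v m t r d n : ℕ} (hp : p.Prime) [CharP F p]
    (hF : Fintype.card F = p ^ (v + 1)) {P : MvPolynomial (Fin p) F}
    (hP : Pdef p (p ^ (v + 1)) hp.pos P) (hr : r ≤ t * (p ^ (v + 1) - p ^ v))
    (hd : d + 1 = m * p * (p ^ (v + 1) - p ^ v) + r) (f : (Fin n → F) → F)
    (hf : ∀ T, ¬Rej f (fun e : {e : Fin t → ℕ // validE (p ^ (v + 1)) r t e} =>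
      blockTest (blockProd (β := Fin m) fun z : Fin p → F => MvPolynomial.eval z P) e.1) T) :
    fDegLE f d := by
  classical
  have : Fact p.Prime := ⟨hp⟩
  set D := p ^ (v + 1) - p ^ v with hD
  have hv : 0 < p ^ v := pow_pos hp.pos v
  have hq1 : 1 < p ^ (v + 1) := Nat.one_lt_pow (by omega) hp.one_lt
  have hDq : D ≤ p ^ (v + 1) - 1 := by omega
  obtain ⟨R, hR, hRf⟩ := exists_reduced f
  refine ⟨R, ?_, hRf⟩
  by_contra hcon
  obtain ⟨b, hb, hbd⟩ : ∃ b ∈ R.support, d < ∑ i, b i := by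
    by_contra hno
    refine hcon (Finset.sup_le fun b hb => ?_)
    rw [Finsupp.sum_fintype _ _ fun _ => rfl]
    exact not_lt.1 fun h => hno ⟨b, hb, h⟩
  have hbq : ∀ i, b i < p ^ (v + 1) := by
    intro i
    have := (MvPolynomial.mem_restrictDegree _ R _).1 hR b hb i
    rw [hF] at this
    omega
  obtain ⟨a, c, h1, h2, h3⟩ := exists_columns (p := p) (k := v) (m * p + t) b hbq
  rw [← hD] at h3
  set E := coordEquiv m p t with hE
  set a' : Fin n → Option (Fin m × Fin p ⊕ Fin t) → ℕ := fun i o =>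
    o.elim (c i) fun j => a i (E j) with ha'
  set col : Option (Fin m × Fin p ⊕ Fin t) → ℕ := fun o => ∑ i, a' i o with hcol
  have hrow : rowSum a' = b := by
    ext i
    change ∑ o, a' i o = b i
    rw [Fintype.sum_option, h2 i, ← Equiv.sum_comp E (a i)]
    rfl
  have hcolE : ∀ j, col (some j) = min D (∑ i, b i - (E j : ℕ) * D) := fun j => h3 (E j)
  have hcolx : ∀ z, col (some (Sum.inl z)) = D := by
    intro z
    rw [hcolE, min_eq_left]
    have h4 : ((E (Sum.inl z) : ℕ) + 1) * D ≤ m * p * D :=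
      Nat.mul_le_mul_right _ (coordEquiv_inl_lt m p t z)
    rw [add_mul, one_mul] at h4
    omega
  have hcoly : ∀ j, col (some (Sum.inr j)) ≤ p ^ (v + 1) - 1 := by
    intro j
    rw [hcolE]
    exact (min_le_left _ _).trans hDq
  have hcolsum : r ≤ ∑ j, col (some (Sum.inr j)) := by
    have h4 : ∀ j : Fin t, col (some (Sum.inr j)) =
        min D ((∑ i, b i - m * p * D) - (j : ℕ) * D) := by
      intro j
      rw [hcolE, hE, coordEquiv_inr, Fin.val_natAdd, add_mul, Nat.sub_sub]
    simp_rw [h4]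
    rw [Fin.sum_univ_eq_sum_range fun j => min D ((∑ i, b i - m * p * D) - j * D), sum_min_sub]
    exact le_min hr (by omega)
  set e : Fin t → ℕ := fun j => p ^ (v + 1) - 1 - col (some (Sum.inr j)) with he
  have hvalid : validE (p ^ (v + 1)) r t e := by
    refine ⟨fun j => Nat.sub_le _ _, ?_⟩
    rw [he, sum_tsub_distrib _ fun j _ => hcoly j, sum_const, card_univ, Fintype.card_fin, smul_eq_mul]
    exact Nat.sub_le_sub_left hcolsum _
  have hzero := coeff_mul_eq_zero hR (h := blockTest
    (blockProd (β := Fin m) fun z : Fin p → F => MvPolynomial.eval z P) e) (fun T => by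
      by_contra hne
      refine hf T ⟨⟨e, hvalid⟩, ?_⟩
      simp_rw [hRf] at hne
      exact hne) a'
  have hP0 := coeff_topExp_ne_zero hp hP
  have hdeg := totalDegree_le_of_Pdef hp hP fun h => hP0 (by rw [h, MvPolynomial.coeff_zero])
  refine mul_ne_zero (mul_ne_zero ?_ ?_) ?_ hzero
  · rw [hrow]
    exact MvPolynomial.mem_support_iff.1 hb
  · refine prod_ne_zero_iff.2 fun i _ => ?_
    rw [Ne, CharP.cast_eq_zero_iff F p]
    obtain ⟨u, hu, hu'⟩ := h1 i
    have hspec := Nat.multinomial_spec univ (a' i)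
    have hsum : ∑ o, a' i o = b i := DFunLike.congr_fun hrow i
    have hprod : ∏ o, (a' i o).factorial = (c i).factorial * ∏ j, (a i j).factorial := by
      rw [Fintype.prod_option, ← Equiv.prod_comp E fun j => (a i j).factorial]
      rfl
    rw [hsum, hu', hprod, mul_comm, mul_assoc u] at hspec
    rwa [Nat.eq_of_mul_eq_mul_right (Nat.mul_pos (Nat.factorial_pos _)
      (prod_pos fun _ _ => Nat.factorial_pos _)) hspec]
  · have hswap : ∀ x : Fin m × Fin p ⊕ Fin t → F,
        ∏ i, ∏ o, hat x o ^ a' i o = ∏ o, hat x o ^ col o := by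
      intro x
      rw [prod_comm]
      exact prod_congr rfl fun o _ => prod_pow_eq_pow_sum _ _ _
    simp_rw [hswap]
    rw [sum_blockTest_mul _ _ _ hcolx]
    refine mul_ne_zero (pow_ne_zero _ ?_) (prod_ne_zero_iff.2 fun j _ => ?_)
    · rw [sum_monomial_mul_eval hp hF hdeg]
      exact mul_ne_zero (pow_ne_zero _ (neg_ne_zero.2 one_ne_zero)) hP0
    · have h5 : e j + col (some (Sum.inr j)) = Fintype.card F - 1 := by
        rw [hF]
        exact Nat.sub_add_cancel (hcoly j)
      rw [h5, sum_pow_card_sub_one]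
      exact neg_ne_zero.2 one_ne_zero

end LowDegree

/-! ### Translation to the coordinates of the statement -/

section Coordinates
variable {F : Type} [Field F] [Fintype F] {n m p t : ℕ}

/-- Affine maps as matrices with an extra column. -/
def affEquiv : Aff F n (m * p + t) ≃ (Fin n × Option (Fin m × Fin p ⊕ Fin t) → F) where
  toFun T io := io.2.elim (T.2 io.1) fun j => T.1 io.1 (coordEquiv m p t j)
  invFun T := (fun i j => T (i, some ((coordEquiv m p t).symm j)), fun i => T (i, none))
  left_inv T := by
    refine Prod.ext ?_ rfl
    funext i j
    simp
  right_inv T := by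
    funext ⟨i, o⟩
    cases o <;> simp

theorem affApp_eq (T : Aff F n (m * p + t)) (x : Fin (m * p + t) → F) :
    affApp T x = app (affEquiv T) fun j => x (coordEquiv m p t j) := by
  funext i
  rw [app_apply, Fintype.sum_option]
  simp only [affEquiv, Equiv.coe_fn_mk, Option.elim_none, Option.elim_some, hat, mul_one]
  rw [Equiv.sum_comp (coordEquiv m p t) fun j => T.1 i j * x j]
  exact add_comm _ _

theorem Hfun_eq (hp : 0 < p) (P : MvPolynomial (Fin p) F) (e : Fin t → ℕ)
    (x : Fin (m * p + t) → F) :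
    Hfun P (m * p) t e x =
      blockTest (blockProd (β := Fin m) fun z : Fin p → F => MvPolynomial.eval z P) e
        fun j => x (coordEquiv m p t j) := by
  unfold Hfun blockTest blockProd
  rw [Nat.mul_div_cancel _ hp, prod_range]
  congr 1
  refine prod_congr rfl fun i _ => ?_
  congr 2
  funext l
  have hval : (coordEquiv m p t (Sum.inl (i, l)) : ℕ) = (l : ℕ) + p * (i : ℕ) :=
    coordEquiv_inl m p t (i, l)
  have hlt : p * (i : ℕ) + l < m * p + t := by
    have := (coordEquiv m p t (Sum.inl (i, l))).2
    omega
  rw [dif_pos hlt]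
  congr 1
  ext
  simp only [hval]
  omega

theorem rejects_iff (hp : 0 < p) (P : MvPolynomial (Fin p) F) (q r : ℕ) (f : (Fin n → F) → F)
    (T : Aff F n (m * p + t)) :
    rejects P q (m * p) r t n f T ↔ Rej f (fun e : {e : Fin t → ℕ // validE q r t e} =>
      blockTest (blockProd (β := Fin m) fun z : Fin p → F => MvPolynomial.eval z P) e.1)
        (affEquiv T) := by
  have key : ∀ e, ip (fun x => f (affApp T x)) (Hfun P (m * p) t e) = rho f
      (blockTest (blockProd (β := Fin m) fun z : Fin p → F => MvPolynomial.eval z P) e)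
        (affEquiv T) := by
    intro e
    unfold ip rho
    rw [← Equiv.sum_comp ((coordEquiv m p t).symm.arrowCongr (Equiv.refl F))]
    refine sum_congr rfl fun x _ => ?_
    simp only [affApp_eq, Hfun_eq hp]
    simp [Equiv.arrowCongr, Function.comp_def]
  constructor
  · rintro ⟨e, he, hne⟩
    exact ⟨⟨e, he⟩, key e ▸ hne⟩
  · rintro ⟨⟨e, he⟩, hne⟩
    exact ⟨e, he, (key e).symm ▸ hne⟩

theorem mu_rejects (hp : 0 < p) (P : MvPolynomial (Fin p) F) (q r : ℕ) (f : (Fin n → F) → F) :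
    mu {T : Aff F n (m * p + t) | rejects P q (m * p) r t n f T} =
      ct (Rej f fun e : {e : Fin t → ℕ // validE q r t e} =>
        blockTest (blockProd (β := Fin m) fun z : Fin p → F => MvPolynomial.eval z P) e.1) /
      Fintype.card (Fin n × Option (Fin m × Fin p ⊕ Fin t) → F) := by
  have h : (Nat.card ↥{T : Aff F n (m * p + t) | rejects P q (m * p) r t n f T} : ℝ) =
      ct (Rej f fun e : {e : Fin t → ℕ // validE q r t e} =>
        blockTest (blockProd (β := Fin m) fun z : Fin p → F => MvPolynomial.eval z P) e.1) := by
    rw [← ct_equiv affEquiv]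
    refine (ct_eq_natCard fun T => rejects P q (m * p) r t n f T).symm.trans ?_
    exact congrArg ct (funext fun T => propext (rejects_iff hp P q r f T))
  unfold mu
  rw [h, Nat.card_congr (affEquiv (F := F) (n := n) (m := m) (p := p) (t := t)),
    Nat.card_eq_fintype_card]

theorem ncard_suppH (hp : 0 < p) (P : MvPolynomial (Fin p) F) (q : ℕ) :
    ((suppH P q (m * p) t).ncard : ℝ) = ct fun x : Fin m × Fin p ⊕ Fin t → F =>
      blockProd (fun z : Fin p → F => MvPolynomial.eval z P) (fun i => x (Sum.inl i)) ≠ 0 := by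
  rw [← ct_equiv ((coordEquiv m p t).symm.arrowCongr (Equiv.refl F)),
    ← Nat.card_coe_set_eq]
  refine (ct_eq_natCard fun x => x ∈ suppH P q (m * p) t).symm.trans ?_
  refine congrArg ct (funext fun x => propext ?_)
  change (∃ e : Fin t → ℕ, (∀ j, e j ≤ q - 1) ∧ Hfun P (m * p) t e x ≠ 0) ↔ _
  simp only [Hfun_eq hp]
  constructor
  · rintro ⟨e, -, he⟩
    exact left_ne_zero_of_mul he
  · intro h
    refine ⟨0, fun _ => Nat.zero_le _, ?_⟩
    simpa [blockTest, Equiv.arrowCongr, Function.comp_def] using h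

theorem deltaDist_le {f g : (Fin n → F) → F} {d : ℕ} (hg : fDegLE g d) :
    deltaDist f d ≤ ct (fun y => f y ≠ g y) / Fintype.card (Fin n → F) := by
  refine csInf_le ⟨0, ?_⟩ ⟨g, hg, ?_⟩
  · rintro _ ⟨g', -, rfl⟩
    positivity
  · rw [ct_eq_natCard]

end Coordinates

end SparseTester

open SparseTester

/-- There is an absolute constant `A` such that for every prime `p`,
prime power `q = p^k`, degree `d`, `n ≥ s + t + 100` and `f : F_q^n → F_q`, the sparse
`(s+t)`-flat tester rejects `f` with probability at least `q^{-A} · min(1, |supp(H)| · δ_d(f))`. -/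
theorem sparse_tester_optimal :
    ∃ A : ℕ, ∀ (p k : ℕ) (hp : p.Prime), 1 ≤ k →
    ∀ (F : Type) [Field F] [Fintype F],
    ∀ q : ℕ, q = p ^ k → Fintype.card F = q →
    ∀ d s r : ℕ, p ∣ s → 0 < r → r ≤ p * (q - q / p) → d + 1 = s * (q - q / p) + r →
    ∀ t : ℕ, t = max (p + 2) 10 →
    ∀ P : MvPolynomial (Fin p) F, Pdef p q hp.pos P →
    ∀ n : ℕ, s + t + 100 ≤ n →
    ∀ f : (Fin n → F) → F,
      (q : ℝ) ^ (-(A : ℤ)) * min 1 (((suppH P q s t).ncard : ℝ) * deltaDist f d) ≤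
        mu {T : Aff F n (s + t) | rejects P q s r t n f T} := by
  refine ⟨30, ?_⟩
  intro p k hp hk F _ _ q hq hF d s r hps _ hr hd t ht P hP n hn f
  classical
  obtain ⟨v, rfl⟩ : ∃ v, k = v + 1 := ⟨k - 1, (Nat.sub_add_cancel hk).symm⟩
  obtain ⟨m, rfl⟩ : ∃ m, s = m * p := hps.imp fun m h => h.trans (mul_comm p m)
  subst hq
  have hqp : p ^ (v + 1) / p = p ^ v := by rw [pow_succ, Nat.mul_div_cancel _ hp.pos]
  rw [hqp] at hr hd
  have : Fact p.Prime := ⟨hp⟩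
  have : CharP F p := charP_of_card_eq_prime_pow hF
  have hP0 := coeff_topExp_ne_zero hp hP
  have hdeg := totalDegree_le_of_Pdef hp hP fun h => hP0 (by rw [h, MvPolynomial.coeff_zero])
  have hpq : p ≤ p ^ (v + 1) := Nat.le_self_pow (by omega) p
  have hp2 := hp.two_le
  have hline : ∀ x a : Fin p → F, ∑ κ : F, MvPolynomial.eval (κ • x + a) P = 0 :=
    sum_line_eq_zero (by rw [hF]; omega)
  have hq2 : (2 : ℝ) ≤ (p ^ (v + 1) : ℕ) := by exact_mod_cast hp2.trans hpq
  rw [mu_rejects hp.pos, ncard_suppH hp.pos]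
  set q := p ^ (v + 1) with hq
  set S := Rej f fun e : {e : Fin t → ℕ // validE q r t e} =>
    blockTest (blockProd (β := Fin m) fun z : Fin p → F => MvPolynomial.eval z P) e.1 with hS
  set N : ℝ := (Fintype.card (Fin n × Option (Fin m × Fin p ⊕ Fin t) → F) : ℝ) with hN
  set Q : ℝ := (Fintype.card (Fin n → F) : ℝ) with hQ
  have hN0 : 0 < N := card_fun_pos
  have hQ0 : 0 < Q := card_fun_pos
  have hq0 : (0 : ℝ) < (q : ℝ) ^ 30 := by positivity
  have hS0 := ct_nonneg S
  rw [zpow_neg, zpow_natCast, inv_mul_le_iff₀ hq0]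
  rcases lt_or_ge N ((q : ℝ) ^ 30 * ct S) with hlarge | hsmall
  · refine (min_le_left _ _).trans ?_
    rw [← mul_div_assoc, le_div_iff₀ hN0, one_mul]
    exact hlarge.le
  · obtain ⟨f₁, hacc, hclose⟩ := exists_close_accepted (β := Fin m) (Y := Fin t)
      (V := validE q r t) (fun z : Fin p → F => MvPolynomial.eval z P) hline
      (by
        rintro e j ⟨h1, h2⟩
        have hle : ∀ i, Function.update e j 0 i ≤ e i := by
          intro i
          by_cases hi : i = j
          · subst hi
            simp
          · rw [Function.update_of_ne hi]
        exact ⟨fun i => (hle i).trans (h1 i), (sum_le_sum fun i _ => hle i).trans h2⟩)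
      ⟨fun _ => Nat.zero_le _, by simp⟩
      (by
        rw [Fintype.card_fin, hF]
        have : t ≤ 10 * q := by
          rw [ht]
          omega
        exact_mod_cast this)
      (by
        rw [Fintype.card_fun, Fintype.card_fun, Fintype.card_sum, Fintype.card_prod,
          Fintype.card_fin, Fintype.card_fin, Fintype.card_fin, Fintype.card_fin, hF]
        push_cast
        calc 8 * (q : ℝ) ^ (m * p + t) = 2 ^ 3 * (q : ℝ) ^ (m * p + t) := by norm_num
          _ ≤ (q : ℝ) ^ 3 * (q : ℝ) ^ (m * p + t) := by gcongr
          _ = (q : ℝ) ^ (3 + (m * p + t)) := (pow_add _ _ _).symm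
          _ ≤ (q : ℝ) ^ n := pow_le_pow_right₀ (by linarith) (by omega))
      f (by rw [hF]; exact hsmall)
    have hdegree : fDegLE f₁ d := by
      refine fDegLE_of_accepted hp hF hP (hr.trans (Nat.mul_le_mul_right _ ?_)) hd f₁ hacc
      rw [ht]
      omega
    refine (min_le_right _ _).trans ?_
    refine (mul_le_mul_of_nonneg_left (deltaDist_le hdegree) (ct_nonneg _)).trans ?_
    rw [← mul_div_assoc, ← mul_div_assoc, div_le_div_iff₀ hQ0 hN0]
    refine hclose.trans ?_
    have h2 : (2 : ℝ) ≤ (q : ℝ) ^ 30 := hq2.trans (le_self_pow₀ (by linarith) (by norm_num))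
    calc 2 * (Q * ct S) ≤ (q : ℝ) ^ 30 * (Q * ct S) := by gcongr
      _ = (q : ℝ) ^ 30 * ct S * Q := by ring

end
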